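/- arXiv:1504.00503 — 5 statements merged into one kernel-verified Lean document; each statement's English description precedes it below -/
import Mathlib

section
/- Let q be a prime power, r ≥ 2 an even integer, a ∈ F\{0} and b ∈ F with b^q ≠ b, where F = GF(q²). Suppose that either q is odd and 4a^{q+1} + (b^q − b)² is a non-zero square of GF(q), or q is even and Tr_q(a^{q+1}/(b^q + b)²) = 1. Let t be the minimum of |π ∩ B(a,b)| over all affine hyperplanes π of F^r. Then t ≥ 1 and for every point P ∈ B(a,b) there exists an affine hyperplane π of F^r with P ∈ π and |π ∩ B(a,b)| = t; that is, B(a,b) is a minimal t-fold blocking set with respect to the hyperplanes of AG(r,q²). -/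
open Finset

/-- The affine point set `B(a,b) ⊆ AG(r,q²)`: a point of `F^r` is encoded as a pair
consisting of its first `r - 1` coordinates `(x₁, …, x_{r-1})` together with its last
coordinate `x_r`.  It consists of the solutions of
`x_r^q − x_r + a^q(x₁^{2q}+⋯+x_{r−1}^{2q}) − a(x₁²+⋯+x_{r−1}²)
  = (b^q − b)(x₁^{q+1}+⋯+x_{r−1}^{q+1})`. -/
def BSet (q r : ℕ) {F : Type*} [Field F] (a b : F) :
    Set ((Fin (r - 1) → F) × F) :=
  {x | x.2 ^ q - x.2 + a ^ q * (∑ i, x.1 i ^ (2 * q)) - a * (∑ i, x.1 i ^ 2)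
      = (b ^ q - b) * ∑ i, x.1 i ^ (q + 1)}

/-- The minimum, over all affine hyperplanes `π` of `F^r`, of `|π ∩ B(a,b)|`. -/
noncomputable def tmin (q r : ℕ) {F : Type*} [Field F] (a b : F) : ℕ :=
  sInf {n : ℕ | ∃ (c : Fin (r - 1) → F) (c0 d : F), ¬(c = 0 ∧ c0 = 0) ∧
    n = ({x : (Fin (r - 1) → F) × F | (∑ i, c i * x.1 i) + c0 * x.2 = d}
          ∩ BSet q r a b).ncard}

/-- the quadratic form in one variable -/
def hform {F : Type*} [Field F] (φ : F →+* F) (a b x : F) : F :=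
  (φ b - b) * (x * φ x) + a * x ^ 2 - φ a * φ x ^ 2

/-- number of solutions of `Σ h(x_i) = k` -/
noncomputable def Nk {F : Type*} [Field F] (φ : F →+* F) (a b : F) (m : ℕ) (k : F) : ℕ :=
  Nat.card {x : Fin m → F // ∑ i, hform φ a b (x i) = k}

noncomputable def Mk (E : Type*) [Field E] (m : ℕ) (e : E) : ℕ :=
  Nat.card {p : (Fin m → E) × (Fin m → E) // ∑ i, p.1 i * p.2 i = e}

lemma exists_v {E : Type*} [Field E] (m : ℕ) :
    ∃ v : (Fin m → E) → (Fin m → E), ∀ α, α ≠ 0 → ∑ i, α i * v α i = 1 := by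
  have : ∀ α : Fin m → E, ∃ w : Fin m → E, α ≠ 0 → ∑ i, α i * w i = 1 := by
    intro α
    by_cases h : α = 0
    · exact ⟨0, fun h' => absurd h h'⟩
    · obtain ⟨j, hj⟩ := Function.ne_iff.mp h
      refine ⟨Pi.single j (α j)⁻¹, fun _ => ?_⟩
      rw [Finset.sum_eq_single j]
      · simpa using mul_inv_cancel₀ hj
      · intro i _ hij
        simp [Pi.single_eq_of_ne hij]
      · simp
  choose v hv using this
  exact ⟨v, hv⟩

lemma ne_zero_of_dot {E : Type*} [Field E] {m : ℕ} {e : E} (he : e ≠ 0)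
    {α β : Fin m → E} (h : ∑ i, α i * β i = e) : α ≠ 0 := by
  rintro rfl
  simp at h
  exact he h.symm

lemma Mk_facts (E : Type*) [Field E] [Finite E] (m : ℕ) (hm : 1 ≤ m) :
    1 ≤ Mk E m 1 ∧ (∀ e : E, e ≠ 0 → Mk E m e = Mk E m 1) ∧ Mk E m 1 ≤ Mk E m 0 ∧
    Nat.card E * Mk E m 1 ≤ Nat.card ((Fin m → E) × (Fin m → E)) := by
  obtain ⟨v, hv⟩ := exists_v (E := E) m
  refine ⟨?_, ?_, ?_, ?_⟩
  · have : Nonempty {p : (Fin m → E) × (Fin m → E) // ∑ i, p.1 i * p.2 i = 1} := by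
      have h1 : (fun _ => 1 : Fin m → E) ≠ 0 := by
        intro h
        exact one_ne_zero (congrFun h ⟨0, hm⟩)
      exact ⟨⟨(_, _), hv _ h1⟩⟩
    exact Nat.card_pos
  · intro e he
    refine Nat.card_congr ⟨fun p => ⟨(fun i => e⁻¹ * p.1.1 i, p.1.2), ?_⟩,
      fun p => ⟨(fun i => e * p.1.1 i, p.1.2), ?_⟩, ?_, ?_⟩
    · simp only [mul_assoc]
      rw [← Finset.mul_sum, p.2, inv_mul_cancel₀ he]
    · simp only [mul_assoc]
      rw [← Finset.mul_sum, p.2, mul_one]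
    · intro p
      ext <;> simp [he]
    · intro p
      ext <;> simp [he]
  · refine Nat.card_le_card_of_injective
      (fun p => ⟨(p.1.1, p.1.2 - v p.1.1), ?_⟩) ?_
    · have := ne_zero_of_dot one_ne_zero p.2
      simp only [Pi.sub_apply, mul_sub, Finset.sum_sub_distrib, p.2, hv _ this, sub_self]
    · rintro ⟨⟨α, β⟩, h⟩ ⟨⟨α', β'⟩, h'⟩ heq
      simp only [Subtype.mk.injEq, Prod.mk.injEq] at heq ⊢
      obtain ⟨rfl, h2⟩ := heq
      exact ⟨rfl, sub_left_injective h2⟩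
  · unfold Mk
    rw [← Nat.card_prod]
    refine Nat.card_le_card_of_injective
      (fun p => (p.2.1.1, p.2.1.2 - p.1 • v p.2.1.1)) ?_
    rintro ⟨t, ⟨⟨α, β⟩, h⟩⟩ ⟨t', ⟨⟨α', β'⟩, h'⟩⟩ heq
    simp only [Prod.mk.injEq] at heq
    obtain ⟨rfl, h2⟩ := heq
    have hα := hv _ (ne_zero_of_dot one_ne_zero h)
    have key : ∀ (t : E) (β : Fin m → E), ∑ i, α i * β i = 1 →
        ∑ i, α i * (β - t • v α) i = 1 - t := by
      intro t β h
      simp only [Pi.sub_apply, Pi.smul_apply, smul_eq_mul, mul_sub, Finset.sum_sub_distrib, h]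
      simp only [mul_left_comm _ t]
      rw [← Finset.mul_sum, hα, mul_one]
    have k1 := key t β h
    rw [h2, key t' β' h'] at k1
    have ht : t = t' := by linear_combination k1
    subst ht
    have : β = β' := sub_left_injective h2
    subst this
    rfl

section core
variable {F : Type*} [Field F] (φ : F →+* F)

lemma exists_norm_one (hφ : ∀ x, φ (φ x) = x) (b : F) (hb : φ b ≠ b) (z : F) (hz : z * φ z = 1) :
    ∃ x, x ≠ 0 ∧ φ x = z * x := by
  have key : ∀ θ, φ (θ + φ z * φ θ) = z * (θ + φ z * φ θ) := by
    intro θ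
    simp only [map_add, map_mul, hφ]
    linear_combination -(φ θ) * hz
  by_cases h1 : (1 : F) + φ z * φ 1 = 0
  · refine ⟨b + φ z * φ b, ?_, key b⟩
    intro h
    apply hb
    rw [map_one] at h1
    linear_combination -h + φ b * h1
  · exact ⟨_, h1, key 1⟩

lemma coords (hφ : ∀ x, φ (φ x) = x) (a b : F) (ha : a ≠ 0) (hb : φ b ≠ b)
    (hD : 4 * (a * φ a) + (φ b - b) ^ 2 ≠ 0) (z₁ z₂ : F) (hz₁ : z₁ * φ z₁ = 1)
    (hz₂ : z₂ * φ z₂ = 1) (hs : φ a * (z₁ + z₂) = φ b - b) (hp : φ a * (z₁ * z₂) = -a) :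
    ∃ x₁ x₂ κ : F, κ ≠ 0 ∧ φ κ = -κ ∧
      (∀ α β : F, φ α = α → φ β = β → hform φ a b (α * x₁ + β * x₂) = κ * (α * β)) ∧
      (∀ α β α' β' : F, φ α = α → φ β = β → φ α' = α' → φ β' = β' →
        α * x₁ + β * x₂ = α' * x₁ + β' * x₂ → α = α' ∧ β = β') ∧
      (∀ x, ∃ α β, φ α = α ∧ φ β = β ∧ α * x₁ + β * x₂ = x) := by
  obtain ⟨x₁, h1, e1⟩ := exists_norm_one φ hφ b hb z₁ hz₁
  obtain ⟨x₂, h2, e2⟩ := exists_norm_one φ hφ b hb z₂ hz₂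
  have ha' : φ a ≠ 0 := (map_ne_zero φ).mpr ha
  have hz : z₁ - z₂ ≠ 0 := by
    intro h
    apply hD
    rw [← hs]
    linear_combination (φ a) ^ 2 * (z₁ - z₂) * h - 4 * φ a * (- hp)
  refine ⟨x₁, x₂, (φ b - b) * (x₁ * φ x₂ + φ x₁ * x₂) + 2 * a * x₁ * x₂
    - 2 * φ a * φ x₁ * φ x₂, ?_, ?_, ?_, ?_, ?_⟩
  · intro h
    rw [e1, e2] at h
    have : (4 * (a * φ a) + (φ b - b) ^ 2) * (x₁ * x₂) = 0 := by
      linear_combination φ a * h - (φ b - b) * x₁ * x₂ * hs + 2 * φ a * x₁ * x₂ * hp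
    rcases mul_eq_zero.mp this with h | h
    · exact hD h
    · exact mul_ne_zero h1 h2 h
  · simp only [map_sub, map_add, map_mul, hφ, map_ofNat]
    ring
  · intro α β hα hβ
    simp only [hform, map_add, map_mul, hα, hβ]
    rw [e1, e2]
    linear_combination (-α ^ 2 * x₁ ^ 2 * z₁ - β ^ 2 * x₂ ^ 2 * z₂) * hs +
      (α ^ 2 * x₁ ^ 2 + β ^ 2 * x₂ ^ 2) * hp
  · intro α β α' β' hα hβ hα' hβ' h
    have h' := congrArg φ h
    simp only [map_add, map_mul, hα, hβ, hα', hβ', e1, e2] at h'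
    constructor
    · have : (α - α') * ((z₁ - z₂) * x₁) = 0 := by linear_combination h' - z₂ * h
      rcases mul_eq_zero.mp this with h | h
      · exact sub_eq_zero.mp h
      · exact absurd h (mul_ne_zero hz h1)
    · have : (β - β') * ((z₁ - z₂) * x₂) = 0 := by linear_combination z₁ * h - h'
      rcases mul_eq_zero.mp this with h | h
      · exact sub_eq_zero.mp h
      · exact absurd h (mul_ne_zero hz h2)
  · intro x
    have hz1' : φ z₁ ≠ 0 := right_ne_zero_of_mul_eq_one hz₁
    have hz2' : φ z₂ ≠ 0 := right_ne_zero_of_mul_eq_one hz₂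
    have hφz : φ z₁ - φ z₂ ≠ 0 := by
      rw [← map_sub]; exact (map_ne_zero φ).mpr hz
    have hz10 : z₁ ≠ 0 := left_ne_zero_of_mul_eq_one hz₁
    have hz20 : z₂ ≠ 0 := left_ne_zero_of_mul_eq_one hz₂
    refine ⟨(φ x - z₂ * x) / ((z₁ - z₂) * x₁), (z₁ * x - φ x) / ((z₁ - z₂) * x₂), ?_, ?_, ?_⟩
    · simp only [map_div₀, map_sub, map_mul, hφ, e1]
      rw [div_eq_div_iff (mul_ne_zero hφz (mul_ne_zero hz10 h1)) (mul_ne_zero hz h1)]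
      linear_combination (-φ x * x₁ + x * z₂ * x₁) * hz₁ + (φ x * x₁ - x * z₁ * x₁) * hz₂
    · simp only [map_div₀, map_sub, map_mul, hφ, e2]
      rw [div_eq_div_iff (mul_ne_zero hφz (mul_ne_zero hz20 h2)) (mul_ne_zero hz h2)]
      linear_combination (φ x * x₂ - z₂ * x * x₂) * hz₁ + (z₁ * x * x₂ - φ x * x₂) * hz₂
    · field_simp
      ring

lemma Nk_facts [Finite F] (hφ : ∀ x, φ (φ x) = x) (a b : F) (ha : a ≠ 0) (hb : φ b ≠ b)
    (hD : 4 * (a * φ a) + (φ b - b) ^ 2 ≠ 0) (z₁ z₂ : F) (hz₁ : z₁ * φ z₁ = 1)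
    (hz₂ : z₂ * φ z₂ = 1) (hs : φ a * (z₁ + z₂) = φ b - b) (hp : φ a * (z₁ * z₂) = -a)
    (m : ℕ) (hm : 1 ≤ m) :
    ∃ A : ℕ, 1 ≤ A ∧ (∀ k, k ≠ 0 → φ k = -k → Nk φ a b m k = A) ∧ A ≤ Nk φ a b m 0 ∧
      Nat.card {x : F // φ x = x} * A ≤ Nat.card (Fin m → F) ∧
      Nat.card {x : F // φ x = x} * Nat.card {x : F // φ x = x} = Nat.card F ∧
      ∃ v : Fin m → F, ∑ i, hform φ a b (v i) ≠ 0 := by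
  obtain ⟨x₁, x₂, κ, hκ, hκφ, hh, hinj, hsurj⟩ :=
    coords φ hφ a b ha hb hD z₁ z₂ hz₁ hz₂ hs hp
  let E : Subfield F := φ.eqLocusField (RingHom.id F)
  have hE : ∀ x : E, φ x = x := fun x => x.2
  have cE : Nat.card E = Nat.card {x : F // φ x = x} := rfl
  obtain ⟨m1, m2, m3, m4⟩ := Mk_facts E m hm
  let f : E × E → F := fun p => p.1 * x₁ + p.2 * x₂
  have fbij : Function.Bijective f := by
    constructor
    · rintro ⟨α, β⟩ ⟨α', β'⟩ h
      obtain ⟨h1, h2⟩ := hinj _ _ _ _ (hE α) (hE β) (hE α') (hE β') h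
      exact Prod.ext (Subtype.ext h1) (Subtype.ext h2)
    · intro x
      obtain ⟨α, β, h1, h2, h3⟩ := hsurj x
      exact ⟨(⟨α, h1⟩, ⟨β, h2⟩), h3⟩
  let e := Equiv.ofBijective f fbij
  let g : (Fin m → E) × (Fin m → E) ≃ (Fin m → F) :=
    (Equiv.arrowProdEquivProdArrow (Fin m) (fun _ => E) (fun _ => E)).symm.trans
      (Equiv.arrowCongr (Equiv.refl _) e)
  have hg : ∀ p i, g p i = p.1 i * x₁ + p.2 i * x₂ := fun p i => rfl
  have hsum : ∀ p, ∑ i, hform φ a b (g p i) = κ * ((∑ i, p.1 i * p.2 i : E) : F) := by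
    intro p
    push_cast
    rw [Finset.mul_sum]
    refine Finset.sum_congr rfl fun i _ => ?_
    rw [hg, hh _ _ (hE _) (hE _)]
  have hNM : ∀ t : E, Nk φ a b m (κ * t) = Mk E m t := by
    intro t
    refine (Nat.card_congr (Equiv.subtypeEquiv g fun p => ?_)).symm
    rw [hsum]
    constructor
    · intro h; rw [h]
    · intro h; exact Subtype.ext (mul_left_cancel₀ hκ h)
  refine ⟨Mk E m 1, m1, ?_, ?_, ?_, ?_, ?_⟩
  · intro k hk hkφ
    have : φ (k / κ) = k / κ := by rw [map_div₀, hkφ, hκφ, neg_div_neg_eq]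
    have h2 := hNM ⟨k / κ, this⟩
    rw [m2 _ (by
      intro h
      exact div_ne_zero hk hκ (congrArg Subtype.val h))] at h2
    rw [← h2]
    congr 1
    field_simp
  · have := hNM 0
    simp only [ZeroMemClass.coe_zero, mul_zero] at this
    rw [this]
    exact m3
  · rw [← cE, ← Nat.card_congr g]
    exact m4
  · rw [← cE, ← Nat.card_prod]
    exact Nat.card_congr e
  · obtain ⟨v, hv⟩ := exists_v (E := E) m
    have h1 : (fun _ => 1 : Fin m → E) ≠ 0 := by
      intro h
      exact one_ne_zero (congrFun h ⟨0, hm⟩)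
    refine ⟨g (fun _ => 1, v fun _ => 1), ?_⟩
    rw [hsum, hv _ h1]
    simpa using hκ

lemma hform_neg (hφ : ∀ x, φ (φ x) = x) (a b x : F) :
    φ (hform φ a b x) = -hform φ a b x := by
  simp only [hform, map_sub, map_add, map_mul, map_pow, hφ]
  ring

/-- The affine set in terms of `φ`. -/
lemma mem_BSet_iff (q r : ℕ) (hφq : ∀ x, φ x = x ^ q) (a b : F) (x : (Fin (r - 1) → F) × F) :
    x ∈ BSet q r a b ↔ φ x.2 - x.2 = ∑ i, hform φ a b (x.1 i) := by
  have e : ∑ i, hform φ a b (x.1 i) = (b ^ q - b) * ∑ i, x.1 i ^ (q + 1)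
      - (a ^ q * (∑ i, x.1 i ^ (2 * q)) - a * (∑ i, x.1 i ^ 2)) := by
    simp only [Finset.mul_sum, ← Finset.sum_sub_distrib]
    refine Finset.sum_congr rfl fun i _ => ?_
    simp only [hform, hφq]
    ring
  rw [e, hφq]
  simp only [BSet, Set.mem_setOf_eq]
  constructor <;> intro h <;> linear_combination h

lemma section_card (q r : ℕ) (hφq : ∀ x, φ x = x ^ q) (hφ : ∀ x, φ (φ x) = x) (a b : F)
    (u : Fin (r - 1) → F) (c : Fin (r - 1) → F) (c0 d : F) (hc0 : c0 ≠ 0)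
    (hc : ∀ i, c i = -c0 * ((φ b - b) * φ (u i) + 2 * a * u i)) :
    ({x : (Fin (r - 1) → F) × F | (∑ i, c i * x.1 i) + c0 * x.2 = d}
          ∩ BSet q r a b).ncard =
      Nk φ a b (r - 1) (φ (d / c0) - d / c0 + ∑ i, hform φ a b (u i)) := by
  have key : ∀ x : Fin (r - 1) → F, ∀ y : F, (∑ i, c i * x i) + c0 * y = d →
      ((φ y - y = ∑ i, hform φ a b (x i)) ↔ ∑ i, hform φ a b (x i + u i) =
        φ (d / c0) - d / c0 + ∑ i, hform φ a b (u i)) := by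
    intro x y h
    have hy : d / c0 = y - ∑ i, ((φ b - b) * φ (u i) + 2 * a * u i) * x i := by
      rw [← h, add_div, mul_div_cancel_left₀ _ hc0, Finset.sum_div, sub_eq_add_neg, add_comm,
        ← Finset.sum_neg_distrib]
      congr 1
      refine Finset.sum_congr rfl fun i _ => ?_
      rw [hc]
      field_simp
    have e : ∑ i, hform φ a b (x i + u i) = ∑ i, hform φ a b (x i) + ∑ i, hform φ a b (u i)
        - (φ (∑ i, ((φ b - b) * φ (u i) + 2 * a * u i) * x i)
          - ∑ i, ((φ b - b) * φ (u i) + 2 * a * u i) * x i) := by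
      rw [map_sum, ← Finset.sum_sub_distrib, ← Finset.sum_add_distrib, ← Finset.sum_sub_distrib]
      refine Finset.sum_congr rfl fun i _ => ?_
      simp only [hform, map_sub, map_add, map_mul, hφ, map_ofNat]
      ring
    rw [e, hy, map_sub]
    constructor <;> intro h <;> linear_combination -h
  have hsol : ∀ x : Fin (r - 1) → F, (∑ i, c i * x i) + c0 * ((d - ∑ i, c i * x i) / c0) = d := by
    intro x
    field_simp
    ring
  rw [← Nat.card_coe_set_eq]
  refine Nat.card_congr ⟨fun p => ⟨p.1.1 + u, ?_⟩,
    fun x => ⟨(x.1 - u, (d - ∑ i, c i * (x.1 - u) i) / c0), ?_, ?_⟩, ?_, ?_⟩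
  · obtain ⟨⟨x, y⟩, h1, h2⟩ := p
    rw [mem_BSet_iff φ q r hφq] at h2
    exact (key x y h1).mp h2
  · exact hsol _
  · rw [mem_BSet_iff φ q r hφq]
    refine (key _ _ (hsol _)).mpr ?_
    simpa using x.2
  · rintro ⟨⟨x, y⟩, h1, h2⟩
    have h1' : (∑ i, c i * x i) + c0 * y = d := h1
    have hx : x + u - u = x := add_sub_cancel_right x u
    apply Subtype.ext
    refine Prod.ext hx ?_
    change (d - ∑ i, c i * (x + u - u) i) / c0 = y
    rw [hx, ← h1']
    field_simp
    ring
  · intro x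
    simp

lemma section_card_zero [Finite F] (q r : ℕ) (hφq : ∀ x, φ x = x ^ q) (hφ : ∀ x, φ (φ x) = x)
    (a b : F) (hb : φ b ≠ b) (c : Fin (r - 1) → F) (hc : c ≠ 0) (d : F)
    (hE : Nat.card {x : F // φ x = x} * Nat.card {x : F // φ x = x} = Nat.card F) :
    Nat.card (Fin (r - 1) → F) ≤ Nat.card {x : F // φ x = x} *
    ({x : (Fin (r - 1) → F) × F | (∑ i, c i * x.1 i) + 0 * x.2 = d}
          ∩ BSet q r a b).ncard := by
  obtain ⟨v, hv⟩ : ∃ v : Fin (r - 1) → F, ∑ i, c i * v i = 1 := by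
    obtain ⟨v, hv⟩ := exists_v (E := F) (r - 1)
    exact ⟨v c, hv c hc⟩
  have hb' : φ b - b ≠ 0 := sub_ne_zero.mpr hb
  have hb2 : b - φ b ≠ 0 := sub_ne_zero.mpr (Ne.symm hb)
  have h1 : Nat.card (Fin (r - 1) → F) ≤
      Nat.card F * Nat.card {x : Fin (r - 1) → F // ∑ i, c i * x i = d} := by
    rw [← Nat.card_prod]
    refine Nat.card_le_card_of_injective
      (fun x => (∑ i, c i * x i - d, ⟨x - (∑ i, c i * x i - d) • v, ?_⟩)) ?_
    · simp only [Pi.sub_apply, Pi.smul_apply, smul_eq_mul, mul_sub, Finset.sum_sub_distrib]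
      simp only [mul_left_comm (c _)]
      rw [← Finset.mul_sum, hv]
      ring
    · intro x y h
      simp only [Prod.mk.injEq, Subtype.mk.injEq] at h
      obtain ⟨h1, h2⟩ := h
      rw [h1] at h2
      exact sub_left_injective h2
  have h2 : Nat.card {x : F // φ x = x} * Nat.card {x : Fin (r - 1) → F // ∑ i, c i * x i = d} ≤
    ({x : (Fin (r - 1) → F) × F | (∑ i, c i * x.1 i) + 0 * x.2 = d}
          ∩ BSet q r a b).ncard := by
    rw [← Nat.card_coe_set_eq, ← Nat.card_prod]
    refine Nat.card_le_card_of_injective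
      (fun p => ⟨(p.2.1, (∑ i, hform φ a b (p.2.1 i)) * (b / (φ b - b)) + p.1.1), ?_, ?_⟩) ?_
    · simpa using p.2.2
    · rw [mem_BSet_iff φ q r hφq]
      have : φ (∑ i, hform φ a b (p.2.1 i)) = - ∑ i, hform φ a b (p.2.1 i) := by
        rw [map_sum, ← Finset.sum_neg_distrib]
        exact Finset.sum_congr rfl fun i _ => hform_neg φ hφ a b _
      simp only [map_add, map_mul, map_div₀, map_sub, hφ, this, p.1.2]
      have e : φ b / (b - φ b) = - (φ b / (φ b - b)) := by
        rw [← neg_sub, div_neg]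
      rw [e]
      field_simp
      ring
    · rintro ⟨t, x⟩ ⟨t', x'⟩ h
      simp only [Prod.mk.injEq, Subtype.mk.injEq] at h
      obtain ⟨h1, h2⟩ := h
      have hx : x = x' := Subtype.ext h1
      subst hx
      have : t = t' := Subtype.ext (add_left_cancel h2)
      rw [this]
  calc _ ≤ _ := h1
    _ = Nat.card {x : F // φ x = x} * (Nat.card {x : F // φ x = x} *
        Nat.card {x : Fin (r - 1) → F // ∑ i, c i * x i = d}) := by rw [← hE, mul_assoc]
    _ ≤ _ := Nat.mul_le_mul_left _ h2

lemma exists_u [Finite F] (hφ : ∀ x, φ (φ x) = x) (a b : F) (hb : φ b ≠ b)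
    (hD : 4 * (a * φ a) + (φ b - b) ^ 2 ≠ 0) (w : F) :
    ∃ u, (φ b - b) * φ u + 2 * a * u = w := by
  have hinj : Function.Injective (fun u => (φ b - b) * φ u + 2 * a * u) := by
    intro u u' h
    simp only at h
    by_contra hne
    have hw : u - u' ≠ 0 := sub_ne_zero.mpr hne
    have e1 : (φ b - b) * φ (u - u') + 2 * a * (u - u') = 0 := by
      rw [map_sub]; linear_combination h
    have e2 := congrArg φ e1
    simp only [map_add, map_sub, map_mul, hφ, map_ofNat, map_zero] at e2
    rw [map_sub] at e1
    have : (4 * (a * φ a) + (φ b - b) ^ 2) * (u - u') = 0 := by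
      linear_combination 2 * φ a * e1 - (φ b - b) * e2
    rcases mul_eq_zero.mp this with h | h
    · exact hD h
    · exact hw h
  exact Finite.surjective_of_injective hinj w

lemma core_main [Finite F] (q r : ℕ) (hr : 2 ≤ r) (hφq : ∀ x, φ x = x ^ q)
    (hφ : ∀ x, φ (φ x) = x) (a b : F) (ha : a ≠ 0) (hb : φ b ≠ b)
    (hD : 4 * (a * φ a) + (φ b - b) ^ 2 ≠ 0) (z₁ z₂ : F) (hz₁ : z₁ * φ z₁ = 1)
    (hz₂ : z₂ * φ z₂ = 1) (hs : φ a * (z₁ + z₂) = φ b - b) (hp : φ a * (z₁ * z₂) = -a) :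
    1 ≤ tmin q r a b ∧
    ∀ P ∈ BSet q r a b, ∃ (c : Fin (r - 1) → F) (c0 d : F), ¬(c = 0 ∧ c0 = 0) ∧
      (∑ i, c i * P.1 i) + c0 * P.2 = d ∧
      ({x : (Fin (r - 1) → F) × F | (∑ i, c i * x.1 i) + c0 * x.2 = d}
          ∩ BSet q r a b).ncard = tmin q r a b := by
  obtain ⟨A, hA1, hAk, hA0, hAE, hEE, v, hv⟩ :=
    Nk_facts φ hφ a b ha hb hD z₁ z₂ hz₁ hz₂ hs hp (r - 1) (by omega)
  have hneg : ∀ x : Fin (r - 1) → F,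
      φ (∑ i, hform φ a b (x i)) = - ∑ i, hform φ a b (x i) := by
    intro x
    rw [map_sum, ← Finset.sum_neg_distrib]
    exact Finset.sum_congr rfl fun i _ => hform_neg φ hφ a b _
  have hEpos : 0 < Nat.card {x : F // φ x = x} := by
    have : Nonempty {x : F // φ x = x} := ⟨⟨0, map_zero φ⟩⟩
    exact Nat.card_pos
  have lower : ∀ (c : Fin (r - 1) → F) (c0 d : F), ¬(c = 0 ∧ c0 = 0) →
      A ≤ ({x : (Fin (r - 1) → F) × F | (∑ i, c i * x.1 i) + c0 * x.2 = d}
          ∩ BSet q r a b).ncard := by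
    intro c c0 d hc
    by_cases h0 : c0 = 0
    · subst h0
      have := section_card_zero φ q r hφq hφ a b hb c (fun h => hc ⟨h, rfl⟩) d hEE
      exact Nat.le_of_mul_le_mul_left (hAE.trans this) hEpos
    · choose u hu using fun i => exists_u φ hφ a b hb hD (-(c i / c0))
      rw [section_card φ q r hφq hφ a b u c c0 d h0 (by
        intro i; rw [hu]; field_simp)]
      set k := φ (d / c0) - d / c0 + ∑ i, hform φ a b (u i) with hk
      have hkφ : φ k = -k := by
        rw [hk, map_add, map_sub, hφ, hneg]
        ring
      by_cases hk0 : k = 0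
      · rw [hk0]; exact hA0
      · rw [hAk k hk0 hkφ]
  have upper : ∀ P ∈ BSet q r a b, ∃ (c : Fin (r - 1) → F) (c0 d : F), ¬(c = 0 ∧ c0 = 0) ∧
      (∑ i, c i * P.1 i) + c0 * P.2 = d ∧
      ({x : (Fin (r - 1) → F) × F | (∑ i, c i * x.1 i) + c0 * x.2 = d}
          ∩ BSet q r a b).ncard = A := by
    intro P hP
    let u : Fin (r - 1) → F := v - P.1
    let c : Fin (r - 1) → F := fun i => -1 * ((φ b - b) * φ (u i) + 2 * a * u i)
    refine ⟨c, 1, _, fun h => one_ne_zero h.2, rfl, ?_⟩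
    rw [section_card φ q r hφq hφ a b u c 1 _ one_ne_zero (fun i => rfl)]
    rw [mem_BSet_iff φ q r hφq] at hP
    have e : φ ((∑ i, c i * P.1 i + 1 * P.2) / 1) - (∑ i, c i * P.1 i + 1 * P.2) / 1
        + ∑ i, hform φ a b (u i) = ∑ i, hform φ a b (v i) := by
      rw [div_one, one_mul, map_add]
      have e2 : ∑ i, hform φ a b (v i) = φ (∑ i, c i * P.1 i) - ∑ i, c i * P.1 i +
          ∑ i, hform φ a b (P.1 i) + ∑ i, hform φ a b (u i) := by
        rw [map_sum, ← Finset.sum_sub_distrib, ← Finset.sum_add_distrib,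
          ← Finset.sum_add_distrib]
        refine Finset.sum_congr rfl fun i _ => ?_
        simp only [c, u, hform, Pi.sub_apply, map_sub, map_add, map_mul, map_neg, map_one, hφ,
          map_ofNat]
        ring
      rw [e2]
      linear_combination hP
    rw [e]
    exact hAk _ hv (hneg v)
  have ht : tmin q r a b = A := by
    apply le_antisymm
    · have h0 : ((0, 0) : (Fin (r - 1) → F) × F) ∈ BSet q r a b := by
        rw [mem_BSet_iff φ q r hφq]
        simp [hform]
      obtain ⟨c, c0, d, h1, _, h3⟩ := upper _ h0
      exact Nat.sInf_le ⟨c, c0, d, h1, h3.symm⟩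
    · refine le_csInf ?_ ?_
      · exact ⟨_, 0, 1, 0, fun h => one_ne_zero h.2, rfl⟩
      · rintro n ⟨c, c0, d, h, rfl⟩
        exact lower c c0 d h
  rw [ht]
  exact ⟨hA1, upper⟩

end core

lemma exists_artin_schreier {F : Type*} [Field F] [Fintype F] (q h : ℕ)
    (hF : Fintype.card F = q ^ 2) (hqh : q = 2 ^ h) (h2 : (2 : F) = 0) (N : F)
    (hN : ∑ i ∈ Finset.range h, N ^ 2 ^ i = 1) :
    ∃ w : F, w ^ 2 + w + N = 0 ∧ w ^ q = w + 1 := by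
  have : CharP F 2 := (CharP.charP_iff_prime_eq_zero Nat.prime_two).mpr (by exact_mod_cast h2)
  let K := AlgebraicClosure F
  have : CharP K 2 := charP_of_injective_algebraMap (algebraMap F K).injective 2
  let ι := algebraMap F K
  obtain ⟨w, hw⟩ : ∃ w : K, w ^ 2 + w + ι N = 0 := by
    have hdeg : (Polynomial.X ^ 2 + Polynomial.X + Polynomial.C (ι N)).degree = 2 := by
      compute_degree!
    obtain ⟨w, hw⟩ := IsAlgClosed.exists_root
      (Polynomial.X ^ 2 + Polynomial.X + Polynomial.C (ι N)) (by rw [hdeg]; decide)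
    exact ⟨w, by simpa using hw⟩
  have h2K : (2 : K) = 0 := by exact_mod_cast CharP.cast_eq_zero K 2
  have hw' : w ^ 2 = w + ι N := by linear_combination hw - (w + ι N) * h2K
  have hpow : ∀ n, w ^ 2 ^ n = w + ∑ i ∈ Finset.range n, ι N ^ 2 ^ i := by
    intro n
    induction n with
    | zero => simp
    | succ n ih =>
      have e : w ^ 2 ^ (n + 1) = (w ^ 2) ^ 2 ^ n := by rw [← pow_mul, pow_succ']
      rw [e, hw', add_pow_char_pow, ih, Finset.sum_range_succ, add_assoc]
  have hwq : w ^ q = w + 1 := by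
    rw [hqh, hpow, ← map_one ι, ← hN, map_sum]
    simp
  have hwF : w ^ Fintype.card F = w := by
    rw [hF, sq, pow_mul, hwq]
    nth_rewrite 1 [hqh]
    rw [add_pow_char_pow, ← hqh, hwq, one_pow]
    linear_combination h2K
  obtain ⟨w₀, rfl⟩ : ∃ w₀ : F, ι w₀ = w := by
    classical
    by_contra hne
    push Not at hne
    have hcard : 1 < Fintype.card F := Fintype.one_lt_card
    refine FiniteField.X_pow_card_sub_X_ne_zero K hcard
      (Polynomial.eq_zero_of_natDegree_lt_card_of_eval_eq_zero' _
        (insert w (Finset.univ.image ι)) ?_ ?_)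
    · intro x hx
      rcases Finset.mem_insert.mp hx with rfl | hx
      · simp [hwF]
      · obtain ⟨y, _, rfl⟩ := Finset.mem_image.mp hx
        simp [← map_pow, FiniteField.pow_card]
    · rw [FiniteField.X_pow_card_sub_X_natDegree_eq K hcard, Finset.card_insert_of_notMem,
        Finset.card_image_of_injective _ ι.injective, Finset.card_univ]
      · omega
      · intro h
        obtain ⟨y, _, hy⟩ := Finset.mem_image.mp h
        exact hne y hy
  refine ⟨w₀, ι.injective ?_, ι.injective ?_⟩
  · simpa using hw
  · simpa using hwq

/-- for `r ≥ 2` even, with either `q` odd and `4a^{q+1} + (b^q − b)²` a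
non-zero square of the subfield `GF(q) = {s : F | s^q = s}`, or `q = 2^h` even and
`Tr_q(a^{q+1}/(b^q + b)²) = 1`, letting `t` be the minimum size of the intersection of
`B(a,b)` with an affine hyperplane, we have `t ≥ 1` and every point of `B(a,b)` lies on a
hyperplane meeting `B(a,b)` in exactly `t` points; i.e. `B(a,b)` is a minimal `t`-fold
blocking set with respect to hyperplanes. -/
theorem statement9 (q r : ℕ) (hq : IsPrimePow q) (hr : 2 ≤ r) (hreven : Even r)
    {F : Type*} [Field F] [Fintype F] (hF : Fintype.card F = q ^ 2)
    (a b : F) (ha : a ≠ 0) (hb : b ^ q ≠ b)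
    (hab : (Odd q ∧
        ∃ s : F, s ≠ 0 ∧ s ^ q = s ∧ 4 * a ^ (q + 1) + (b ^ q - b) ^ 2 = s ^ 2) ∨
      (Even q ∧ ∃ h : ℕ, q = 2 ^ h ∧
        ∑ i ∈ Finset.range h, (a ^ (q + 1) / (b ^ q + b) ^ 2) ^ 2 ^ i = 1)) :
    1 ≤ tmin q r a b ∧
    ∀ P ∈ BSet q r a b, ∃ (c : Fin (r - 1) → F) (c0 d : F), ¬(c = 0 ∧ c0 = 0) ∧
      (∑ i, c i * P.1 i) + c0 * P.2 = d ∧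
      ({x : (Fin (r - 1) → F) × F | (∑ i, c i * x.1 i) + c0 * x.2 = d}
          ∩ BSet q r a b).ncard = tmin q r a b := by
  have hq0 : (q : F) = 0 := by
    have : ((q ^ 2 : ℕ) : F) = 0 := by rw [← hF]; exact FiniteField.cast_card_eq_zero F
    push_cast at this
    exact pow_eq_zero_iff (two_ne_zero) |>.mp this
  obtain ⟨φ, hφq⟩ : ∃ φ : F →+* F, ∀ x, φ x = x ^ q := by
    obtain ⟨p, k, hp, hk, hpk⟩ := hq
    have hp' : p.Prime := hp.nat_prime
    have : Fact p.Prime := ⟨hp'⟩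
    have : CharP F p := by
      rw [CharP.charP_iff_prime_eq_zero hp']
      rw [← hpk] at hq0
      push_cast at hq0
      exact pow_eq_zero_iff hk.ne' |>.mp hq0
    exact ⟨iterateFrobenius F p k, fun x => by rw [iterateFrobenius_def, hpk]⟩
  have hφ : ∀ x, φ (φ x) = x := by
    intro x
    rw [hφq, hφq, ← pow_mul, ← sq, ← hF, FiniteField.pow_card]
  have ha' : φ a ≠ 0 := (map_ne_zero φ).mpr ha
  have hb' : φ b ≠ b := by rwa [hφq]
  have hδ : φ b - b ≠ 0 := sub_ne_zero.mpr hb'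
  have haq : a ^ (q + 1) = a * φ a := by rw [hφq, pow_succ']
  have hbq : b ^ q = φ b := (hφq b).symm
  rw [haq, hbq] at hab
  rcases hab with ⟨hodd, s, hs0, hsq, hs⟩ | ⟨heven, h, hqh, hsum⟩
  · have h2 : (2 : F) ≠ 0 := by
      intro h2
      obtain ⟨j, hj⟩ := hodd
      rw [hj] at hq0
      push_cast at hq0
      rw [h2] at hq0
      simp at hq0
    rw [← hφq] at hsq
    have h4 : φ 2 = 2 := map_ofNat φ 2
    refine core_main φ q r hr hφq hφ a b ha hb' (by rw [hs]; exact pow_ne_zero 2 hs0)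
      ((φ b - b + s) / (2 * φ a)) ((φ b - b - s) / (2 * φ a)) ?_ ?_ ?_ ?_
    · simp only [map_div₀, map_add, map_sub, map_mul, hφ, hsq, h4]
      field_simp
      linear_combination -hs
    · simp only [map_div₀, map_add, map_sub, map_mul, hφ, hsq, h4]
      field_simp
      linear_combination -hs
    · field_simp
      ring
    · field_simp
      linear_combination hs
  · have h2 : (2 : F) = 0 := by
      have hh : h ≠ 0 := by
        rintro rfl
        exact hq.one_lt.ne' (by simpa using hqh)
      rw [hqh] at hq0
      push_cast at hq0
      exact pow_eq_zero_iff hh |>.mp hq0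
    obtain ⟨w, hw, hwq⟩ := exists_artin_schreier q h hF hqh h2 _ hsum
    rw [← hφq] at hwq
    have hδ' : φ b + b = φ b - b := by linear_combination b * h2
    rw [hδ'] at hw
    have hδφ : φ (φ b - b) = φ b - b := by
      rw [map_sub, hφ]
      linear_combination (b - φ b) * h2
    have hw2 : (φ b - b) ^ 2 * (w ^ 2 + w) + a * φ a = 0 := by
      field_simp at hw
      linear_combination hw
    have hD : 4 * (a * φ a) + (φ b - b) ^ 2 ≠ 0 := by
      have : 4 * (a * φ a) + (φ b - b) ^ 2 = (φ b - b) ^ 2 := by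
        linear_combination 2 * (a * φ a) * h2
      rw [this]
      exact pow_ne_zero 2 hδ
    refine core_main φ q r hr hφq hφ a b ha hb' hD
      ((φ b - b) * w / φ a) ((φ b - b) * (w + 1) / φ a) ?_ ?_ ?_ ?_
    · rw [map_div₀, map_mul, hδφ, hφ, hwq]
      field_simp
      linear_combination hw2 - a * φ a * h2
    · rw [map_div₀, map_mul, hδφ, hφ, map_add, hwq, map_one]
      field_simp
      linear_combination hw2 + ((φ b - b) ^ 2 * (w + 1) - a * φ a) * h2
    · field_simp
      linear_combination w * h2
    · field_simp
      linear_combination hw2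
end

section
/- Let q be an odd prime power, r ≥ 3 an odd integer such that r ≡ 1 (mod 4) or q ≡ 1 (mod 4), a ∈ F\{0} and b ∈ F with b^q ≠ b, where F = GF(q²), and suppose 4a^{q+1} + (b^q − b)² = 0. For a non-negative integer j, let N_j denote the number of affine hyperplanes π of F^r with |π ∩ B(a,b)| = j. Then N_{q^{2r−3} + q^{3(r−1)/2} − q^{(3r−5)/2}} = q^r, N_{q^{2r−3}} = (q^{2r} − 1)/(q² − 1) − 1 + q^{2r} − q^{r+1}, and N_{q^{2r−3} − q^{(3r−5)/2}} = q^{r+1} − q^r. -/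
open Finset

/-- `NHyp q r a b j` is the number of affine hyperplanes `π` of `F^r` (as point sets)
with `|π ∩ B(a,b)| = j`. -/
noncomputable def NHyp (q r : ℕ) {F : Type*} [Field F] (a b : F) (j : ℕ) : ℕ :=
  Set.ncard {π : Set ((Fin (r - 1) → F) × F) |
    (∃ (c : Fin (r - 1) → F) (c0 d : F), ¬(c = 0 ∧ c0 = 0) ∧
      π = {x : (Fin (r - 1) → F) × F | (∑ i, c i * x.1 i) + c0 * x.2 = d}) ∧
    (π ∩ BSet q r a b).ncard = j}

theorem unif {X Y : Type*} [Finite X] [Finite Y] (G : X → Y) (N : ℕ)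
    (h : ∀ y, Nat.card {x // G x = y} = N) : N * Nat.card Y = Nat.card X := by
  have := Fintype.ofFinite Y
  rw [← Nat.card_congr (Equiv.sigmaFiberEquiv G), Nat.card_sigma]
  simp [h, mul_comm]

theorem unif' {X Y : Type*} [Finite X] [Finite Y] (G : X → Y)
    (h : ∀ y y' : Y, ∃ e : X ≃ X, ∀ x, G x = y ↔ G (e x) = y') (y : Y) :
    Nat.card {x // G x = y} * Nat.card Y = Nat.card X := by
  apply unif G
  intro y'
  obtain ⟨e, he⟩ := h y' y
  exact Nat.card_congr (e.subtypeEquiv he)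

section setup
variable {F : Type*} [Field F] [Fintype F]

theorem exists_setup (q : ℕ) (hq : IsPrimePow q) (hqodd : Odd q)
    (hF : Fintype.card F = q ^ 2)
    (a b : F) (ha : a ≠ 0) (hb : b ^ q ≠ b)
    (hab : 4 * a ^ (q + 1) + (b ^ q - b) ^ 2 = 0) :
    ∃ (K : Subfield F) (T : F →ₗ[K] K) (e : F), e ≠ 0 ∧ Nat.card K = q ∧
      Function.Surjective T ∧ ∀ (n : ℕ) (x : Fin n → F) (t : F),
      (t ^ q - t + a ^ q * (∑ i, x i ^ (2 * q)) - a * (∑ i, x i ^ 2)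
      = (b ^ q - b) * ∑ i, x i ^ (q + 1)) ↔ T t + ∑ i, T (e * x i) ^ 2 = 0 := by
  classical
  obtain ⟨p, k, hp, hk, hpk⟩ := hq
  have hp' : p.Prime := hp.nat_prime
  have : Fact p.Prime := ⟨hp'⟩
  have : CharP F p := by
    apply charP_of_card_eq_prime_pow (f := k * 2)
    rw [hF, ← hpk, pow_mul]
  have hσ : ∀ x : F, iterateFrobenius F p k x = x ^ q := by
    intro x; rw [iterateFrobenius_def, hpk]
  have hadd : ∀ x y : F, (x + y) ^ q = x ^ q + y ^ q := by
    intro x y; simp only [← hσ, map_add]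
  have hsub : ∀ x y : F, (x - y) ^ q = x ^ q - y ^ q := by
    intro x y; simp only [← hσ, map_sub]
  have hqq : ∀ x : F, (x ^ q) ^ q = x := by
    intro x
    rw [← pow_mul, ← sq, ← hF, FiniteField.pow_card]
  have h2 : (2 : F) ≠ 0 := by
    intro h
    have : ((2 : ℕ) : F) = 0 := by exact_mod_cast h
    rw [CharP.cast_eq_zero_iff F p, Nat.prime_dvd_prime_iff_eq hp' Nat.prime_two] at this
    subst this
    rw [← hpk, Nat.odd_pow_iff hk.ne'] at hqodd
    exact absurd hqodd (by decide)
  have h2q : (2 : F) ^ q = 2 := by rw [← hσ]; exact map_ofNat _ 2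
  have hq0 : q ≠ 0 := by rintro rfl; exact absurd hqodd (by decide)
  have hq1 : 1 < q := by
    rcases Nat.lt_or_ge 1 q with h | h
    · exact h
    · exfalso; have : q = 1 := by omega
      subst this; simp at hb
  obtain ⟨h, hh⟩ : ∃ h, h = b ^ q - b := ⟨_, rfl⟩
  obtain ⟨A, hA⟩ : ∃ A, A = a ^ q := ⟨_, rfl⟩
  have hhq : h ^ q = -h := by rw [hh, hsub, hqq]; ring
  have hh0 : h ≠ 0 := by rw [hh]; exact sub_ne_zero.mpr hb
  have hA0 : A ≠ 0 := by rw [hA]; exact pow_ne_zero _ ha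
  have hAq : A ^ q = a := by rw [hA, hqq]
  have hab' : 4 * (A * a) + h ^ 2 = 0 := by rw [hh, hA, ← pow_succ]; exact hab
  obtain ⟨m, hm⟩ : ∃ m, m = h / (2 * A) := ⟨_, rfl⟩
  have hm1 : 2 * A * m = h := by rw [hm]; field_simp
  have hm2 : A * m ^ 2 = -a := by
    have : 4 * A * (A * m ^ 2 + a) = 0 := by
      rw [← hm1] at hab'; linear_combination hab'
    have h4 : (4 * A) ≠ 0 := by
      rw [show (4 : F) = 2 * 2 by norm_num]; positivity
    have := (mul_eq_zero.mp this).resolve_left h4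
    linear_combination this
  have hmm : m * m ^ q = 1 := by
    have h1 : 2 * a * m ^ q = -h := by
      rw [← hhq, ← hm1, mul_pow, mul_pow, hAq, h2q]
    have : (4 * A * a) * (m * m ^ q - 1) = 0 := by
      linear_combination (2 * a * m ^ q) * hm1 + h * h1 - hab'
    have h4 : (4 * A * a) ≠ 0 := by
      rw [show (4 : F) = 2 * 2 by norm_num]; positivity
    exact sub_eq_zero.mp ((mul_eq_zero.mp this).resolve_left h4)
  obtain ⟨e, he0, he⟩ : ∃ e : F, e ≠ 0 ∧ m * e ^ q = e := by
    have key : ∀ y : F, m * (y + m * y ^ q) ^ q = y + m * y ^ q := by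
      intro y
      rw [hadd, mul_pow, hqq]
      linear_combination y * hmm
    by_cases hm' : m = -1
    · refine ⟨b + m * b ^ q, ?_, key b⟩
      rw [hm']; intro h0; apply hb; linear_combination -h0
    · refine ⟨1 + m * 1 ^ q, ?_, key 1⟩
      intro h0; apply hm'; rw [one_pow] at h0; linear_combination h0
  obtain ⟨κ, hκ⟩ : ∃ κ, κ = A / (e ^ q) ^ 2 := ⟨_, rfl⟩
  have heq0 : e ^ q ≠ 0 := pow_ne_zero _ he0
  have hκe : κ * (e ^ q) ^ 2 = A := by rw [hκ]; field_simp
  have hκ0 : κ ≠ 0 := by rw [hκ]; positivity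
  have hκq : κ ^ q = -κ := by
    have h1 : κ ^ q * e ^ 2 = a := by
      have := congrArg (· ^ q) hκe
      simp only [mul_pow, hAq] at this
      rw [← this]
      congr 1
      rw [← pow_mul, mul_comm 2 q, pow_mul, hqq]
    have h3 : e ^ 2 * (κ ^ q + κ) = 0 := by
      have : κ * e ^ 2 = -a := by
        rw [← hm2, ← hκe, ← he]; 
        rw [he]; nth_rewrite 1 [← he]; ring
      linear_combination h1 + this
    have := (mul_eq_zero.mp h3).resolve_left (by positivity)
    linear_combination this
  let K : Subfield F := RingHom.eqLocusField (iterateFrobenius F p k) (RingHom.id F)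
  have hK : ∀ x : F, x ∈ K ↔ x ^ q = x := by
    intro x
    rw [← hσ]; rfl
  let T : F →ₗ[K] K :=
    { toFun := fun z => ⟨κ * (z ^ q - z), by
        rw [hK, mul_pow, hκq, hsub, hqq]; ring⟩
      map_add' := by
        intro x y
        ext
        simp only [Subfield.coe_add, hadd]; ring
      map_smul' := by
        intro c x
        ext
        have hc := (hK c).mp c.2
        simp only [RingHom.id_apply, smul_eq_mul, Subfield.coe_mul, Subfield.smul_def, mul_pow, hc]
        ring }
  have hT : ∀ z, (T z : F) = κ * (z ^ q - z) := fun z => rfl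
  have hKle : Nat.card K ≤ q := by
    have h1 : (Polynomial.X ^ q - Polynomial.X : Polynomial F) ≠ 0 :=
      FiniteField.X_pow_card_sub_X_ne_zero F hq1
    have h2 : (K : Set F) ⊆ ((Polynomial.X ^ q - Polynomial.X : Polynomial F).roots.toFinset : Set F) := by
      intro x hx
      have := (hK x).mp hx
      simp [Polynomial.mem_roots h1, Polynomial.IsRoot, this, h1]
    have h3 := Set.ncard_le_ncard h2 (Finset.finite_toSet _)
    rw [Set.ncard_coe_finset] at h3
    calc Nat.card K = (K : Set F).ncard := rfl
      _ ≤ _ := h3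
      _ ≤ _ := Multiset.toFinset_card_le _
      _ ≤ _ := Polynomial.card_roots' _
      _ = q := FiniteField.X_pow_card_sub_X_natDegree_eq F hq1
  have hker : Nat.card (LinearMap.ker T) = Nat.card K := by
    apply Nat.card_congr
    apply Equiv.subtypeEquivRight
    intro x
    rw [LinearMap.mem_ker, hK, Subtype.ext_iff, hT]
    simp [hκ0, sub_eq_zero]
  have hprod : Nat.card F = Nat.card K * Nat.card (LinearMap.range T) := by
    rw [← hker, ← Nat.card_congr (LinearMap.quotKerEquivRange T).toEquiv]
    exact Submodule.card_eq_card_quotient_mul_card (LinearMap.ker T) |>.trans (by ring)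
  have hrange : Nat.card (LinearMap.range T) ≤ Nat.card K := Nat.card_le_card_of_injective _ Subtype.val_injective
  rw [Nat.card_eq_fintype_card (α := F), hF] at hprod
  have hKq : Nat.card K = q := by
    nlinarith
  have hR : Nat.card (LinearMap.range T) = Nat.card K := by
    rw [hKq] at hprod ⊢
    exact Nat.eq_of_mul_eq_mul_left (show 0 < q by omega) (by rw [← hprod]; ring)
  refine ⟨K, T, e, he0, hKq, ?_, ?_⟩
  · rw [← LinearMap.range_eq_top]
    apply SetLike.coe_injective
    apply Set.eq_of_subset_of_ncard_le (Set.subset_univ _)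
    · change Set.univ.ncard ≤ _
      rw [Set.ncard_univ, ← hR]; rfl
  · intro n x t
    rw [Subtype.ext_iff]
    simp only [Subfield.coe_add, hT, AddSubmonoidClass.coe_finsetSum, SubmonoidClass.coe_pow, Subfield.coe_zero]
    rw [← hA, ← hh]
    have hf : ∀ i, (κ * ((e * x i) ^ q - e * x i)) ^ 2
        = κ * (A * x i ^ (2 * q) - a * x i ^ 2 - h * x i ^ (q + 1)) := by
      intro i
      rw [mul_pow e, mul_comm 2 q, pow_mul, pow_succ (x i) q]
      nth_rewrite 2 [← he]
      have h5 : a = - (A * m ^ 2) := by rw [hm2]; ring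
      rw [h5, ← hm1, ← hκe]; ring
    simp only [hf, ← Finset.mul_sum, Finset.sum_sub_distrib]
    rw [← mul_add, mul_eq_zero, or_iff_right hκ0]
    constructor
    · intro h; linear_combination h
    · intro h; linear_combination h
end setup

theorem two_sq {K : Type*} [Field K] [Fintype K] [DecidableEq K] (h2 : ringChar K ≠ 2) (γ : K) :
    (∑ a : K, quadraticChar K (γ - a ^ 2) : ℤ)
      = quadraticChar K (-1) * ((if γ = 0 then (Fintype.card K : ℤ) else 0) - 1) := by
  by_cases hγ : γ = 0
  · subst hγ
    have : ∀ a : K, quadraticChar K (0 - a ^ 2) = quadraticChar K (-1) * (if a = 0 then 0 else 1) := by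
      intro a
      split_ifs with h
      · simp [h]
      · rw [show (0 - a ^ 2 : K) = -1 * a ^ 2 by ring, map_mul, map_pow, quadraticChar_sq_one h]
    simp only [this, ← Finset.mul_sum]
    congr 1
    simp only [if_true]
    have h3 : (∑ i : K, if i = 0 then (0:ℤ) else 1) = ∑ i : K, (1 - if i = 0 then (1 : ℤ) else 0) := by
      apply Finset.sum_congr rfl; intro i _; split_ifs <;> simp
    rw [h3, Finset.sum_sub_distrib]
    simp
  · simp only [hγ, if_false]
    have e1 : (∑ a : K, quadraticChar K (γ - a ^ 2) : ℤ)
        = ∑ x : K, (quadraticChar K x + 1) * quadraticChar K (γ - x) := by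
      rw [← Finset.sum_fiberwise (s := Finset.univ) (g := fun a : K => a ^ 2)]
      apply Finset.sum_congr rfl
      intro x _
      rw [← quadraticChar_card_sqrts h2 x]
      rw [Finset.sum_congr rfl (g := fun _ => quadraticChar K (γ - x))]
      · rw [Finset.sum_const, nsmul_eq_mul]
        congr 2
        congr 1
        ext y; simp
      · intro y hy; simp at hy; rw [hy]
    have e2 : ∑ x : K, quadraticChar K (γ - x) = 0 := by
      rw [← quadraticChar_sum_zero h2]
      exact Fintype.sum_equiv (Equiv.subLeft γ) _ _ (fun x => rfl)
    have e3 : ∑ x : K, quadraticChar K x * quadraticChar K (γ - x) = jacobiSum (quadraticChar K) (quadraticChar K) := by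
      rw [jacobiSum]
      symm
      refine Fintype.sum_equiv (Equiv.mulLeft₀ γ hγ) _ _ (fun x => ?_)
      simp only [Equiv.mulLeft₀_apply]
      rw [show γ - γ * x = γ * (1 - x) by ring, map_mul, map_mul]
      have := quadraticChar_sq_one hγ
      linear_combination (-(quadraticChar K) x * quadraticChar K (1 - x)) * this
    have e4 := jacobiSum_nontrivial_inv (quadraticChar_ne_one h2)
    have e5 : (quadraticChar K)⁻¹ = quadraticChar K := (quadraticChar_isQuadratic K).inv
    rw [e5] at e4
    rw [e1]
    simp only [add_mul, one_mul, Finset.sum_add_distrib]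
    rw [e2, e3, e4]; ring

theorem cons_card {K : Type*} [Field K] [Fintype K] (n : ℕ) (γ : K) :
    Nat.card {u : Fin (n + 1) → K // ∑ i, u i ^ 2 = γ}
      = ∑ a : K, Nat.card {u : Fin n → K // ∑ i, u i ^ 2 = γ - a ^ 2} := by
  rw [← Nat.card_sigma]
  apply Nat.card_congr
  refine ⟨fun u => ⟨u.1 0, ⟨Fin.tail u.1, ?_⟩⟩, fun s => ⟨Fin.cons s.1 s.2.1, ?_⟩, ?_, ?_⟩
  · have := u.2; rw [Fin.sum_univ_succ] at this
    simp only [Fin.tail]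
    linear_combination this
  · rw [Fin.sum_univ_succ]
    simp only [Fin.cons_zero, Fin.cons_succ]
    rw [s.2.2]; ring
  · intro u; ext1; simp
  · rintro ⟨a, u, hu⟩; rfl

theorem sum_sq {K : Type*} [Field K] [Fintype K] [DecidableEq K] (h2 : ringChar K ≠ 2) (k : ℕ) :
    ∀ γ : K, (Fintype.card K : ℤ) * Nat.card {u : Fin (2 * k) → K // ∑ i, u i ^ 2 = γ}
      = (Fintype.card K : ℤ) ^ (2 * k) + (quadraticChar K (-1)) ^ k *
        ((if γ = 0 then (Fintype.card K : ℤ) ^ (k + 1) else 0) - (Fintype.card K : ℤ) ^ k) := by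
  induction k with
  | zero =>
    intro γ
    by_cases hγ : γ = 0
    · simp [hγ]
    · simp [hγ, Ne.symm hγ]
  | succ k ih =>
    intro γ
    rw [show 2 * (k + 1) = 2 * k + 1 + 1 by ring, cons_card]
    simp only [cons_card]
    push_cast
    simp only [Finset.mul_sum, ih]
    have h1 : ∀ x : K, ∑ i : K, (if γ - x ^ 2 - i ^ 2 = 0 then (Fintype.card K : ℤ) ^ (k + 1) else 0)
       = (quadraticChar K (γ - x ^ 2) + 1) * (Fintype.card K : ℤ) ^ (k + 1) := by
      intro x
      rw [← quadraticChar_card_sqrts h2, ← Finset.sum_filter, Finset.sum_const, nsmul_eq_mul]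
      congr 2
      congr 1
      ext y; simp only [Finset.mem_filter, Finset.mem_univ, true_and, Set.mem_toFinset, Set.mem_ofPred_eq]
      rw [sub_eq_zero, eq_comm]
    simp only [Finset.sum_add_distrib, ← Finset.mul_sum, Finset.sum_sub_distrib, h1, ← Finset.sum_mul, two_sq h2]
    simp only [Finset.sum_const, Finset.card_univ, nsmul_eq_mul]
    have := quadraticChar_sq_one (F := K) (a := -1) (by simp)
    split_ifs <;> ring

section hyp
variable {ι F : Type*} [Fintype ι] [Field F]

def HH (p : (ι → F) × F) : Set ((ι → F) × F) := {x | x.2 = p.2 + ∑ i, p.1 i * x.1 i}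
def VV (p : (ι → F) × F) : Set ((ι → F) × F) := {x | ∑ i, p.1 i * x.1 i = p.2}

theorem HH_inj : Function.Injective (HH : (ι → F) × F → Set ((ι → F) × F)) := by
  classical
  intro p p' h
  have key : ∀ x : ι → F, p.2 + ∑ i, p.1 i * x i = p'.2 + ∑ i, p'.1 i * x i := by
    intro x
    have : ((x, p.2 + ∑ i, p.1 i * x i) : (ι → F) × F) ∈ HH p := rfl
    rw [h] at this
    exact this
  have h0 : p.2 = p'.2 := by simpa using key 0
  refine Prod.ext (funext fun i => ?_) h0
  have := key (Pi.single i 1)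
  rw [h0] at this
  simpa [Pi.single_apply] using this

theorem VV_nonempty (p : (ι → F) × F) (hp : p.1 ≠ 0) : ∃ x : ι → F, ∑ i, p.1 i * x i = p.2 := by
  classical
  obtain ⟨i, hi⟩ := Function.ne_iff.mp hp
  refine ⟨Pi.single i (p.2 / p.1 i), ?_⟩
  simp only [Pi.zero_apply] at hi
  simp [Pi.single_apply]
  field_simp

theorem VV_eq (p p' : (ι → F) × F) (hp : p.1 ≠ 0) (hp' : p'.1 ≠ 0) (h : VV p = VV p') :
    ∃ u : Fˣ, p' = u • p := by
  classical
  have key : ∀ x : ι → F, ∑ i, p.1 i * x i = p.2 → ∑ i, p'.1 i * x i = p'.2 := by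
    intro x hx
    have : ((x, 0) : (ι → F) × F) ∈ VV p := hx
    rw [h] at this
    exact this
  obtain ⟨i, hi⟩ := Function.ne_iff.mp hp
  simp only [Pi.zero_apply] at hi
  have k0 := key (Pi.single i (p.2 / p.1 i)) (by simp [Pi.single_apply]; field_simp)
  have k1 : ∀ j, p'.1 j = p'.1 i / p.1 i * p.1 j := by
    intro j
    have := key (Pi.single i (p.2 / p.1 i) + (Pi.single j 1 - Pi.single i (p.1 j / p.1 i)))
      (by simp [Pi.single_apply, mul_add, mul_sub, Finset.sum_add_distrib, Finset.sum_sub_distrib]; field_simp; ring)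
    simp only [Pi.add_apply, Pi.sub_apply, mul_add, mul_sub, Finset.sum_add_distrib, Finset.sum_sub_distrib, k0] at this
    simp [Pi.single_apply] at this
    field_simp at this ⊢
    linear_combination this
  have hu : p'.1 i / p.1 i ≠ 0 := by
    intro h0
    apply hp'
    funext j
    rw [k1, h0]; simp
  refine ⟨Units.mk0 _ hu, Prod.ext (funext fun j => ?_) ?_⟩
  · rw [k1]; simp [Units.smul_def]
  · rw [← k0]; simp [Units.smul_def, Pi.single_apply]; field_simp

theorem VV_smul (p : (ι → F) × F) (u : Fˣ) : VV (u • p) = VV p := by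
  ext x
  simp only [VV, Set.mem_ofPred_eq, Units.smul_def, Prod.smul_fst, Prod.smul_snd, Pi.smul_apply, smul_eq_mul, mul_assoc, ← Finset.mul_sum]
  exact mul_right_inj' u.ne_zero

variable [Fintype F]

theorem VV_card : (VV '' {p : (ι → F) × F | p.1 ≠ 0}).ncard * (Nat.card F - 1)
    = (Nat.card F ^ Fintype.card ι - 1) * Nat.card F := by
  classical
  have hS : Nat.card {p : (ι → F) × F // p.1 ≠ 0} = (Nat.card F ^ Fintype.card ι - 1) * Nat.card F := by
    have : Nat.card {c : ι → F // c ≠ 0} = Nat.card F ^ Fintype.card ι - 1 := by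
      rw [Nat.card_eq_fintype_card, Fintype.card_subtype_compl, Fintype.card_subtype_eq]
      simp
    rw [← this, ← Nat.card_prod]
    apply Nat.card_congr
    exact ⟨fun p => (⟨p.1.1, p.2⟩, p.1.2), fun p => ⟨(p.1.1, p.2), p.1.2⟩, fun _ => rfl, fun _ => rfl⟩
  rw [← hS]
  let G : {p : (ι → F) × F // p.1 ≠ 0} → (VV '' {p : (ι → F) × F | p.1 ≠ 0}) :=
    fun p => ⟨VV p.1, ⟨p.1, p.2, rfl⟩⟩
  have hfin : Finite (VV '' {p : (ι → F) × F | p.1 ≠ 0}) := Set.toFinite _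
  have hu : Nat.card Fˣ = Nat.card F - 1 := Nat.card_units F
  have hf : ∀ y, Nat.card {x // G x = y} = Nat.card F - 1 := by
    rintro ⟨_, p, hp, rfl⟩
    rw [← hu]
    symm
    refine Nat.card_congr (Equiv.ofBijective (fun u => ⟨⟨u • p, ?_⟩, ?_⟩) ⟨?_, ?_⟩)
    · intro h
      apply hp
      exact (smul_eq_zero_iff_eq u).mp h
    · exact Subtype.ext (VV_smul p u)
    · intro u v huv
      simp only [Subtype.mk.injEq] at huv
      obtain ⟨i, hi⟩ := Function.ne_iff.mp hp
      have := congrFun (congrArg Prod.fst huv) i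
      simp [Units.smul_def] at this
      exact Units.ext (this.resolve_right hi)
    · rintro ⟨⟨p', hp'⟩, hpp⟩
      obtain ⟨u, hu⟩ := VV_eq p p' hp hp' (congrArg Subtype.val hpp).symm
      exact ⟨u, by simp [hu]⟩
  have := unif G _ hf
  rw [← this, mul_comm]; rfl

theorem hyp_count (B : Set ((ι → F) × F)) (A0 j : ℕ)
    (hv : ∀ p : (ι → F) × F, p.1 ≠ 0 → (VV p ∩ B).ncard = A0) :
    Set.ncard {π : Set ((ι → F) × F) |
    (∃ (c : ι → F) (c0 d : F), ¬(c = 0 ∧ c0 = 0) ∧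
      π = {x : (ι → F) × F | (∑ i, c i * x.1 i) + c0 * x.2 = d}) ∧
    (π ∩ B).ncard = j}
    = Nat.card {p : (ι → F) × F // (HH p ∩ B).ncard = j} +
      if j = A0 then (VV '' {p : (ι → F) × F | p.1 ≠ 0}).ncard else 0 := by
  classical
  have hset : {π : Set ((ι → F) × F) |
    (∃ (c : ι → F) (c0 d : F), ¬(c = 0 ∧ c0 = 0) ∧
      π = {x : (ι → F) × F | (∑ i, c i * x.1 i) + c0 * x.2 = d}) ∧
    (π ∩ B).ncard = j} = (HH '' {p | (HH p ∩ B).ncard = j}) ∪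
      (if j = A0 then (VV '' {p : (ι → F) × F | p.1 ≠ 0}) else ∅) := by
    ext π
    constructor
    · rintro ⟨⟨c, c0, d, hc, rfl⟩, hj⟩
      by_cases h0 : c0 = 0
      · right
        subst h0
        have hc' : c ≠ 0 := by simpa using hc
        have e1 : {x : (ι → F) × F | (∑ i, c i * x.1 i) + 0 * x.2 = d} = VV (c, d) := by
          ext x; simp [VV]
        rw [e1] at hj ⊢
        rw [hv _ hc'] at hj
        rw [if_pos hj.symm]
        exact ⟨(c, d), hc', rfl⟩
      · left
        have e1 : {x : (ι → F) × F | (∑ i, c i * x.1 i) + c0 * x.2 = d}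
            = HH (fun i => - c i / c0, d / c0) := by
          ext x
          simp only [HH, Set.mem_ofPred_eq]
          have : ∑ i, - c i / c0 * x.1 i = - (∑ i, c i * x.1 i) / c0 := by
            rw [neg_div, Finset.sum_div, ← Finset.sum_neg_distrib]
            apply Finset.sum_congr rfl; intros; ring
          rw [this]
          field_simp
          constructor
          · intro h; linear_combination h
          · intro h; linear_combination h
        rw [e1] at hj ⊢
        exact ⟨_, hj, rfl⟩
    · rintro (⟨p, hp, rfl⟩ | h)
      · refine ⟨⟨fun i => - p.1 i, 1, p.2, by simp, ?_⟩, hp⟩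
        ext x
        simp only [HH, Set.mem_ofPred_eq, neg_mul, Finset.sum_neg_distrib]
        constructor
        · intro h; linear_combination h
        · intro h; linear_combination h
      · split_ifs at h with hj
        · obtain ⟨p, hp, rfl⟩ := h
          refine ⟨⟨p.1, 0, p.2, by simpa using hp, ?_⟩, by rw [hv p hp, hj]⟩
          ext x; simp [VV]
        · exact absurd h (by simp)
  rw [hset, Set.ncard_union_eq _ (Set.toFinite _) (Set.toFinite _), Set.ncard_image_of_injective _ HH_inj]
  · congr 1
    split_ifs <;> simp
  · split_ifs with hj
    · rw [Set.disjoint_left]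
      rintro _ ⟨p, _, rfl⟩ ⟨p', hp', h⟩
      obtain ⟨x, hx⟩ := VV_nonempty p' hp'
      have h1 : ∀ t, ((x, t) : (ι → F) × F) ∈ HH p := by
        intro t; rw [← h]; exact hx
      have h2 := h1 0
      have h3 := h1 1
      simp only [HH, Set.mem_ofPred_eq] at h2 h3
      rw [← h2] at h3
      exact one_ne_zero h3
    · simp

end hyp

theorem unif_hom {X Y : Type*} [AddCommGroup X] [AddCommGroup Y] [Finite X] [Finite Y] (G : X →+ Y)
    (hG : Function.Surjective G) (y : Y) :
    Nat.card {x // G x = y} * Nat.card Y = Nat.card X := by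
  apply unif' G
  intro y y'
  obtain ⟨z, hz⟩ := hG (y' - y)
  refine ⟨Equiv.addRight z, fun x => ?_⟩
  simp only [Equiv.coe_addRight, map_add, hz]
  constructor
  · rintro rfl; abel
  · intro h
    rw [← sub_eq_zero] at h ⊢
    rw [← h]; abel

theorem unifP {X Y : Type*} [Finite X] [Finite Y] (G : X → Y) (N : ℕ)
    (h : ∀ y, Nat.card {x // G x = y} = N) (P : Y → Prop) :
    N * Nat.card {y // P y} = Nat.card {x // P (G x)} := by
  apply unif (fun x : {x // P (G x)} => (⟨G x.1, x.2⟩ : {y // P y}))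
  rintro ⟨y, hy⟩
  rw [← h y]
  apply Nat.card_congr
  exact ⟨fun x => ⟨x.1.1, congrArg Subtype.val x.2⟩,
    fun x => ⟨⟨x.1, by rw [x.2]; exact hy⟩, Subtype.ext x.2⟩, fun _ => rfl, fun _ => rfl⟩

section count
variable {F K ι : Type*} [Field F] [Field K] [Fintype F] [Fintype K] [Algebra K F] [Fintype ι]

def BB (T : F →ₗ[K] K) (e : F) : Set ((ι → F) × F) := {x | T x.2 + ∑ i, T (e * x.1 i) ^ 2 = 0}

theorem VV_BB (T : F →ₗ[K] K) (hT : Function.Surjective T) (e : F)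
    (p : (ι → F) × F) (hp : p.1 ≠ 0) :
    (VV p ∩ BB T e).ncard * (Nat.card F * Nat.card K) = Nat.card F ^ Fintype.card ι * Nat.card F := by
  classical
  let φ : (ι → F) →+ F :=
    { toFun := fun x => ∑ i, p.1 i * x i
      map_zero' := by simp
      map_add' := by intro x y; simp [mul_add, Finset.sum_add_distrib] }
  have hφ : Function.Surjective φ := fun d => VV_nonempty (p.1, d) hp
  have h1 := unif_hom φ hφ p.2
  have h2 := unif_hom T.toAddMonoidHom hT
  have h3 : (VV p ∩ BB T e).ncard
      = Nat.card (Σ x : {x // φ x = p.2}, {t // T t = - ∑ i, T (e * x.1 i) ^ 2}) := by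
    apply Nat.card_congr
    exact ⟨fun z => ⟨⟨z.1.1, z.2.1⟩, ⟨z.1.2, eq_neg_of_add_eq_zero_left z.2.2⟩⟩,
      fun s => ⟨(s.1.1, s.2.1), ⟨s.1.2, by
        have := s.2.2
        change T s.2.1 + _ = 0
        rw [this]; simp⟩⟩, fun _ => rfl, fun _ => rfl⟩
  rw [h3, Nat.card_sigma]
  have h4 : Nat.card (ι → F) = Nat.card F ^ Fintype.card ι := by simp
  rw [← h4, ← h1]
  calc _ = (∑ x : {x // φ x = p.2}, Nat.card {t // T t = - ∑ i, T (e * x.1 i) ^ 2} * Nat.card K) * Nat.card F := by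
        rw [← Finset.sum_mul]; ring
    _ = (∑ x : {x // φ x = p.2}, Nat.card F) * Nat.card F := by
        congr 1
        exact Finset.sum_congr rfl (fun x _ => h2 _)
    _ = _ := by simp

noncomputable def cnt (T : F →ₗ[K] K) (e : F) (p : (ι → F) × F) : ℕ :=
  Nat.card {x : ι → F // T (p.2 + ∑ i, p.1 i * x i) + ∑ i, T (e * x i) ^ 2 = 0}

theorem HH_BB (T : F →ₗ[K] K) (e : F) (p : (ι → F) × F) : (HH p ∩ BB T e).ncard = cnt T e p := by
  apply Nat.card_congr
  exact ⟨fun z => ⟨z.1.1, by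
      have h1 := z.2.1
      have h2 := z.2.2
      simp only [HH, BB, Set.mem_ofPred_eq] at h1 h2
      rw [← h1]; exact h2⟩,
    fun x => ⟨(x.1, p.2 + ∑ i, p.1 i * x.1 i), ⟨rfl, x.2⟩⟩,
    fun z => Subtype.ext (Prod.ext rfl (by
      have h1 := z.2.1
      exact h1.symm)), fun _ => rfl⟩

theorem exists_w (T : F →ₗ[K] K) (hT : Function.Surjective T) (e : F) (he : e ≠ 0)
    (c : F) (hc : ∀ α : K, c ≠ α • e) : ∃ w, T (e * w) = 0 ∧ T (c * w) ≠ 0 := by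
  by_contra! hcon
  obtain ⟨w1, hw1⟩ := hT 1
  have hw0 : T (e * (w1 / e)) = 1 := by rw [mul_div_cancel₀ _ he, hw1]
  set w0 := w1 / e
  apply hc (T (c * w0))
  by_contra hne
  have hne' : c - T (c * w0) • e ≠ 0 := sub_ne_zero.mpr hne
  have hall : ∀ w, T ((c - T (c * w0) • e) * w) = 0 := by
    intro w
    have := hcon (w - T (e * w) • w0) (by
      rw [mul_sub, map_sub, mul_smul_comm, map_smul, hw0]; simp)
    rw [mul_sub, map_sub, mul_smul_comm, map_smul, smul_eq_mul] at this
    rw [sub_mul, map_sub, smul_mul_assoc, map_smul, smul_eq_mul]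
    linear_combination this
  have := hall (w1 / (c - T (c * w0) • e))
  rw [mul_div_cancel₀ _ hne', hw1] at this
  exact one_ne_zero this

theorem cnt1 (T : F →ₗ[K] K) (hT : Function.Surjective T) (e : F) (he : e ≠ 0)
    (p : (ι → F) × F) (hp : ∀ α : ι → K, p.1 ≠ fun i => α i • e) :
    cnt T e p * Nat.card K = Nat.card F ^ Fintype.card ι := by
  classical
  obtain ⟨i, hi⟩ : ∃ i, ∀ α : K, p.1 i ≠ α • e := by
    by_contra! hcon
    choose α hα using hcon
    exact hp α (funext hα)
  obtain ⟨w, hw1, hw2⟩ := exists_w T hT e he (p.1 i) hi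
  have h4 : Nat.card (ι → F) = Nat.card F ^ Fintype.card ι := by simp
  rw [← h4]
  apply unif' (fun x : ι → F => T (p.2 + ∑ i, p.1 i * x i) + ∑ i, T (e * x i) ^ 2)
  intro y y'
  refine ⟨Equiv.addRight (Pi.single i (((y' - y) / T (p.1 i * w)) • w)), fun x => ?_⟩
  have e1 : ∀ j, T (e * (x j + (Pi.single i (((y' - y) / T (p.1 i * w)) • w) : ι → F) j)) = T (e * x j) := by
    intro j
    by_cases hj : j = i
    · subst hj
      rw [Pi.single_eq_same, mul_add, map_add, mul_smul_comm, map_smul, hw1]; simp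
    · rw [Pi.single_eq_of_ne hj, add_zero]
  have e2 : T (∑ j, p.1 j * (x j + (Pi.single i (((y' - y) / T (p.1 i * w)) • w) : ι → F) j))
      = T (∑ j, p.1 j * x j) + (y' - y) := by
    simp only [mul_add, Finset.sum_add_distrib, map_add]
    congr 1
    simp only [Pi.single_apply, mul_ite, mul_zero, Finset.sum_ite_eq', Finset.mem_univ, if_true]
    rw [mul_smul_comm, map_smul, smul_eq_mul, div_mul_cancel₀ _ hw2]
  simp only [Equiv.coe_addRight, Pi.add_apply, e1, map_add, e2]
  constructor
  · intro h; linear_combination h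
  · intro h; linear_combination h

theorem cnt2 (T : F →ₗ[K] K) (hT : Function.Surjective T) (e : F) (he : e ≠ 0)
    (hF : Nat.card F = Nat.card K ^ 2) (h2 : (2 : K) ≠ 0) (α : ι → K) (d : F) :
    cnt T e (fun i => α i • e, d) = Nat.card K ^ Fintype.card ι *
      Nat.card {u : ι → K // ∑ i, u i ^ 2 = (∑ i, α i ^ 2) / 4 - T d} := by
  classical
  let φ : (ι → F) →+ (ι → K) :=
    { toFun := fun x i => T (e * x i)
      map_zero' := by ext; simp
      map_add' := by intro x y; ext; simp [mul_add] }
  have hφ : Function.Surjective φ := by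
    intro u
    choose s hs using hT
    refine ⟨fun i => s (u i) / e, ?_⟩
    ext i
    change T (e * (s (u i) / e)) = u i
    rw [mul_div_cancel₀ _ he, hs]
  have hK0 : 0 < Nat.card K := Nat.card_pos
  have h1 : ∀ y, Nat.card {x // φ x = y} = Nat.card K ^ Fintype.card ι := by
    intro y
    have := unif_hom φ hφ y
    rw [Nat.card_fun, Nat.card_fun, hF] at this
    simp only [Nat.card_eq_fintype_card (α := ι)] at this
    apply Nat.eq_of_mul_eq_mul_right (pow_pos hK0 (Fintype.card ι))
    rw [this]; ring
  have h3 := unifP φ _ h1 (fun u => T d + ∑ i, α i * u i + ∑ i, u i ^ 2 = 0)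
  have h5 : Nat.card {u : ι → K // ∑ i, u i ^ 2 = (∑ i, α i ^ 2) / 4 - T d}
      = Nat.card {u : ι → K // T d + ∑ i, α i * u i + ∑ i, u i ^ 2 = 0} := by
    symm
    apply Nat.card_congr
    refine (Equiv.addRight (fun i => α i / 2)).subtypeEquiv ?_
    intro u
    have h4 : (4 : K) ≠ 0 := by
      rw [show (4 : K) = 2 * 2 by norm_num]; exact mul_ne_zero h2 h2
    have : ∑ i, (u i + α i / 2) ^ 2 = ∑ i, u i ^ 2 + ∑ i, α i * u i + (∑ i, α i ^ 2) / 4 := by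
      rw [Finset.sum_div, ← Finset.sum_add_distrib, ← Finset.sum_add_distrib]
      apply Finset.sum_congr rfl
      intro i _
      field_simp
      ring
    simp only [Equiv.coe_addRight, Pi.add_apply, this]
    constructor
    · intro h; linear_combination h
    · intro h; linear_combination h
  rw [h5, h3, cnt]
  apply Nat.card_congr
  apply Equiv.subtypeEquivRight
  intro x
  have : T (d + ∑ i, (α i • e) * x i) = T d + ∑ i, α i * T (e * x i) := by
    simp only [map_add, map_sum, smul_mul_assoc, map_smul, smul_eq_mul]
  rw [this]; rfl

end count

section final
variable {F K : Type*} [Field F] [Field K] [Fintype F] [Fintype K] [Algebra K F]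

theorem final_counts (T : F →ₗ[K] K) (hT : Function.Surjective T) (e : F) (he : e ≠ 0)
    (q k : ℕ) (hq : Nat.card K = q) (hq1 : 1 < q) (hF : Nat.card F = q ^ 2) (hodd : Odd q)
    (hs : Even (k + 1) ∨ q % 4 = 1) :
    Nat.card {p : (Fin (2 * (k + 1)) → F) × F //
      cnt T e p = q ^ (4 * k + 3) + q ^ (3 * k + 3) - q ^ (3 * k + 2)} = q ^ (2 * k + 3) ∧
    Nat.card {p : (Fin (2 * (k + 1)) → F) × F //
      cnt T e p = q ^ (4 * k + 3)} = q ^ (4 * k + 6) - q ^ (2 * k + 4) ∧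
    Nat.card {p : (Fin (2 * (k + 1)) → F) × F //
      cnt T e p = q ^ (4 * k + 3) - q ^ (3 * k + 2)} = q ^ (2 * k + 4) - q ^ (2 * k + 3) := by
  classical
  have hq' : Fintype.card K = q := by rw [← hq, Nat.card_eq_fintype_card]
  have hchar : ringChar K ≠ 2 := by
    intro h
    rw [← Nat.not_even_iff_odd] at hodd
    apply hodd
    rw [← hq']
    rw [Nat.even_iff]; exact FiniteField.even_card_iff_char_two.mp h
  have h2 : (2 : K) ≠ 0 := Ring.two_ne_zero hchar
  have hchi : (quadraticChar K (-1)) ^ (k + 1) = 1 := by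
    rcases hs with h | h
    · obtain ⟨m, hm⟩ := h
      rw [hm, ← two_mul, pow_mul, quadraticChar_sq_one (by simp), one_pow]
    · have : quadraticChar K (-1) = 1 := by
        rw [quadraticChar_one_iff_isSquare (by simp), FiniteField.isSquare_neg_one_iff, hq', h]
        decide
      rw [this, one_pow]
  let g : (Fin (2 * (k + 1)) → K) × F → (Fin (2 * (k + 1)) → F) × F :=
    fun s => (fun i => s.1 i • e, s.2)
  have hg : Function.Injective g := by
    intro s s' h
    refine Prod.ext (funext fun i => ?_) (congrArg (fun z : (Fin (2 * (k + 1)) → F) × F => z.2) h)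
    have := congrFun (congrArg (fun z : (Fin (2 * (k + 1)) → F) × F => z.1) h) i
    exact smul_left_injective K he this
  let P : Set ((Fin (2 * (k + 1)) → K) × F) := {s | T s.2 - (∑ i, s.1 i ^ 2) / 4 = 0}
  have hPcard : P.ncard = q ^ (2 * k + 3) := by
    have := unif' (fun s : (Fin (2 * (k + 1)) → K) × F => T s.2 - (∑ i, s.1 i ^ 2) / 4) (by
      intro y y'
      obtain ⟨z, hz⟩ := hT (y' - y)
      refine ⟨Equiv.addRight (0, z), fun s => ?_⟩
      simp only [Equiv.coe_addRight, Prod.snd_add, Prod.fst_add, add_zero, map_add, hz]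
      constructor
      · intro h; linear_combination h
      · intro h; linear_combination h) 0
    rw [Nat.card_prod, Nat.card_fun, hF, hq] at this
    apply Nat.eq_of_mul_eq_mul_right (show 0 < q by omega)
    refine Eq.trans this ?_
    simp only [Nat.card_eq_fintype_card, Fintype.card_fin]
    ring
  have htot : Nat.card ((Fin (2 * (k + 1)) → K) × F) = q ^ (2 * k + 4) := by
    rw [Nat.card_prod, Nat.card_fun, hF, hq]
    simp only [Nat.card_eq_fintype_card, Fintype.card_fin]
    ring
  have htotF : Nat.card ((Fin (2 * (k + 1)) → F) × F) = q ^ (4 * k + 6) := by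
    rw [Nat.card_prod, Nat.card_fun, hF]
    simp only [Nat.card_eq_fintype_card, Fintype.card_fin]
    ring
  have hPc : Pᶜ.ncard = q ^ (2 * k + 4) - q ^ (2 * k + 3) := by
    have := Set.ncard_add_ncard_compl P
    omega
  have hgc : (Set.range g)ᶜ.ncard = q ^ (4 * k + 6) - q ^ (2 * k + 4) := by
    have h1 := Set.ncard_add_ncard_compl (Set.range g)
    have h3 : (Set.range g).ncard = q ^ (2 * k + 4) := by
      rw [← Set.image_univ, Set.ncard_image_of_injective _ hg, Set.ncard_univ, htot]
    omega
  -- values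
  have hlt1 : q ^ (3 * k + 2) < q ^ (3 * k + 3) := Nat.pow_lt_pow_right hq1 (by omega)
  have hle : q ^ (3 * k + 2) ≤ q ^ (4 * k + 3) := Nat.pow_le_pow_right (by omega) (by omega)
  have hpos : 0 < q ^ (3 * k + 2) := pow_pos (by omega) _
  have v2 : ∀ p, p ∉ Set.range g → cnt T e p = q ^ (4 * k + 3) := by
    intro p hp
    have := cnt1 T hT e he p (by
      intro α hα
      exact hp ⟨(α, p.2), Prod.ext hα.symm rfl⟩)
    rw [hq, hF, Fintype.card_fin] at this
    apply Nat.eq_of_mul_eq_mul_right (show 0 < q by omega)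
    rw [this]; ring
  have vg : ∀ s, (q : ℤ) * cnt T e (g s) = q * (q ^ (4 * k + 3)
      + (if s ∈ P then (q : ℤ) ^ (3 * k + 3) else 0) - q ^ (3 * k + 2)) := by
    intro s
    have h3 := cnt2 T hT e he (by rw [hF, hq]) h2 s.1 s.2
    have h4 := sum_sq hchar (k + 1) ((∑ i, s.1 i ^ 2) / 4 - T s.2)
    rw [hchi, hq'] at h4
    have hiff : ((∑ i, s.1 i ^ 2) / 4 - T s.2 = 0) ↔ s ∈ P := by
      change _ ↔ T s.2 - (∑ i, s.1 i ^ 2) / 4 = 0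
      rw [sub_eq_zero, sub_eq_zero, eq_comm]
    simp only [hiff] at h4
    change (q : ℤ) * (cnt T e (fun i => s.1 i • e, s.2) : ℕ) = _
    rw [h3, hq, Fintype.card_fin]
    push_cast
    rw [mul_left_comm, h4]
    split_ifs <;> ring
  have hq0 : (q : ℤ) ≠ 0 := by positivity
  have v1 : ∀ s ∈ P, cnt T e (g s) = q ^ (4 * k + 3) + q ^ (3 * k + 3) - q ^ (3 * k + 2) := by
    intro s hs
    have := mul_left_cancel₀ hq0 (vg s)
    rw [if_pos hs] at this
    have : (cnt T e (g s) : ℤ) + (q ^ (3 * k + 2) : ℕ) = (q ^ (4 * k + 3) : ℕ) + (q ^ (3 * k + 3) : ℕ) := by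
      rw [this]; push_cast; ring
    omega
  have v3 : ∀ s, s ∉ P → cnt T e (g s) = q ^ (4 * k + 3) - q ^ (3 * k + 2) := by
    intro s hs
    have := mul_left_cancel₀ hq0 (vg s)
    rw [if_neg hs] at this
    have : (cnt T e (g s) : ℤ) + (q ^ (3 * k + 2) : ℕ) = (q ^ (4 * k + 3) : ℕ) := by
      rw [this]; push_cast; ring
    omega
  refine ⟨?_, ?_, ?_⟩
  · rw [← hPcard, ← Set.ncard_image_of_injective P hg]
    change Set.ncard {p | _} = _
    congr 1
    ext p
    simp only [Set.mem_ofPred_eq]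
    constructor
    · intro h
      by_cases hp : p ∈ Set.range g
      · obtain ⟨s, rfl⟩ := hp
        by_cases hs : s ∈ P
        · exact ⟨s, hs, rfl⟩
        · rw [v3 s hs] at h; omega
      · rw [v2 p hp] at h; omega
    · rintro ⟨s, hs, rfl⟩
      exact v1 s hs
  · rw [← hgc]
    change Set.ncard {p | _} = _
    congr 1
    ext p
    simp only [Set.mem_ofPred_eq]
    constructor
    · intro h hp
      obtain ⟨s, rfl⟩ := hp
      by_cases hs : s ∈ P
      · rw [v1 s hs] at h; omega
      · rw [v3 s hs] at h; omega
    · exact v2 p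
  · rw [← hPc, ← Set.ncard_image_of_injective Pᶜ hg]
    change Set.ncard {p | _} = _
    congr 1
    ext p
    simp only [Set.mem_ofPred_eq]
    constructor
    · intro h
      by_cases hp : p ∈ Set.range g
      · obtain ⟨s, rfl⟩ := hp
        by_cases hs : s ∈ P
        · rw [v1 s hs] at h; omega
        · exact ⟨s, hs, rfl⟩
      · rw [v2 p hp] at h; omega
    · rintro ⟨s, hs, rfl⟩
      exact v3 s hs
end final

/-- hyperplane intersection counts for `q` odd, `r ≥ 3` odd with
`r ≡ 1 (mod 4)` or `q ≡ 1 (mod 4)`, and `4a^{q+1} + (b^q − b)² = 0`. -/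
theorem statement10 (q r : ℕ) (hq : IsPrimePow q) (hqodd : Odd q)
    (hr : 3 ≤ r) (hrodd : Odd r) (hmod : r % 4 = 1 ∨ q % 4 = 1)
    {F : Type*} [Field F] [Fintype F] (hF : Fintype.card F = q ^ 2)
    (a b : F) (ha : a ≠ 0) (hb : b ^ q ≠ b)
    (hab : 4 * a ^ (q + 1) + (b ^ q - b) ^ 2 = 0) :
    NHyp q r a b (q ^ (2 * r - 3) + q ^ (3 * (r - 1) / 2) - q ^ ((3 * r - 5) / 2))
      = q ^ r ∧
    NHyp q r a b (q ^ (2 * r - 3))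
      = (q ^ (2 * r) - 1) / (q ^ 2 - 1) - 1 + q ^ (2 * r) - q ^ (r + 1) ∧
    NHyp q r a b (q ^ (2 * r - 3) - q ^ ((3 * r - 5) / 2))
      = q ^ (r + 1) - q ^ r := by
  classical
  obtain ⟨k, rfl⟩ : ∃ k, r = 2 * (k + 1) + 1 := by
    obtain ⟨m, hm⟩ := hrodd
    exact ⟨m - 1, by omega⟩
  have hq1 : 1 < q := hq.one_lt
  obtain ⟨K, T, e, he, hK, hT, hB⟩ := exists_setup q hq hqodd hF a b ha hb hab
  have hF' : Nat.card F = q ^ 2 := by rw [Nat.card_eq_fintype_card, hF]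
  have hs : Even (k + 1) ∨ q % 4 = 1 := by
    rcases hmod with h | h
    · left; rw [Nat.even_iff]; omega
    · exact Or.inr h
  have : Fintype K := Fintype.ofFinite K
  have hBB : BSet q (2 * (k + 1) + 1) a b = BB (ι := Fin (2 * (k + 1))) T e := by
    ext x
    exact hB _ x.1 x.2
  have hv : ∀ p : (Fin (2 * (k + 1)) → F) × F, p.1 ≠ 0 →
      (VV p ∩ BB T e).ncard = q ^ (4 * k + 3) := by
    intro p hp
    have := VV_BB T hT e p hp
    rw [hF', hK, Fintype.card_fin] at this
    apply Nat.eq_of_mul_eq_mul_right (show 0 < q ^ 2 * q by positivity)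
    rw [this]; ring
  have hN : ∀ j, NHyp q (2 * (k + 1) + 1) a b j
      = Nat.card {p : (Fin (2 * (k + 1)) → F) × F // cnt T e p = j}
      + if j = q ^ (4 * k + 3) then
        (VV '' {p : (Fin (2 * (k + 1)) → F) × F | p.1 ≠ 0}).ncard else 0 := by
    intro j
    have := hyp_count (BB (ι := Fin (2 * (k + 1))) T e) (q ^ (4 * k + 3)) j hv
    simp only [HH_BB] at this
    rw [← this, ← hBB]
    rfl
  obtain ⟨f1, f2, f3⟩ := final_counts T hT e he q k hK hq1 hF' hqodd hs
  have hV := VV_card (ι := Fin (2 * (k + 1))) (F := F)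
  rw [hF', Fintype.card_fin] at hV
  have hlt1 : q ^ (3 * k + 2) < q ^ (3 * k + 3) := Nat.pow_lt_pow_right hq1 (by omega)
  have hle : q ^ (3 * k + 2) ≤ q ^ (4 * k + 3) := Nat.pow_le_pow_right (by omega) (by omega)
  have hpos : 0 < q ^ (3 * k + 2) := pow_pos (by omega) _
  rw [show 2 * (2 * (k + 1) + 1) - 3 = 4 * k + 3 by omega,
    show 3 * (2 * (k + 1) + 1 - 1) / 2 = 3 * k + 3 by omega,
    show (3 * (2 * (k + 1) + 1) - 5) / 2 = 3 * k + 2 by omega,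
    show 2 * (2 * (k + 1) + 1) = 4 * k + 6 by omega,
    show 2 * (k + 1) + 1 + 1 = 2 * k + 4 by omega,
    show q ^ (2 * (k + 1) + 1) = q ^ (2 * k + 3) by congr 1]
  refine ⟨?_, ?_, ?_⟩
  · rw [hN, f1, if_neg (by omega)]; rfl
  · rw [hN, f2, if_pos rfl]
    generalize (VV '' {p : (Fin (2 * (k + 1)) → F) × F | p.1 ≠ 0}).ncard = M at hV
    have hq2 : 1 < q ^ 2 := Nat.one_lt_pow (by omega) hq1
    have hdiv : (q ^ (4 * k + 6) - 1) / (q ^ 2 - 1) = M + 1 := by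
      apply Nat.div_eq_of_eq_mul_left (by omega)
      rw [add_mul, hV, Nat.sub_mul, ← pow_mul, ← pow_add,
        show 2 * (2 * (k + 1)) + 2 = 4 * k + 6 by ring]
      have : q ^ 2 ≤ q ^ (4 * k + 6) := Nat.pow_le_pow_right (by omega) (by omega)
      omega
    rw [hdiv]
    have : q ^ (2 * k + 4) ≤ q ^ (4 * k + 6) := Nat.pow_le_pow_right (by omega) (by omega)
    omega
  · rw [hN, f3, if_neg (by omega)]; rfl
end

section
/- Let q be an odd prime power, r ≥ 2 an even integer, a ∈ F\{0} and b ∈ F with b^q ≠ b, where F = GF(q²), and suppose 4a^{q+1} + (b^q − b)² = 0. For a non-negative integer j, let N_j denote the number of affine hyperplanes π of F^r with |π ∩ B(a,b)| = j. Then N_{q^{2r−3} − q^{(3r−4)/2}} = (q^{r+1} − q^r)/2, N_{q^{2r−3}} = q^r + (q^{2r} − 1)/(q² − 1) − 1 + q^{2r} − q^{r+1}, and N_{q^{2r−3} + q^{(3r−4)/2}} = (q^{r+1} − q^r)/2. -/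
open Finset

section partK
variable {K : Type*} [Field K] [Fintype K] [DecidableEq K]

lemma sum_sq_eq (hK : ringChar K ≠ 2) (h : K → ℤ) :
    ∑ x : K, h (x ^ 2) = ∑ u : K, (1 + quadraticChar K u) * h u := by
  rw [← Finset.sum_fiberwise (s := Finset.univ) (g := fun x : K => x ^ 2)]
  refine Finset.sum_congr rfl fun u _ => ?_
  have h1 := quadraticChar_card_sqrts hK u
  rw [Finset.sum_congr rfl (g := fun _ => h u)
    (fun x hx => by rw [(Finset.mem_filter.mp hx).2])]
  rw [Finset.sum_const, nsmul_eq_mul, add_comm 1, ← h1]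
  congr 3
  ext x; simp

lemma conv_char (hK : ringChar K ≠ 2) (f : K) :
    ∑ u : K, quadraticChar K u * quadraticChar K (f - u)
      = - quadraticChar K (-1) + if f = 0 then Fintype.card K * quadraticChar K (-1) else 0 := by
  have hinv : (quadraticChar K)⁻¹ = quadraticChar K := (quadraticChar_isQuadratic K).inv
  have hJ := jacobiSum_nontrivial_inv (quadraticChar_ne_one hK)
  rw [hinv] at hJ
  unfold jacobiSum at hJ
  split_ifs with hf
  · subst hf
    have : ∀ u : K, quadraticChar K u * quadraticChar K (0 - u)
        = quadraticChar K (-1) * (1 - if u = 0 then 1 else 0) := by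
      intro u
      have : (0 - u) = -1 * u := by ring
      rw [this, map_mul]
      split_ifs with hu
      · subst hu; simp
      · have := quadraticChar_sq_one hu
        linear_combination quadraticChar K (-1) * this
    simp_rw [this, ← Finset.mul_sum, Finset.sum_sub_distrib]
    simp
    ring
  · rw [← Equiv.sum_comp (Equiv.mulLeft₀ f hf)]
    rw [add_zero, ← hJ]
    refine Finset.sum_congr rfl fun u _ => ?_
    have h1 : f - f * u = f * (1 - u) := by ring
    change quadraticChar K (f * u) * quadraticChar K (f - f * u) = _
    rw [h1, map_mul, map_mul]
    have := quadraticChar_sq_one hf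
    linear_combination quadraticChar K u * quadraticChar K (1 - u) * this

/-- number of representations as a sum of squares -/
def SqCnt (K : Type*) [Field K] [Fintype K] [DecidableEq K] (n : ℕ) (e : K) : ℤ :=
  ∑ t : Fin n → K, if ∑ i, t i ^ 2 = e then 1 else 0

lemma SqCnt_succ (n : ℕ) (e : K) : SqCnt K (n + 1) e = ∑ x : K, SqCnt K n (e - x ^ 2) := by
  unfold SqCnt
  rw [← Equiv.sum_comp (Fin.consEquiv (fun _ => K)), Fintype.sum_prod_type]
  refine Finset.sum_congr rfl fun x _ => Finset.sum_congr rfl fun t _ => ?_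
  simp [Fin.sum_univ_succ, Fin.consEquiv, eq_sub_iff_add_eq']

lemma SqCnt_odd (hK : ringChar K ≠ 2) (k : ℕ) : ∃ ε : ℤ, (ε = 1 ∨ ε = -1) ∧
    ∀ e : K, SqCnt K (2 * k + 1) e
      = (Fintype.card K : ℤ) ^ (2 * k) + ε * (Fintype.card K : ℤ) ^ k * quadraticChar K e := by
  have hs := quadraticChar_sum_zero hK
  induction k with
  | zero =>
    refine ⟨1, Or.inl rfl, fun e => ?_⟩
    rw [SqCnt_succ]
    have h0 : ∀ e : K, SqCnt K (2 * 0) e = if e = 0 then 1 else 0 := by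
      intro e
      simp [SqCnt, eq_comm]
    simp_rw [h0]
    rw [sum_sq_eq hK (fun x => if e - x = 0 then 1 else 0)]
    simp [sub_eq_zero]
  | succ k ih =>
    obtain ⟨ε, hε, ih⟩ := ih
    refine ⟨quadraticChar K (-1) * ε, ?_, fun e => ?_⟩
    · rcases quadraticChar_dichotomy (F := K) (a := -1) (by simp) with h | h <;>
        rcases hε with h' | h' <;> simp [h, h']
    · have e1 : 2 * (k + 1) + 1 = 2 * k + 1 + 1 + 1 := by ring
      rw [e1, SqCnt_succ]
      simp_rw [SqCnt_succ (2 * k + 1), ih]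
      rw [sum_sq_eq hK (fun u => ∑ y : K, ((Fintype.card K : ℤ) ^ (2 * k) +
        ε * (Fintype.card K : ℤ) ^ k * quadraticChar K (e - u - y ^ 2)))]
      have h2 : ∀ u : K, ∑ y : K, ((Fintype.card K : ℤ) ^ (2 * k) +
          ε * (Fintype.card K : ℤ) ^ k * quadraticChar K (e - u - y ^ 2))
          = ∑ y : K, (1 + quadraticChar K (y - u)) * ((Fintype.card K : ℤ) ^ (2 * k) +
          ε * (Fintype.card K : ℤ) ^ k * quadraticChar K (e - y)) := by
        intro u
        rw [sum_sq_eq hK (fun v => ((Fintype.card K : ℤ) ^ (2 * k) +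
          ε * (Fintype.card K : ℤ) ^ k * quadraticChar K (e - u - v)))]
        rw [← Equiv.sum_comp (Equiv.subRight u)]
        refine Finset.sum_congr rfl fun y _ => ?_
        simp only [Equiv.subRight_apply]
        have h7 : e - u - (y - u) = e - y := by ring
        rw [h7]
      simp_rw [h2, Finset.mul_sum]
      rw [Finset.sum_comm]
      have h3 : ∀ y : K, ∑ u : K, (1 + quadraticChar K u) * ((1 + quadraticChar K (y - u)) *
          ((Fintype.card K : ℤ) ^ (2 * k) +
          ε * (Fintype.card K : ℤ) ^ k * quadraticChar K (e - y))) =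
          (Fintype.card K - quadraticChar K (-1) +
            if y = 0 then Fintype.card K * quadraticChar K (-1) else 0) *
          ((Fintype.card K : ℤ) ^ (2 * k) +
          ε * (Fintype.card K : ℤ) ^ k * quadraticChar K (e - y)) := by
        intro y
        simp_rw [← mul_assoc, ← Finset.sum_mul]
        congr 1
        have h4 : ∑ u : K, quadraticChar K (y - u) = 0 := by
          rw [← hs]
          exact Equiv.sum_comp (Equiv.subLeft y) (fun u => quadraticChar K u)
        have h5 := conv_char hK y
        have : ∀ u : K, (1 + quadraticChar K u) * (1 + quadraticChar K (y - u)) =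
          1 + quadraticChar K u + quadraticChar K (y - u)
            + quadraticChar K u * quadraticChar K (y - u) := by intro u; ring
        simp_rw [this, Finset.sum_add_distrib, h4, h5, hs]
        simp
        ring
      simp_rw [h3, add_mul, mul_add, Finset.sum_add_distrib, ← Finset.mul_sum]
      have h6 : ∑ u : K, quadraticChar K (e - u) = 0 := by
        rw [← hs]
        exact Equiv.sum_comp (Equiv.subLeft e) (fun u => quadraticChar K u)
      simp only [h6, ite_mul, zero_mul, Finset.sum_ite_eq', Finset.mem_univ, if_true,
        Finset.sum_const, Finset.card_univ, nsmul_eq_mul, sub_zero]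
      ring

lemma card_char (hK : ringChar K ≠ 2) (σ : ℤ) (hσ : σ = 1 ∨ σ = -1) :
    2 * #{e : K | quadraticChar K e = σ} + 1 = Fintype.card K := by
  have hs := quadraticChar_sum_zero hK
  have h1 : ∀ e : K, quadraticChar K e = (if quadraticChar K e = 1 then 1 else 0)
      - (if quadraticChar K e = -1 then 1 else 0) := by
    intro e
    by_cases he : e = 0
    · simp [he]
    · rcases quadraticChar_dichotomy he with h | h <;> simp [h]
  have h2 : ∀ e : K, 1 = (if quadraticChar K e = 1 then 1 else 0)
      + (if quadraticChar K e = -1 then 1 else 0) + (if e = 0 then 1 else 0) := by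
    intro e
    by_cases he : e = 0
    · simp [he]
    · rcases quadraticChar_dichotomy he with h | h <;> simp [h, he]
  have h3 : Fintype.card K = #{e : K | quadraticChar K e = 1}
    + #{e : K | quadraticChar K e = -1} + 1 := by
    rw [← Finset.card_univ, Finset.card_eq_sum_ones, Finset.sum_congr rfl (fun e _ => h2 e)]
    simp [Finset.sum_add_distrib]
  rw [Finset.sum_congr rfl (fun e _ => h1 e)] at hs
  simp only [Finset.sum_sub_distrib, Finset.sum_boole] at hs
  rcases hσ with h | h <;> subst h <;> omega

lemma card_shift {P A : Type*} [Fintype P] [Fintype A] [AddCommGroup A] [DecidableEq A] (Φ : P → A)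
    (T : A → P ≃ P) (hT : ∀ e p, Φ (T e p) = Φ p + e) (e : A) :
    Fintype.card A * #{p : P | Φ p = e} = Fintype.card P := by
  have h0 : Fintype.card P = ∑ x : A, #{p : P | Φ p = x} := by
    rw [← Finset.card_univ (α := P), Finset.card_eq_sum_card_fiberwise (f := Φ) (t := Finset.univ)
      (by intro x _; simp)]
  rw [h0, Finset.sum_congr rfl (g := fun _ => #{p : P | Φ p = e})]
  · simp
  · intro x _
    refine Finset.card_equiv (T (e - x)) fun p => ?_
    simp only [Finset.mem_filter, Finset.mem_univ, true_and, hT]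
    constructor
    · rintro rfl; abel
    · intro h; rw [← sub_eq_zero] at h ⊢; rw [← h]; abel

/-- The transformed equation -/
def PhiK {n : ℕ} (κ τ : K) (g h : Fin n → K) (d : K) (p : (Fin n → K) × (Fin n → K)) : K :=
  ∑ i, (κ * p.2 i ^ 2 + g i * p.2 i + h i * p.1 i + τ * h i * p.2 i) + d

lemma PhiK_count_ne {n : ℕ} (κ τ : K) (g h : Fin n → K) (d : K) (hh : h ≠ 0) :
    #{p | PhiK κ τ g h d p = 0} = Fintype.card K ^ (2 * n - 1) := by
  obtain ⟨i, hi⟩ := Function.ne_iff.mp hh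
  simp only [Pi.zero_apply] at hi
  have h1 := card_shift (PhiK κ τ g h d)
    (fun e => Equiv.addRight ((Pi.single i (e / h i), 0) : (Fin n → K) × (Fin n → K))) (by
      intro e p
      simp only [PhiK, Equiv.coe_addRight, Prod.fst_add, Prod.snd_add, Pi.add_apply,
        Pi.zero_apply, add_zero, mul_add, Finset.sum_add_distrib]
      have : ∑ j, h j * (Pi.single i (e / h i) : Fin n → K) j = e := by
        rw [Finset.sum_eq_single i]
        · rw [Pi.single_eq_same]; field_simp
        · intro j _ hj; simp [hj]
        · simp
      rw [this]; ring) 0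
  have hpos : 0 < Fintype.card K := Fintype.card_pos
  apply Nat.eq_of_mul_eq_mul_left hpos
  rw [h1]
  have : 0 < n := i.pos
  simp only [Fintype.card_prod, Fintype.card_fun, Fintype.card_fin]
  rw [← pow_succ', ← pow_add]
  congr 1; omega

lemma PhiK_count_eq {n : ℕ} (hK : ringChar K ≠ 2) (κ τ : K) (hκ : κ ≠ 0) (g : Fin n → K) (d : K) :
    (#{p | PhiK κ τ g 0 d p = 0} : ℤ) = (Fintype.card K : ℤ) ^ n *
      SqCnt K n ((∑ i, g i ^ 2 / (4 * κ) - d) / κ) := by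
  have h2 : (2 : K) ≠ 0 := Ring.two_ne_zero hK
  have h4 : (4 : K) ≠ 0 := by
    have : (4 : K) = 2 * 2 := by norm_num
    rw [this]; exact mul_ne_zero h2 h2
  unfold SqCnt
  rw [Finset.card_filter, Fintype.sum_prod_type]
  push_cast
  rw [← Equiv.sum_comp (Equiv.addRight (fun i => g i / (2 * κ))) (fun t : Fin n → K =>
    if ∑ i, t i ^ 2 = (∑ i, g i ^ 2 / (4 * κ) - d) / κ then (1 : ℤ) else 0)]
  rw [Finset.sum_congr rfl (g := fun _ => ∑ t : Fin n → K,
    if ∑ i, (Equiv.addRight (fun i => g i / (2 * κ)) t) i ^ 2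
     = (∑ i, g i ^ 2 / (4 * κ) - d) / κ then 1 else 0)]
  · rw [Finset.sum_const, Finset.card_univ, Fintype.card_fun, Fintype.card_fin, nsmul_eq_mul]
    push_cast
    rfl
  · intro s _
    refine Finset.sum_congr rfl fun t _ => ?_
    congr 1
    rw [eq_div_iff hκ, eq_sub_iff_add_eq, ← sub_eq_zero (b := ∑ i, g i ^ 2 / (4 * κ))]
    apply propext
    suffices h : PhiK κ τ g 0 d (s, t) = (∑ i, (Equiv.addRight (fun i => g i / (2 * κ)) t) i ^ 2) * κ
      + d - ∑ i, g i ^ 2 / (4 * κ) by rw [h]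
    unfold PhiK
    rw [Finset.sum_mul, add_sub_right_comm, ← Finset.sum_sub_distrib]
    congr 1
    refine Finset.sum_congr rfl fun i _ => ?_
    simp
    field_simp
    ring

/-- parameters counting -/
lemma param_count {n : ℕ} (hK : ringChar K ≠ 2) (κ : K) (hκ : κ ≠ 0) (σ : ℤ)
    (hσ : σ = 1 ∨ σ = -1) :
    2 * #{w : ((Fin n → K) × (Fin n → K)) × (K × K) | w.1.2 = 0 ∧
      quadraticChar K ((∑ i, w.1.1 i ^ 2 / (4 * κ) - w.2.2) / κ) = σ}
      = Fintype.card K ^ (n + 2) - Fintype.card K ^ (n + 1) := by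
  have h1 : #{w : ((Fin n → K) × (Fin n → K)) × (K × K) | w.1.2 = 0 ∧
      quadraticChar K ((∑ i, w.1.1 i ^ 2 / (4 * κ) - w.2.2) / κ) = σ}
      = #((Finset.univ : Finset ((Fin n → K) × K)) ×ˢ
        (Finset.univ.filter (fun e : K => quadraticChar K e = σ))) := by
    refine Finset.card_bij' (fun w _ => ((w.1.1, w.2.1), (∑ i, w.1.1 i ^ 2 / (4 * κ) - w.2.2) / κ))
      (fun z _ => ((z.1.1, 0), (z.1.2, ∑ i, z.1.1 i ^ 2 / (4 * κ) - z.2 * κ))) ?_ ?_ ?_ ?_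
    · intro w hw; simpa using (by simpa using hw : _ ∧ _).2
    · intro z hz
      simp at hz
      simp [hκ, hz]
    · rintro ⟨⟨g, h⟩, d0, d1⟩ hw
      simp at hw
      simp [hw.1, div_mul_cancel₀ _ hκ]
    · rintro ⟨⟨g, d0⟩, e⟩ hz
      simp [hκ]
  rw [h1, Finset.card_product, Finset.card_univ, Fintype.card_prod, Fintype.card_fun,
    Fintype.card_fin]
  have := card_char hK σ hσ
  apply Nat.eq_sub_of_add_eq
  rw [← this]
  ring

end partK

section partF
variable {F : Type*} [Field F] 

abbrev FixK (φ : F →+* F) : Subfield F := RingHom.eqLocusField φ (RingHom.id F)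

lemma FixK_mem (φ : F →+* F) (x : F) : x ∈ FixK φ ↔ φ x = x := Iff.rfl

lemma FixK_coe (φ : F →+* F) (x : FixK φ) : φ (x : F) = x := x.2

lemma exists_frob (q : ℕ) (hq : IsPrimePow q) [Fintype F] (hF : Fintype.card F = q ^ 2) :
    ∃ φ : F →+* F, (∀ x, φ x = x ^ q) ∧ ∀ x, φ (φ x) = x := by
  obtain ⟨p, k, hp, hk, rfl⟩ := hq
  obtain ⟨p', hp'⟩ := CharP.exists F
  obtain ⟨m, hp'p, hm⟩ := FiniteField.card F p'
  have hpp : p = p' := by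
    have hp1 : p.Prime := hp.nat_prime
    have h1 : p ∣ p' ^ (m : ℕ) := by
      rw [← hm, hF, ← pow_mul]
      exact dvd_pow_self _ (by omega)
    exact (Nat.prime_dvd_prime_iff_eq hp1 hp'p).mp (hp1.dvd_of_dvd_pow h1)
  subst hpp
  have : Fact p.Prime := ⟨hp'p⟩
  refine ⟨iterateFrobenius F p k, fun x => by rw [iterateFrobenius_def], fun x => ?_⟩
  rw [iterateFrobenius_def, iterateFrobenius_def, ← pow_mul, ← sq, ← hF, FiniteField.pow_card]

lemma basis_bij (φ : F →+* F) (hφ : ∀ x, φ (φ x) = x) (b : F) (hb : φ b ≠ b) :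
    Function.Bijective (fun p : FixK φ × FixK φ => (p.1 : F) + p.2 * b) := by
  have hδ : φ b - b ≠ 0 := sub_ne_zero.mpr hb
  constructor
  · rintro ⟨s, t⟩ ⟨s', t'⟩ h
    simp only at h
    have h2 := congrArg φ h
    simp only [map_add, map_mul, FixK_coe] at h2
    have h3 : (t : F) = t' := by
      apply mul_right_cancel₀ hδ
      linear_combination h2 - h
    have h4 : (s : F) = s' := by
      rw [h3] at h; exact add_right_cancel h
    ext <;> simp [h3, h4]
  · intro x
    have ht : φ ((φ x - x) / (φ b - b)) = (φ x - x) / (φ b - b) := by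
      rw [map_div₀, map_sub, map_sub, hφ, hφ, ← neg_sub, ← neg_sub (φ b), neg_div_neg_eq]
    refine ⟨(⟨x - (φ x - x) / (φ b - b) * b, ?_⟩, ⟨_, ht⟩), ?_⟩
    · rw [FixK_mem, map_sub, map_mul, ht]
      field_simp
      ring
    · simp

lemma hilb (φ : F →+* F) (hφ : ∀ x, φ (φ x) = x) (b l : F) (hb : φ b ≠ b) (hl : l * φ l = 1) :
    ∃ v, v ≠ 0 ∧ φ v = l * v := by
  by_cases h : l = -1
  · refine ⟨φ b - b, sub_ne_zero.mpr hb, ?_⟩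
    rw [map_sub, hφ, h]; ring
  · refine ⟨1 + φ l, ?_, ?_⟩
    · intro h0
      apply h
      have : φ l = -1 := by linear_combination h0
      rw [this] at hl
      linear_combination -hl
    · rw [map_add, hφ, map_one]; linear_combination -hl

/-- coordinates on F^n -/
noncomputable def coordF (φ : F →+* F) (hφ : ∀ x, φ (φ x) = x) (b : F) (hb : φ b ≠ b) (n : ℕ)
    (v : F) (hv : v ≠ 0) :
    ((Fin n → FixK φ) × (Fin n → FixK φ)) ≃ (Fin n → F) :=
  (Equiv.arrowProdEquivProdArrow (Fin n) (fun _ => FixK φ) (fun _ => FixK φ)).symm.trans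
    (Equiv.arrowCongr (Equiv.refl _) ((Equiv.ofBijective _ (basis_bij φ hφ b hb)).trans
      (Equiv.mulLeft₀ v hv)))

lemma coordF_apply (φ : F →+* F) (hφ : ∀ x, φ (φ x) = x) (b : F) (hb : φ b ≠ b) (n : ℕ)
    (v : F) (hv : v ≠ 0) (p) (i : Fin n) :
    coordF φ hφ b hb n v hv p i = v * ((p.1 i : F) + p.2 i * b) := rfl

/-- the affine set, abstractly -/
def Bφ (φ : F →+* F) {n : ℕ} (a b : F) : Set ((Fin n → F) × F) :=
  {x | φ x.2 - x.2 + φ a * (∑ i, φ (x.1 i) ^ 2) - a * (∑ i, x.1 i ^ 2)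
      = (φ b - b) * ∑ i, φ (x.1 i) * x.1 i}

lemma setup (φ : F →+* F) (hφ : ∀ x, φ (φ x) = x) (a b : F) (ha : a ≠ 0) (hb : φ b ≠ b)
    (h2 : (2 : F) ≠ 0) (hab : 4 * (φ a * a) + (φ b - b) ^ 2 = 0) :
    ∃ (v : F) (κ : FixK φ), v ≠ 0 ∧ κ ≠ 0 ∧ ∀ s t : FixK φ,
      φ a * φ (v * (s + t * b)) ^ 2 - a * (v * (s + t * b)) ^ 2
        - (φ b - b) * (φ (v * (s + t * b)) * (v * (s + t * b))) = (φ b - b) * (κ * t ^ 2) := by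
  have hδ : φ b - b ≠ 0 := sub_ne_zero.mpr hb
  have ha' : φ a ≠ 0 := by simpa using ha
  have h4 : (4 : F) ≠ 0 := by
    have : (4 : F) = 2 * 2 := by norm_num
    rw [this]; exact mul_ne_zero h2 h2
  obtain ⟨v, hv, hvl⟩ := hilb φ hφ b ((φ b - b) / (2 * φ a)) hb (by
    rw [map_div₀, map_sub, map_mul, hφ, hφ, map_ofNat]
    field_simp
    linear_combination -hab)
  have e1 : 2 * (φ a * φ v) = (φ b - b) * v := by rw [hvl]; field_simp
  have e2 : 2 * (a * v) = - ((φ b - b) * φ v) := by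
    apply mul_left_cancel₀ hδ
    linear_combination -2 * a * e1 + φ v * hab
  have hv' : φ v ≠ 0 := by simpa using hv
  refine ⟨v, ⟨v * φ v * (φ b - b) ^ 2 / 2, ?_⟩, hv, ?_, ?_⟩
  · rw [FixK_mem]
    simp only [map_div₀, map_mul, map_pow, map_sub, hφ, map_ofNat]
    ring
  · intro h
    have := congrArg Subtype.val h
    simp only [ZeroMemClass.coe_zero] at this
    exact (div_ne_zero (mul_ne_zero (mul_ne_zero hv hv') (pow_ne_zero 2 hδ)) h2) this
  · intro s t
    simp only [map_add, map_mul, FixK_coe]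
    apply mul_left_cancel₀ h2
    field_simp
    linear_combination (φ v * (s + t * φ b) ^ 2) * e1 - (v * (s + t * b) ^ 2) * e2

lemma graph_mem (φ : F →+* F) (hφ : ∀ x, φ (φ x) = x) (a b : F) (hb : φ b ≠ b) 
    (v : F) (hv : v ≠ 0) (κ : FixK φ)
    (hκ : ∀ s t : FixK φ,
      φ a * φ (v * (s + t * b)) ^ 2 - a * (v * (s + t * b)) ^ 2
        - (φ b - b) * (φ (v * (s + t * b)) * (v * (s + t * b))) = (φ b - b) * (κ * t ^ 2)) {n : ℕ}
    (p : (Fin n → FixK φ) × (Fin n → FixK φ)) (y : F) :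
    (coordF φ hφ b hb n v hv p, y) ∈ Bφ φ a b ↔
      φ y - y + (φ b - b) * ∑ i, (κ * p.2 i ^ 2 : F) = 0 := by
  rw [Finset.mul_sum, Finset.sum_congr rfl fun i _ => (hκ (p.1 i) (p.2 i)).symm]
  simp only [Bφ, Set.mem_ofPred_eq, coordF_apply, Finset.sum_sub_distrib, ← Finset.mul_sum]
  rw [← sub_eq_zero]
  constructor <;> intro h <;> linear_combination h

lemma graph_eq (φ : F →+* F) (hφ : ∀ x, φ (φ x) = x) (b : F) (hb : φ b ≠ b) 
    (v : F) (hv : v ≠ 0) : ∃ τ : FixK φ, ∀ (κ : FixK φ) {n : ℕ}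
    (w : ((Fin n → FixK φ) × (Fin n → FixK φ)) × (FixK φ × FixK φ)) 
    (p : (Fin n → FixK φ) × (Fin n → FixK φ)) (y : F), 
      y = ∑ i, coordF φ hφ b hb n v⁻¹ (inv_ne_zero hv) w.1 i * coordF φ hφ b hb n v hv p i 
        + (w.2.1 + w.2.2 * b) →
      (φ y - y + (φ b - b) * ∑ i, (κ * p.2 i ^ 2 : F) = 0 ↔ PhiK κ τ w.1.1 w.1.2 w.2.2 p = 0) := by
  have hδ : φ b - b ≠ 0 := sub_ne_zero.mpr hb
  refine ⟨⟨b + φ b, by rw [FixK_mem, map_add, hφ, add_comm]⟩, ?_⟩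
  intro κ n w p y hy
  rw [← (FixK φ).subtype_injective.eq_iff]
  have h1 : φ y - y = (φ b - b) * (∑ i, ((w.1.1 i : F) * p.2 i + w.1.2 i * p.1 i +
     (b + φ b) * w.1.2 i * p.2 i) + w.2.2) := by
    have : y = ∑ i, ((w.1.1 i : F) + w.1.2 i * b) * ((p.1 i : F) + p.2 i * b)
        + (w.2.1 + w.2.2 * b) := by
      rw [hy]
      congr 1
      refine Finset.sum_congr rfl fun i _ => ?_
      rw [coordF_apply, coordF_apply]
      field_simp
    rw [this]
    simp only [map_add, map_sum, map_mul, FixK_coe]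
    rw [mul_add, Finset.mul_sum, add_sub_add_comm, ← Finset.sum_sub_distrib]
    congr 1
    · refine Finset.sum_congr rfl fun i _ => ?_
      ring
    · ring
  have h2 : φ y - y + (φ b - b) * ∑ i, (κ * p.2 i ^ 2 : F) =
    (φ b - b) * (FixK φ).subtype (PhiK κ ⟨b + φ b, by rw [FixK_mem, map_add, hφ, add_comm]⟩ w.1.1 w.1.2 w.2.2 p) := by
    rw [h1, ← mul_add]
    congr 1
    simp only [PhiK, map_add, map_sum, map_mul, map_pow, Subfield.coe_subtype, 
      Finset.sum_add_distrib]
    ring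
  rw [h2, map_zero, mul_eq_zero]
  simp [hδ]

end partF

section partH
variable {F : Type*} [Field F] {n : ℕ}

def GH (z : (Fin n → F) × F) : Set ((Fin n → F) × F) := {x | x.2 = ∑ i, z.1 i * x.1 i + z.2}

def VH (z : (Fin n → F) × F) : Set ((Fin n → F) × F) := {x | ∑ i, z.1 i * x.1 i = z.2}

lemma mem_GH (z x : (Fin n → F) × F) : x ∈ GH z ↔ x.2 = ∑ i, z.1 i * x.1 i + z.2 := Iff.rfl

lemma mem_VH (z x : (Fin n → F) × F) : x ∈ VH z ↔ ∑ i, z.1 i * x.1 i = z.2 := Iff.rfl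

lemma sum_single (c : Fin n → F) (i : Fin n) (e : F) :
    ∑ j, c j * (Pi.single i e : Fin n → F) j = c i * e := by
  rw [Finset.sum_eq_single i]
  · rw [Pi.single_eq_same]
  · intro j _ hj; simp [hj]
  · simp

lemma GH_inj : Function.Injective (GH : (Fin n → F) × F → Set ((Fin n → F) × F)) := by
  rintro ⟨m, d⟩ ⟨m', d'⟩ h
  have h1 : ∀ x : Fin n → F, ∑ i, m i * x i + d = ∑ i, m' i * x i + d' := by
    intro x
    have : (x, ∑ i, m i * x i + d) ∈ GH (m, d) := rfl
    rw [h] at this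
    exact this
  have h2 : d = d' := by simpa using h1 0
  subst h2
  have h3 : m = m' := by
    ext i
    have := h1 (Pi.single i 1)
    rw [sum_single, sum_single] at this
    simpa using this
  rw [h3]

lemma VH_nonempty (z : (Fin n → F) × F) (hz : z.1 ≠ 0) : ∃ x, x ∈ VH z := by
  obtain ⟨i, hi⟩ := Function.ne_iff.mp hz
  refine ⟨(Pi.single i (z.2 / z.1 i), 0), ?_⟩
  rw [mem_VH, sum_single]
  exact mul_div_cancel₀ _ hi

lemma GH_ne_VH (z z' : (Fin n → F) × F) (hz : z'.1 ≠ 0) : GH z ≠ VH z' := by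
  intro h
  obtain ⟨x, hx⟩ := VH_nonempty z' hz
  have h1 : (x.1, (∑ i, z.1 i * x.1 i + z.2) + 1) ∈ VH z' := hx
  rw [← h, mem_GH] at h1
  simp at h1

lemma VH_eq_iff (z z' : (Fin n → F) × F) (hz : z.1 ≠ 0) (hz' : z'.1 ≠ 0) :
    VH z = VH z' ↔ ∃ u : Fˣ, z' = u • z := by
  constructor
  · intro h
    obtain ⟨i, hi⟩ := Function.ne_iff.mp hz
    simp only [Pi.zero_apply] at hi
    have hm : ∀ x : Fin n → F, ∑ i, z.1 i * x i = z.2 → ∑ i, z'.1 i * x i = z'.2 := by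
      intro x hx
      have : (x, (0 : F)) ∈ VH z := hx
      rw [h] at this
      exact this
    have h0 : z'.1 i * (z.2 / z.1 i) = z'.2 := by
      rw [← sum_single]
      apply hm
      rw [sum_single, mul_div_cancel₀ _ hi]
    have h1 : ∀ j, z'.1 j = z'.1 i / z.1 i * z.1 j := by
      intro j
      have := hm (Pi.single i (z.2 / z.1 i) + (Pi.single i (z.1 j) + Pi.single j (- z.1 i))) (by
        simp only [Pi.add_apply, mul_add, Finset.sum_add_distrib, sum_single]
        field_simp
        ring)
      simp only [Pi.add_apply, mul_add, Finset.sum_add_distrib, sum_single, h0] at this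
      field_simp
      linear_combination -this
    have hu : z'.1 i / z.1 i ≠ 0 := by
      intro h2
      apply hz'
      ext j
      rw [h1 j, h2]; simp
    refine ⟨Units.mk0 _ hu, ?_⟩
    ext j
    · rw [h1 j]; rfl
    · rw [← h0]
      change _ = z'.1 i / z.1 i * z.2
      ring
  · rintro ⟨u, rfl⟩
    ext x
    rw [mem_VH, mem_VH]
    have : ∑ i, (u • z).1 i * x.1 i = u * ∑ i, z.1 i * x.1 i := by
      rw [Finset.mul_sum]
      refine Finset.sum_congr rfl fun i _ => ?_
      change (u * z.1 i) * _ = _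
      ring
    rw [this]
    change _ ↔ _ = u * z.2
    simp

lemma VH_image_card [Fintype F] (Q : ℕ) (hQ : Fintype.card F = Q) :
    (Q - 1) * (Set.image VH {z : (Fin n → F) × F | z.1 ≠ 0}).ncard = (Q ^ n - 1) * Q := by
  classical
  have h0 : #{z : (Fin n → F) × F | z.1 ≠ 0} = (Q ^ n - 1) * Q := by
    have : (Finset.univ.filter (fun z : (Fin n → F) × F => z.1 ≠ 0)) =
      (Finset.univ.erase (0 : Fin n → F)) ×ˢ (Finset.univ : Finset F) := by
      ext z; simp
    rw [this, Finset.card_product, Finset.card_erase_of_mem (Finset.mem_univ _)]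
    simp [hQ]
  have h1 : (Set.image VH {z : (Fin n → F) × F | z.1 ≠ 0})
      = (((Finset.univ.filter (fun z : (Fin n → F) × F => z.1 ≠ 0)).image VH : Finset _) :
        Set (Set ((Fin n → F) × F))) := by
    simp
  rw [h1, Set.ncard_coe_finset, ← h0, mul_comm]
  symm
  rw [Finset.card_eq_sum_card_image VH, Finset.sum_const_nat (m := Q - 1)]
  intro π hπ
  obtain ⟨z, hz, rfl⟩ := Finset.mem_image.mp hπ
  have hz' : z.1 ≠ 0 := (Finset.mem_filter.mp hz).2
  have h2 : Finset.filter (fun a => VH a = VH z)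
      (Finset.univ.filter (fun z : (Fin n → F) × F => z.1 ≠ 0))
      = (Finset.univ : Finset Fˣ).image (fun u => u • z) := by
    ext w
    simp only [Finset.mem_filter, Finset.mem_univ, true_and, Finset.mem_image]
    constructor
    · rintro ⟨hw, h⟩
      obtain ⟨u, hu⟩ := (VH_eq_iff z w hz' hw).mp h.symm
      exact ⟨u, hu.symm⟩
    · rintro ⟨u, rfl⟩
      have hw : (u • z).1 ≠ 0 := by
        rw [Prod.smul_fst]
        exact (smul_ne_zero_iff_ne u).mpr hz'
      exact ⟨hw, ((VH_eq_iff z _ hz' hw).mpr ⟨u, rfl⟩).symm⟩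
  rw [h2, Finset.card_image_of_injective, Finset.card_univ, Fintype.card_units, hQ]
  intro u u' h
  obtain ⟨i, hi⟩ := Function.ne_iff.mp hz'
  have h3 := congrFun (congrArg Prod.fst h) i
  change (u : F) * z.1 i = u' * z.1 i at h3
  exact Units.ext (mul_right_cancel₀ hi h3)

lemma hyper_split (B : Set ((Fin n → F) × F)) (j : ℕ) :
    {π : Set ((Fin n → F) × F) |
    (∃ (c : Fin n → F) (c0 d : F), ¬(c = 0 ∧ c0 = 0) ∧
      π = {x : (Fin n → F) × F | (∑ i, c i * x.1 i) + c0 * x.2 = d}) ∧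
    (π ∩ B).ncard = j} = (Set.image GH {z | (GH z ∩ B).ncard = j}) ∪
      Set.image VH {z | z.1 ≠ 0 ∧ (VH z ∩ B).ncard = j} := by
  ext π
  constructor
  · rintro ⟨⟨c, c0, d, hc, rfl⟩, hj⟩
    by_cases h0 : c0 = 0
    · right
      subst h0
      refine ⟨(c, d), ⟨by simpa using hc, ?_⟩, ?_⟩
      · rw [← hj]; congr 2; ext x; simp [mem_VH]
      · ext x; simp [mem_VH]
    · left
      have : GH (fun i => - c i / c0, d / c0) =
          {x : (Fin n → F) × F | (∑ i, c i * x.1 i) + c0 * x.2 = d} := by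
        ext x
        have h1 : ∑ i, - c i / c0 * x.1 i = - (∑ i, c i * x.1 i) / c0 := by
          rw [neg_div, Finset.sum_div, ← Finset.sum_neg_distrib]
          refine Finset.sum_congr rfl fun i _ => ?_
          ring
        simp only [mem_GH, h1, Set.mem_ofPred_eq]
        field_simp
        constructor <;> intro h <;> linear_combination h
      exact ⟨_, by rw [Set.mem_ofPred_eq, this]; exact hj, this⟩
  · rintro (⟨z, hz, rfl⟩ | ⟨z, ⟨hz, hj⟩, rfl⟩)
    · refine ⟨⟨-z.1, 1, z.2, by simp, ?_⟩, hz⟩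
      ext x
      simp only [mem_GH, Set.mem_ofPred_eq, Pi.neg_apply, neg_mul, Finset.sum_neg_distrib]
      constructor <;> intro h <;> linear_combination h
    · refine ⟨⟨z.1, 0, z.2, by simp [hz], ?_⟩, hj⟩
      ext x
      simp [mem_VH]

lemma hyper_card [Finite F] (B : Set ((Fin n → F) × F)) (j : ℕ) :
    ({π : Set ((Fin n → F) × F) |
    (∃ (c : Fin n → F) (c0 d : F), ¬(c = 0 ∧ c0 = 0) ∧
      π = {x : (Fin n → F) × F | (∑ i, c i * x.1 i) + c0 * x.2 = d}) ∧
    (π ∩ B).ncard = j}).ncard = {z | (GH z ∩ B).ncard = j}.ncard +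
      (Set.image VH {z | z.1 ≠ 0 ∧ (VH z ∩ B).ncard = j}).ncard := by
  rw [hyper_split, Set.ncard_union_eq, Set.ncard_image_of_injective _ GH_inj]
  rw [Set.disjoint_left]
  rintro _ ⟨z, _, rfl⟩ ⟨z', hz', h⟩
  exact GH_ne_VH z z' hz'.1 h.symm

lemma VH_count [Fintype F] (φ : F →+* F) (hφ : ∀ x, φ (φ x) = x) (a b : F) (hb : φ b ≠ b) 
    (v : F) (hv : v ≠ 0) (κ : FixK φ)
    (hκ : ∀ s t : FixK φ,
      φ a * φ (v * (s + t * b)) ^ 2 - a * (v * (s + t * b)) ^ 2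
        - (φ b - b) * (φ (v * (s + t * b)) * (v * (s + t * b))) = (φ b - b) * (κ * t ^ 2))
    (q : ℕ) (hF : Fintype.card F = q ^ 2) (hq : Nat.card (FixK φ) = q) (hq0 : 0 < q)
    (z : (Fin n → F) × F) (hz : z.1 ≠ 0) :
    (VH z ∩ Bφ φ a b).ncard = q ^ (2 * n - 1) := by
  classical
  have hδ : φ b - b ≠ 0 := sub_ne_zero.mpr hb
  have hψ : ∀ x : Fin n → F, ∃ ψ : FixK φ, ∀ y, (x, y) ∈ Bφ φ a b ↔
      φ y - y + (φ b - b) * ψ = 0 := by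
    intro x
    obtain ⟨p, rfl⟩ := (coordF φ hφ b hb n v hv).surjective x
    refine ⟨∑ i, κ * p.2 i ^ 2, fun y => ?_⟩
    rw [graph_mem φ hφ a b hb v hv κ hκ]
    push_cast
    rfl
  choose ψ hψ using hψ
  obtain ⟨i, hi⟩ := Function.ne_iff.mp hz
  simp only [Pi.zero_apply] at hi
  have h1 := card_shift (fun x : Fin n → F => ∑ i, z.1 i * x i)
    (fun e => Equiv.addRight (Pi.single i (e / z.1 i) : (Fin n → F))) (by
      intro e x
      simp only [Equiv.coe_addRight, Pi.add_apply, mul_add, Finset.sum_add_distrib, sum_single]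
      field_simp) z.2
  have h2 : (VH z ∩ Bφ φ a b) = Set.image (fun p : (Fin n → F) × FixK φ => (p.1, (p.2 : F) - ψ p.1 * b))
    ({x | ∑ i, z.1 i * x i = z.2} ×ˢ Set.univ) := by
    ext ⟨x, y⟩
    simp only [Set.mem_inter_iff, mem_VH, hψ, Set.mem_image, Set.mem_prod, Set.mem_ofPred_eq,
      Set.mem_univ, and_true, Prod.exists, Prod.mk.injEq]
    constructor
    · rintro ⟨h, h'⟩
      refine ⟨x, ⟨y + ψ x * b, ?_⟩, h, rfl, by simp⟩
      rw [FixK_mem, map_add, map_mul, FixK_coe]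
      linear_combination h'
    · rintro ⟨x, y0, h, rfl, rfl⟩
      refine ⟨h, ?_⟩
      simp only [map_sub, map_mul, FixK_coe]
      ring
  rw [h2, Set.ncard_image_of_injective, Set.ncard_prod, Set.ncard_univ, hq]
  · have h3 : ({x : Fin n → F | ∑ i, z.1 i * x i = z.2}).ncard 
      = #{x : Fin n → F | ∑ i, z.1 i * x i = z.2} := by
      rw [← Set.ncard_coe_finset]; simp
    rw [h3]
    apply Nat.eq_of_mul_eq_mul_left hq0
    have : 0 < n := i.pos
    have e1 : q * q ^ (2 * n - 1) = (q ^ 2) ^ n := by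
      rw [← pow_succ', ← pow_mul]; congr 1; omega
    rw [e1, ← hF]
    simp only [Fintype.card_fun, Fintype.card_fin] at h1
    rw [← h1, hF]
    ring
  · rintro ⟨x, y⟩ ⟨x', y'⟩ h
    simp only [Prod.mk.injEq] at h
    obtain ⟨rfl, h⟩ := h
    simp at h
    rw [h]

lemma GH_count [Fintype F] (φ : F →+* F) (B : Set ((Fin n → F) × F)) (z : (Fin n → F) × F)
   (E : ((Fin n → FixK φ) × (Fin n → FixK φ)) ≃ (Fin n → F)) 
   (P : ((Fin n → FixK φ) × (Fin n → FixK φ)) → Prop) 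
   (h : ∀ p, (E p, ∑ i, z.1 i * E p i + z.2) ∈ B ↔ P p) :
   (GH z ∩ B).ncard = {p | P p}.ncard := by
  rw [← Set.ncard_image_of_injective (f := fun p => (E p, ∑ i, z.1 i * E p i + z.2)) {p | P p}]
  · congr 1
    ext ⟨x, y⟩
    simp only [Set.mem_inter_iff, mem_GH, Set.mem_image, Set.mem_ofPred_eq, Prod.mk.injEq]
    constructor
    · rintro ⟨rfl, h'⟩
      obtain ⟨p, rfl⟩ := E.surjective x
      exact ⟨p, (h p).mp h', rfl, rfl⟩
    · rintro ⟨p, hp, rfl, rfl⟩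
      exact ⟨rfl, (h p).mpr hp⟩
  · intro p p' hp
    simp only [Prod.mk.injEq] at hp
    exact E.injective hp.1

end partH

section partMain

/-- pure counting over the small field -/
lemma small_count {K : Type*} [Field K] [Fintype K] [DecidableEq K] (hK : ringChar K ≠ 2) (k q : ℕ)
    (hq : Fintype.card K = q)
    (κ τ : K) (hκ : κ ≠ 0) :
    let N : ((Fin (2 * k + 1) → K) × (Fin (2 * k + 1) → K)) × (K × K) → ℕ :=
      fun w => #{p | PhiK κ τ w.1.1 w.1.2 w.2.2 p = 0}
    2 * #{w | N w = q ^ (4 * k + 1) - q ^ (3 * k + 1)} = q ^ (2 * k + 3) - q ^ (2 * k + 2) ∧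
    2 * #{w | N w = q ^ (4 * k + 1) + q ^ (3 * k + 1)} = q ^ (2 * k + 3) - q ^ (2 * k + 2) ∧
    #{w | N w = q ^ (4 * k + 1)} + q ^ (2 * k + 3) = q ^ (4 * k + 4) + q ^ (2 * k + 2) := by
  intro N
  obtain ⟨ε, hε, hS⟩ := SqCnt_odd hK k
  have hqpos : 0 < q := hq ▸ Fintype.card_pos
  let X : ((Fin (2 * k + 1) → K) × (Fin (2 * k + 1) → K)) × (K × K) → ℤ := fun w =>
    quadraticChar K ((∑ i, w.1.1 i ^ 2 / (4 * κ) - w.2.2) / κ)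
  have hN1 : ∀ w, w.1.2 ≠ 0 → N w = q ^ (4 * k + 1) := by
    intro w hw
    simp only [N]
    rw [PhiK_count_ne _ _ _ _ _ hw, hq]
    congr 1; omega
  have hN2 : ∀ w, w.1.2 = 0 → (N w : ℤ) = (q : ℤ) ^ (4 * k + 1) + ε * X w * q ^ (3 * k + 1) := by
    intro w hw
    simp only [N]
    rw [hw, PhiK_count_eq hK _ _ hκ, hS, hq]
    simp only [X]
    ring
  have hle : q ^ (3 * k + 1) ≤ q ^ (4 * k + 1) := Nat.pow_le_pow_right hqpos (by omega)
  have hpos : (0 : ℤ) < (q : ℤ) ^ (3 * k + 1) := by positivity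
  have hpos' : 0 < q ^ (3 * k + 1) := by positivity
  have hX : ∀ w, X w = 0 ∨ X w = 1 ∨ X w = -1 := fun w =>
    quadraticChar_isQuadratic K _
  have hεε : ε * ε = 1 := by rcases hε with h | h <;> simp [h]
  have key : ∀ σ : ℤ, (σ = 1 ∨ σ = -1) → ∀ j : ℕ,
      (j : ℤ) = (q : ℤ) ^ (4 * k + 1) + σ * q ^ (3 * k + 1) →
      ∀ w, N w = j ↔ w.1.2 = 0 ∧ X w = ε * σ := by
    intro σ hσ j hj w
    by_cases hw : w.1.2 = 0
    · have h1 := hN2 w hw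
      simp only [hw, true_and]
      rw [← Int.natCast_inj, h1, hj, add_right_inj, mul_left_inj' hpos.ne']
      constructor
      · intro h; rw [← h, ← mul_assoc, hεε, one_mul]
      · intro h; rw [h, ← mul_assoc, hεε, one_mul]
    · simp only [hw, false_and, iff_false]
      rw [hN1 w hw]
      intro h
      rw [← h] at hj
      push_cast at hj
      rcases hσ with h | h <;> subst h <;> linarith
  have hes : ∀ σ : ℤ, (σ = 1 ∨ σ = -1) → (ε * σ = 1 ∨ ε * σ = -1) := by
    intro σ hσ
    rcases hσ with h | h <;> rcases hε with h' | h' <;> simp [h, h']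
  have keyc : ∀ σ : ℤ, (σ = 1 ∨ σ = -1) → ∀ j : ℕ,
      (j : ℤ) = (q : ℤ) ^ (4 * k + 1) + σ * q ^ (3 * k + 1) →
      2 * #{w | N w = j} = q ^ (2 * k + 3) - q ^ (2 * k + 2) := by
    intro σ hσ j hj
    have h1 := param_count (n := 2 * k + 1) hK κ hκ (ε * σ) (hes σ hσ)
    rw [hq] at h1
    rw [← h1]
    congr 2
    ext w
    simp only [Finset.mem_filter, Finset.mem_univ, true_and]
    exact key σ hσ j hj w
  have hm : ((q ^ (4 * k + 1) - q ^ (3 * k + 1) : ℕ) : ℤ)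
      = (q : ℤ) ^ (4 * k + 1) + (-1) * q ^ (3 * k + 1) := by
    push_cast [Nat.cast_sub hle]; ring
  have hp : ((q ^ (4 * k + 1) + q ^ (3 * k + 1) : ℕ) : ℤ)
      = (q : ℤ) ^ (4 * k + 1) + 1 * q ^ (3 * k + 1) := by
    push_cast; ring
  have c1 := keyc (-1) (Or.inr rfl) _ hm
  have c2 := keyc 1 (Or.inl rfl) _ hp
  refine ⟨c1, c2, ?_⟩
  have htri : ∀ w, N w = q ^ (4 * k + 1) - q ^ (3 * k + 1) ∨ N w = q ^ (4 * k + 1) + q ^ (3 * k + 1)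
      ∨ N w = q ^ (4 * k + 1) := by
    intro w
    by_cases hw : w.1.2 = 0
    · have h1 := hN2 w hw
      simp only [← Int.natCast_inj, hm, hp, h1]
      push_cast
      rcases hX w with h | h | h <;> rcases hε with h' | h' <;> simp [h, h']
    · exact Or.inr (Or.inr (hN1 w hw))
  have htot : #{w | N w = q ^ (4 * k + 1) - q ^ (3 * k + 1)}
      + #{w | N w = q ^ (4 * k + 1) + q ^ (3 * k + 1)} + #{w | N w = q ^ (4 * k + 1)}
      = q ^ (4 * k + 4) := by
    have : Fintype.card (((Fin (2 * k + 1) → K) × (Fin (2 * k + 1) → K)) × (K × K))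
        = q ^ (4 * k + 4) := by
      simp only [Fintype.card_prod, Fintype.card_fun, Fintype.card_fin, hq]
      ring
    rw [← this, ← Finset.card_univ, Finset.card_eq_sum_ones univ, Finset.card_filter,
      Finset.card_filter, Finset.card_filter, ← Finset.sum_add_distrib, ← Finset.sum_add_distrib]
    refine Finset.sum_congr rfl fun w _ => ?_
    rcases htri w with h | h | h <;> rw [h] <;> split_ifs <;> omega
  have hle2 : q ^ (2 * k + 2) ≤ q ^ (2 * k + 3) := Nat.pow_le_pow_right hqpos (by omega)
  omega

lemma card_FixK {F : Type*} [Field F] [Fintype F] (φ : F →+* F) (hφ : ∀ x, φ (φ x) = x) (b : F)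
    (hb : φ b ≠ b) (q : ℕ) (hF : Fintype.card F = q ^ 2) : Nat.card (FixK φ) = q := by
  have := Nat.card_congr (Equiv.ofBijective _ (basis_bij φ hφ b hb))
  rw [Nat.card_prod, Nat.card_eq_fintype_card (α := F), hF, ← sq] at this
  exact Nat.pow_left_injective (by norm_num : 2 ≠ 0) this

end partMain

/-- hyperplane intersection counts for `q` odd, `r ≥ 2` even, and
`4a^{q+1} + (b^q − b)² = 0`. -/
theorem statement12 (q r : ℕ) (hq : IsPrimePow q) (hqodd : Odd q)
    (hr : 2 ≤ r) (hreven : Even r)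
    {F : Type*} [Field F] [Fintype F] (hF : Fintype.card F = q ^ 2)
    (a b : F) (ha : a ≠ 0) (hb : b ^ q ≠ b)
    (hab : 4 * a ^ (q + 1) + (b ^ q - b) ^ 2 = 0) :
    NHyp q r a b (q ^ (2 * r - 3) - q ^ ((3 * r - 4) / 2))
      = (q ^ (r + 1) - q ^ r) / 2 ∧
    NHyp q r a b (q ^ (2 * r - 3))
      = q ^ r + (q ^ (2 * r) - 1) / (q ^ 2 - 1) - 1 + q ^ (2 * r) - q ^ (r + 1) ∧
    NHyp q r a b (q ^ (2 * r - 3) + q ^ ((3 * r - 4) / 2))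
      = (q ^ (r + 1) - q ^ r) / 2 := by
  classical
  obtain ⟨φ, hφq, hφ⟩ := exists_frob q hq hF
  obtain ⟨k, rfl⟩ : ∃ k, r = 2 * k + 2 := by
    obtain ⟨m, hm⟩ := hreven
    exact ⟨m - 1, by omega⟩
  have hq1 : 1 < q := hq.one_lt
  have hF2 : ringChar F ≠ 2 := by
    intro h
    have := FiniteField.even_card_of_char_two h
    rw [hF] at this
    have h2 : Odd (q ^ 2) := hqodd.pow
    rw [Nat.odd_iff] at h2
    omega
  have h2F : (2 : F) ≠ 0 := Ring.two_ne_zero hF2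
  have hb' : φ b ≠ b := by rwa [hφq]
  have hab' : 4 * (φ a * a) + (φ b - b) ^ 2 = 0 := by
    rw [hφq, hφq, ← pow_succ]; exact hab
  obtain ⟨v, κ, hv, hκ0, hκ⟩ := setup φ hφ a b ha hb' h2F hab'
  obtain ⟨τ, hτ⟩ := graph_eq φ hφ b hb' v hv
  have hcK := card_FixK φ hφ b hb' q hF
  have hcK' : Fintype.card (FixK φ) = q := by rw [← Nat.card_eq_fintype_card, hcK]
  have hK2 : ringChar (FixK φ) ≠ 2 := by
    intro h
    have := FiniteField.even_card_of_char_two h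
    rw [hcK'] at this
    rw [Nat.odd_iff] at hqodd
    omega
  have hB : BSet q (2 * k + 2) a b = Bφ φ (n := 2 * k + 1) a b := by
    ext x
    have e1 : ∀ i, x.1 i ^ (2 * q) = φ (x.1 i) ^ 2 := by
      intro i; rw [hφq, ← pow_mul, mul_comm 2 q]
    have e2 : ∀ i, x.1 i ^ (q + 1) = φ (x.1 i) * x.1 i := by
      intro i; rw [hφq, pow_succ]
    simp only [BSet, Set.mem_ofPred_eq, e1, e2]
    simp only [← hφq]
    rfl
  obtain ⟨c1, c2, c3⟩ := small_count hK2 k q hcK' κ τ hκ0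
  have hG : ∀ j, {z | (GH z ∩ Bφ φ (n := 2 * k + 1) a b).ncard = j}.ncard =
      #{w : ((Fin (2 * k + 1) → FixK φ) × (Fin (2 * k + 1) → FixK φ)) × (FixK φ × FixK φ) |
        #{p | PhiK κ τ w.1.1 w.1.2 w.2.2 p = 0} = j} := by
    intro j
    let E := Equiv.prodCongr (coordF φ hφ b hb' (2 * k + 1) v⁻¹ (inv_ne_zero hv))
      (Equiv.ofBijective _ (basis_bij φ hφ b hb'))
    rw [← Set.ncard_coe_finset, ← Set.ncard_image_of_injective _ E.injective]
    congr 1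
    rw [Equiv.image_eq_preimage_symm]
    ext z
    obtain ⟨w, rfl⟩ := E.surjective z
    simp only [Set.mem_preimage, Equiv.symm_apply_apply, Finset.coe_filter, Finset.mem_univ,
      true_and, Set.mem_ofPred_eq]
    rw [GH_count φ _ _ (coordF φ hφ b hb' (2 * k + 1) v hv)
      (fun p => PhiK κ τ w.1.1 w.1.2 w.2.2 p = 0)]
    · rw [← Set.ncard_coe_finset]
      simp
    · intro p
      rw [graph_mem φ hφ a b hb' v hv κ hκ]
      exact hτ κ w p _ rfl
  have hV : ∀ z : (Fin (2 * k + 1) → F) × F, z.1 ≠ 0 →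
      (VH z ∩ Bφ φ a b).ncard = q ^ (4 * k + 1) := by
    intro z hz
    rw [VH_count φ hφ a b hb' v hv κ hκ q hF hcK (by omega) z hz]
    congr 1; omega
  have hNH : ∀ j, NHyp q (2 * k + 2) a b j =
      #{w : ((Fin (2 * k + 1) → FixK φ) × (Fin (2 * k + 1) → FixK φ)) × (FixK φ × FixK φ) |
        #{p | PhiK κ τ w.1.1 w.1.2 w.2.2 p = 0} = j} +
      (Set.image VH {z : (Fin (2 * k + 1) → F) × F | z.1 ≠ 0 ∧ 
        (VH z ∩ Bφ φ a b).ncard = j}).ncard := by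
    intro j
    rw [← hG, ← hyper_card]
    unfold NHyp
    rw [hB]
    rfl
  have hV0 : ∀ j, j ≠ q ^ (4 * k + 1) → (Set.image VH {z : (Fin (2 * k + 1) → F) × F | z.1 ≠ 0 ∧ 
        (VH z ∩ Bφ φ a b).ncard = j}).ncard = 0 := by
    intro j hj
    have : {z : (Fin (2 * k + 1) → F) × F | z.1 ≠ 0 ∧ (VH z ∩ Bφ φ a b).ncard = j} = ∅ := by
      ext z
      simp only [Set.mem_ofPred_eq, Set.mem_empty_iff_false, iff_false, not_and]
      intro hz h
      exact hj (by rw [← h, hV z hz])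
    rw [this]; simp
  have hV1 : {z : (Fin (2 * k + 1) → F) × F | z.1 ≠ 0 ∧
      (VH z ∩ Bφ φ a b).ncard = q ^ (4 * k + 1)} = {z | z.1 ≠ 0} := by
    ext z
    simp only [Set.mem_ofPred_eq, and_iff_left_iff_imp]
    exact hV z
  have hVc := VH_image_card (F := F) (n := 2 * k + 1) (q ^ 2) hF
  have x1 : 2 * (2 * k + 2) - 3 = 4 * k + 1 := by omega
  have x2 : (3 * (2 * k + 2) - 4) / 2 = 3 * k + 1 := by omega
  have x3 : 2 * (2 * k + 2) = 4 * k + 4 := by ring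
  have hpos' : 0 < q ^ (3 * k + 1) := by positivity
  have hpos2 : 0 < q ^ (4 * k + 1) := by positivity
  have e3 : 2 * k + 2 + 1 = 2 * k + 3 := by ring
  beta_reduce at c1 c2 c3
  rw [x1, x2, x3, e3, hNH, hNH, hNH, hV1, hV0 (q ^ (4 * k + 1) - q ^ (3 * k + 1)) (by omega),
    hV0 (q ^ (4 * k + 1) + q ^ (3 * k + 1)) (by omega)]
  refine ⟨by omega, ?_, by omega⟩
  set H := (Set.image VH {z : (Fin (2 * k + 1) → F) × F | z.1 ≠ 0}).ncard with hH
  have hq2 : 1 < q ^ 2 := Nat.one_lt_pow (by norm_num) hq1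
  have hdiv : (q ^ (4 * k + 4) - 1) / (q ^ 2 - 1) = H + 1 := by
    apply Nat.div_eq_of_eq_mul_right (by omega)
    rw [mul_add, hVc, Nat.sub_mul, ← pow_succ, ← pow_mul]
    have e : 2 * (2 * k + 1 + 1) = 4 * k + 4 := by ring
    rw [e]
    have : q ^ 2 ≤ q ^ (4 * k + 4) := Nat.pow_le_pow_right (by omega) (by omega)
    omega
  rw [hdiv]
  omega
end

section
/- Let q be a prime power, r ≥ 2 an even integer, a ∈ F\{0} and b ∈ F with b^q ≠ b, where F = GF(q²). Suppose that either q is odd and 4a^{q+1} + (b^q − b)² is a non-zero square of GF(q), or q is even and Tr_q(a^{q+1}/(b^q + b)²) = 1. Among the q^{2r} affine hyperplanes of F^r of the form {x ∈ F^r : x_r = m₁x₁ + ⋯ + m_{r−1}x_{r−1} + d} (i.e., the affine hyperplanes not containing the direction (0,…,0,1)), exactly q^{2r−1} meet B(a,b) in exactly q^{2r−3} − q^{r−2} + q^{r−1} points and exactly q^{2r} − q^{2r−1} meet B(a,b) in exactly q^{2r−3} − q^{r−2} points. -/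
open Finset

open scoped Classical in
/-- Number of solutions of the hyperbolic equation. -/
lemma hyp_count_s16 {K : Type*} [Field K] [Fintype K] (q n : ℕ) (hK : Nat.card K = q)
    (κ : K) :
    Nat.card {p : (Fin n → K) × (Fin n → K) // ∑ i, p.1 i * p.2 i = κ}
      = (q ^ n - 1) * q ^ (n - 1) + if κ = 0 then q ^ n else 0 := by
  classical
  have e : {p : (Fin n → K) × (Fin n → K) // ∑ i, p.1 i * p.2 i = κ} ≃
      Σ s : Fin n → K, {t : Fin n → K // ∑ i, s i * t i = κ} :=
    { toFun := fun p => ⟨p.1.1, p.1.2, p.2⟩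
      invFun := fun p => ⟨(p.1, p.2.1), p.2.2⟩
      left_inv := fun _ => rfl
      right_inv := fun _ => rfl }
  rw [Nat.card_congr e, Nat.card_sigma]
  have h0 : Nat.card {t : Fin n → K // ∑ i, (0 : Fin n → K) i * t i = κ}
      = if κ = 0 then q ^ n else 0 := by
    split_ifs with h
    · subst h
      simp [← hK]
    · simp only [Pi.zero_apply, zero_mul, Finset.sum_const_zero]
      have : IsEmpty {t : Fin n → K // (0:K) = κ} := ⟨fun x => h x.2.symm⟩
      exact Nat.card_of_isEmpty
  have h1 : ∀ s : Fin n → K, s ≠ 0 →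
      Nat.card {t : Fin n → K // ∑ i, s i * t i = κ} = q ^ (n - 1) := by
    intro s hs
    obtain ⟨j, hj⟩ : ∃ j, s j ≠ 0 := by
      by_contra! h
      exact hs (funext h)
    have e2 : {t : Fin n → K // ∑ i, s i * t i = κ} ≃ ({i : Fin n // i ≠ j} → K) :=
      { toFun := fun t i => t.1 i
        invFun := fun g => ⟨fun i => if h : i = j then
            (κ - ∑ i : {i : Fin n // i ≠ j}, s i * g i) / s j else g ⟨i, h⟩, by
          rw [← Finset.add_sum_erase _ _ (Finset.mem_univ j)]
          rw [Finset.sum_subtype (F := inferInstance) (p := fun i => i ≠ j) (Finset.univ.erase j)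
            (by simp)]
          have : ∀ x : {i : Fin n // i ≠ j}, (x : Fin n) ≠ j := fun x => x.2
          simp [this]
          field_simp
          ring⟩
        left_inv := by
          rintro ⟨t, ht⟩
          apply Subtype.ext
          funext i
          by_cases h : i = j
          · subst h
            simp only [dif_pos]
            rw [← Finset.add_sum_erase _ _ (Finset.mem_univ i)] at ht
            rw [Finset.sum_subtype (p := fun k => k ≠ i) (Finset.univ.erase i) (by simp)] at ht
            rw [div_eq_iff hj, ← ht]
            ring
          · simp [h]
        right_inv := by
          intro g
          funext i
          simp [i.2] }
    rw [Nat.card_congr e2, Nat.card_fun, hK]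
    simp
  rw [← Finset.add_sum_erase _ _ (Finset.mem_univ (0 : Fin n → K)), h0]
  rw [Finset.sum_congr rfl (fun s hs => h1 s (Finset.ne_of_mem_erase hs))]
  rw [Finset.sum_const, Finset.card_erase_of_mem (Finset.mem_univ _), Finset.card_univ,
    ← Nat.card_eq_fintype_card, Nat.card_fun, hK]
  simp
  ring

/-- In characteristic two, trace one elements give Artin-Schreier roots in the quadratic
extension. -/
lemma as_root {F : Type*} [Field F] [Fintype F] (h : ℕ) (hF : Fintype.card F = (2 ^ h) ^ 2)
    [CharP F 2] (A : F) (hA : ∑ i ∈ Finset.range h, A ^ 2 ^ i = 1) :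
    ∃ v : F, v ^ 2 + v = A ∧ v ^ 2 ^ h = v + 1 := by
  let L := AlgebraicClosure F
  have : CharP L 2 := charP_of_injective_algebraMap (algebraMap F L).injective 2
  obtain ⟨v, hv⟩ : ∃ v : L, v ^ 2 + v = algebraMap F L A := by
    obtain ⟨v, hv⟩ := IsAlgClosed.exists_root
      (Polynomial.X ^ 2 + Polynomial.X - Polynomial.C (algebraMap F L A)) (by
        have : (Polynomial.X ^ 2 + Polynomial.X - Polynomial.C (algebraMap F L A)).degree = 2 := by
          compute_degree!
        rw [this]; decide)
    refine ⟨v, ?_⟩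
    simp [Polynomial.IsRoot] at hv
    exact sub_eq_zero.mp hv
  have hi : ∀ i : ℕ, v ^ 2 ^ i = v + ∑ j ∈ Finset.range i, (algebraMap F L A) ^ 2 ^ j := by
    intro i
    induction i with
    | zero => simp
    | succ i ih =>
      rw [Finset.sum_range_succ, ← add_assoc, ← ih, ← hv, add_pow_char_pow]
      rw [← pow_mul, pow_succ, mul_comm 2 (2 ^ i)]
      have := CharTwo.add_self_eq_zero (v ^ 2 ^ i)
      linear_combination -this
  have hh : v ^ 2 ^ h = v + 1 := by
    rw [hi, ← map_one (algebraMap F L), ← hA]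
    simp
  have hq : v ^ Fintype.card F = v := by
    rw [hF, pow_two, pow_mul, hh, add_pow_char_pow, hh, one_pow, add_assoc,
      CharTwo.add_self_eq_zero, add_zero]
  have hmem : ∃ w : F, algebraMap F L w = v := by
    have hmon : (Polynomial.X ^ Fintype.card F - Polynomial.X : Polynomial F).Monic := by
      apply Polynomial.monic_X_pow_sub
      rw [Polynomial.degree_X]
      exact_mod_cast Fintype.one_lt_card
    have h1 := Polynomial.prod_multiset_X_sub_C_of_monic_of_roots_card_eq hmon (by
      rw [FiniteField.roots_X_pow_card_sub_X,
        FiniteField.X_pow_card_sub_X_natDegree_eq F Fintype.one_lt_card]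
      rfl)
    rw [FiniteField.roots_X_pow_card_sub_X] at h1
    change ∏ a : F, (Polynomial.X - Polynomial.C a) = _ at h1
    have h2 := congrArg (Polynomial.eval₂ (algebraMap F L) v) h1
    simp [Polynomial.eval₂_finsetProd, hq] at h2
    rw [Finset.prod_eq_zero_iff] at h2
    obtain ⟨w, -, hw⟩ := h2
    exact ⟨w, (sub_eq_zero.mp hw).symm⟩
  obtain ⟨w, rfl⟩ := hmem
  refine ⟨w, (algebraMap F L).injective (by simpa using hv),
    (algebraMap F L).injective (by simpa using hh)⟩

lemma eig {F : Type*} [Field F] (σ : F →+* F) (hσ : ∀ x, σ (σ x) = x) (b u : F)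
    (hb : σ b ≠ b) (hu : u * σ u = 1) : ∃ e : F, e ≠ 0 ∧ σ e = u * e := by
  by_cases h : u + 1 = 0
  · have : u = -1 := by linear_combination h
    subst this
    exact ⟨b - σ b, sub_ne_zero.mpr hb.symm, by simp [hσ]⟩
  · refine ⟨1 + σ u, ?_, ?_⟩
    · intro h0
      apply h
      linear_combination u * h0 - hu
    · simp only [map_add, map_one, hσ]
      linear_combination -hu

lemma fix_card {F : Type*} [Field F] [Fintype F] (q : ℕ) (hF : Fintype.card F = q ^ 2)
    (σ : F →+* F) (hσ : ∀ x, σ (σ x) = x) (b : F) (hb : σ b ≠ b) :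
    Nat.card (σ.eqLocusField (RingHom.id F)) = q := by
  set K := σ.eqLocusField (RingHom.id F) with hK
  have hfix : ∀ k : K, σ k = k := fun k => k.2
  have hb' : σ b - b ≠ 0 := sub_ne_zero.mpr hb
  have hbij : Function.Bijective (fun p : K × K => (p.1 : F) + p.2 * b) := by
    constructor
    · rintro ⟨k, l⟩ ⟨k', l'⟩ h
      simp only at h
      have h' := congrArg σ h
      simp only [map_add, map_mul, hfix] at h'
      have hl : (l : F) = l' := by
        apply mul_right_cancel₀ hb'
        linear_combination h' - h
      have hk : (k : F) = k' := by
        rw [hl] at h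
        exact add_right_cancel h
      exact Prod.ext (Subtype.ext hk) (Subtype.ext hl)
    · intro x
      have hk : (σ x - x) / (σ b - b) ∈ K := by
        change σ _ = _
        simp only [map_div₀, map_sub, hσ, RingHom.id_apply]
        rw [← neg_sub (σ x), ← neg_sub (σ b), neg_div_neg_eq]
      have hl : x - (σ x - x) / (σ b - b) * b ∈ K := by
        change σ _ = _
        have hk' : σ ((σ x - x) / (σ b - b)) = (σ x - x) / (σ b - b) := hk
        rw [map_sub, map_mul, hk', RingHom.id_apply]
        field_simp
        ring
      exact ⟨(⟨_, hl⟩, ⟨_, hk⟩), by simp⟩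
  have := Nat.card_eq_of_bijective _ hbij
  rw [Nat.card_prod, Nat.card_eq_fintype_card (α := F), hF, ← pow_two] at this
  exact Nat.pow_left_injective (n := 2) (by norm_num) this

open scoped Classical in
lemma core {F : Type*} [Field F] [Fintype F] (q n : ℕ) (hF : Fintype.card F = q ^ 2)
    (σ : F →+* F) (hσ : ∀ x, σ (σ x) = x) (a b u1 u2 : F) (ha : a ≠ 0)
    (hb : σ b ≠ b) (hu : u1 ≠ u2) (h1 : u1 * σ u1 = 1) (h2 : u2 * σ u2 = 1)
    (hq1 : σ a * u1 ^ 2 - (σ b - b) * u1 - a = 0)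
    (hq2 : σ a * u2 ^ 2 - (σ b - b) * u2 - a = 0) :
    ∃ Z : Set ((Fin n → F) × F), Z.ncard = q ^ (2 * n + 1) ∧ ∀ p : (Fin n → F) × F,
      Nat.card {x : Fin n → F // σ ((∑ i, p.1 i * x i) + p.2) - ((∑ i, p.1 i * x i) + p.2)
        + ∑ i, (σ a * σ (x i) ^ 2 - a * x i ^ 2 - (σ b - b) * (x i * σ (x i))) = 0}
      = (q ^ n - 1) * q ^ (n - 1) + if p ∈ Z then q ^ n else 0 := by
  have hKcard := fix_card q hF σ hσ b hb
  set K := σ.eqLocusField (RingHom.id F) with hK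
  have hfix : ∀ k : K, σ k = k := fun k => k.2
  have hmemK : ∀ x : F, σ x = x → x ∈ K := fun x hx => hx
  obtain ⟨e1, he1, hs1⟩ := eig σ hσ b u1 hb h1
  obtain ⟨e2, he2, hs2⟩ := eig σ hσ b u2 hb h2
  have hu' : u1 - u2 ≠ 0 := sub_ne_zero.mpr hu
  have hsa : σ a ≠ 0 := (map_ne_zero σ).mpr ha
  -- the polar value
  obtain ⟨c, hc⟩ : ∃ c, c = 2 * σ a * (u1 * e1) * (u2 * e2) - 2 * a * e1 * e2
      - (σ b - b) * (e1 * (u2 * e2) + e2 * (u1 * e1)) := ⟨_, rfl⟩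
  have hβ : σ b - b = σ a * (u1 + u2) := by
    apply mul_right_cancel₀ hu'
    linear_combination hq2 - hq1
  have haa : a = - σ a * u1 * u2 := by
    linear_combination -hq1 - u1 * hβ
  have hc' : c = - (e1 * e2 * σ a * (u1 - u2) ^ 2) := by
    rw [hc]
    linear_combination (-2 * e1 * e2) * haa - (e1 * (u2 * e2) + e2 * (u1 * e1)) * hβ
  have hc0 : c ≠ 0 := by
    rw [hc']
    exact neg_ne_zero.mpr (by positivity)
  have hcσ : σ c = - c := by
    have e := congrArg σ hc
    have t1 : σ u1 * σ e1 = e1 := by rw [← map_mul, ← hs1, hσ]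
    have t2 : σ u2 * σ e2 = e2 := by rw [← map_mul, ← hs2, hσ]
    simp only [map_sub, map_add, map_mul, hσ, map_ofNat, t1, t2] at e
    rw [e, hc, hs1, hs2]
    ring
  have hφ : Function.Bijective (fun p : K × K => (p.1 : F) * e1 + p.2 * e2) := by
    have hinj : Function.Injective (fun p : K × K => (p.1 : F) * e1 + p.2 * e2) := by
      rintro ⟨k, l⟩ ⟨k', l'⟩ h
      simp only at h
      have h' := congrArg σ h
      simp only [map_add, map_mul, hfix, hs1, hs2] at h'
      have hk : (k : F) = k' := by
        apply mul_right_cancel₀ (mul_ne_zero hu' he1)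
        linear_combination h' - u2 * h
      have hl : (l : F) = l' := by
        rw [hk] at h
        exact mul_right_cancel₀ he2 (add_left_cancel h)
      exact Prod.ext (Subtype.ext hk) (Subtype.ext hl)
    refine (Nat.bijective_iff_injective_and_card _).mpr ⟨hinj, ?_⟩
    rw [Nat.card_prod, hKcard, Nat.card_eq_fintype_card, hF, pow_two]
  have hT : ∀ x : F, σ x = - x → x / c ∈ K := by
    intro x hx
    apply hmemK
    rw [map_div₀, hx, hcσ, neg_div_neg_eq]
  have hT' : ∀ x : F, (σ x - x) / c ∈ K := fun x => hT _ (by simp [hσ])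
  let α : F → K := fun m => ⟨(σ (m * e1) - m * e1) / c, hT' _⟩
  let β : F → K := fun m => ⟨(σ (m * e2) - m * e2) / c, hT' _⟩
  let δ : F → K := fun d => ⟨(σ d - d) / c, hT' _⟩
  have hα : ∀ m, σ m * (u1 * e1) - m * e1 = c * α m := by
    intro m
    simp only [α, map_mul, hs1]
    field_simp
  have hβ : ∀ m, σ m * (u2 * e2) - m * e2 = c * β m := by
    intro m
    simp only [β, map_mul, hs2]
    field_simp
  have hδ : ∀ m, σ m - m = c * δ m := by
    intro m
    simp only [δ]
    field_simp
  let κ : (Fin n → F) × F → K := fun p => (∑ i, α (p.1 i) * β (p.1 i)) - δ p.2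
  -- local computation
  have hloc : ∀ (m : F) (s t : K), 
      σ (m * ((s : F) * e1 + t * e2)) - m * ((s : F) * e1 + t * e2) +
      (σ a * σ ((s : F) * e1 + t * e2) ^ 2 - a * ((s : F) * e1 + t * e2) ^ 2
        - (σ b - b) * (((s : F) * e1 + t * e2) * σ ((s : F) * e1 + t * e2)))
      = c * (((s + β m) * (t + α m) - α m * β m : K) : F) := by
    intro m s t
    push_cast
    simp only [map_add, map_mul, hfix, hs1, hs2]
    linear_combination (s : F) * hα m + t * hβ m + (s : F) ^ 2 * e1 ^ 2 * hq1
      + (t : F) ^ 2 * e2 ^ 2 * hq2 - (s : F) * t * hc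
  refine ⟨{p | κ p = 0}, ?_, ?_⟩
  · have hsurj : ∀ k : K, ∃ d : F, δ d = k := by
      intro k
      have hb' : σ b - b ≠ 0 := sub_ne_zero.mpr hb
      have hσk : σ (k * c / (σ b - b)) = k * c / (σ b - b) := by
        rw [map_div₀, map_mul, hfix, hcσ, map_sub, hσ, ← neg_sub (σ b), mul_neg, neg_div_neg_eq]
      refine ⟨k * c / (σ b - b) * b, Subtype.ext ?_⟩
      simp only [δ]
      rw [map_mul, hσk]
      field_simp
    choose g hg using hsurj
    have hδadd : ∀ x y, δ (x + y) = δ x + δ y := by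
      intro x y
      apply Subtype.ext
      simp only [δ, map_add, Subfield.coe_add]
      ring
    have hδ0 : ∀ x, δ x = 0 ↔ x ∈ K := by
      intro x
      rw [← Subtype.coe_inj]
      simp only [δ, Subfield.coe_zero, div_eq_zero_iff, hc0, or_false, sub_eq_zero]
      rfl
    have e : {p : (Fin n → F) × F | κ p = 0} ≃ (Fin n → F) × K :=
      { toFun := fun p => (p.1.1, ⟨p.1.2 - g (∑ i, α (p.1.1 i) * β (p.1.1 i)), by
          have h := p.2
          simp only [Set.mem_ofPred_eq, κ] at h
          rw [← hδ0]
          have h3 := hδadd (p.1.2 - g (∑ i, α (p.1.1 i) * β (p.1.1 i)))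
            (g (∑ i, α (p.1.1 i) * β (p.1.1 i)))
          rw [sub_add_cancel, hg] at h3
          linear_combination -h3 - h⟩)
        invFun := fun p => ⟨(p.1, p.2 + g (∑ i, α (p.1 i) * β (p.1 i))), by
          simp only [Set.mem_ofPred_eq, κ]
          rw [hδadd, hg, (hδ0 p.2).mpr p.2.2]
          ring⟩
        left_inv := fun p => by simp
        right_inv := fun p => by simp }
    rw [← Nat.card_coe_set_eq, Nat.card_congr e, Nat.card_prod, Nat.card_fun, hKcard,
      Nat.card_eq_fintype_card, hF]
    simp
    ring
  · intro p
    have : Fintype K := Fintype.ofFinite K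
    rw [show (p ∈ {p | κ p = 0}) = (κ p = 0) from rfl, ← hyp_count_s16 q n hKcard (κ p)]
    symm
    let ψ : (Fin n → K) × (Fin n → K) → (Fin n → F) := fun st i =>
      ((st.1 i - β (p.1 i) : K) : F) * e1 + ((st.2 i - α (p.1 i) : K) : F) * e2
    have hψ : Function.Bijective ψ := by
      constructor
      · rintro ⟨s, t⟩ ⟨s', t'⟩ h
        have h' : ∀ i, (s i - β (p.1 i), t i - α (p.1 i)) = (s' i - β (p.1 i), t' i - α (p.1 i)) :=
          fun i => hφ.1 (congrFun h i)
        simp only [Prod.mk.injEq, sub_left_inj] at h'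
        exact Prod.ext (funext fun i => (h' i).1) (funext fun i => (h' i).2)
      · intro x
        choose f hf using fun i => hφ.2 (x i)
        refine ⟨(fun i => (f i).1 + β (p.1 i), fun i => (f i).2 + α (p.1 i)), ?_⟩
        funext i
        simp only [ψ, add_sub_cancel_right]
        exact hf i
    refine Nat.card_congr ((Equiv.ofBijective ψ hψ).subtypeEquiv ?_)
    rintro ⟨s, t⟩
    have key : σ ((∑ i, p.1 i * ψ (s, t) i) + p.2) - ((∑ i, p.1 i * ψ (s, t) i) + p.2)
        + ∑ i, (σ a * σ (ψ (s, t) i) ^ 2 - a * ψ (s, t) i ^ 2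
          - (σ b - b) * (ψ (s, t) i * σ (ψ (s, t) i)))
        = c * (((∑ i, s i * t i) - κ p : K) : F) := by
      have h3 : ∀ i, σ (p.1 i * ψ (s, t) i) - p.1 i * ψ (s, t) i +
        (σ a * σ (ψ (s, t) i) ^ 2 - a * ψ (s, t) i ^ 2
          - (σ b - b) * (ψ (s, t) i * σ (ψ (s, t) i)))
          = c * ((s i * t i - α (p.1 i) * β (p.1 i) : K) : F) := by
        intro i
        have := hloc (p.1 i) (s i - β (p.1 i)) (t i - α (p.1 i))
        rw [sub_add_cancel, sub_add_cancel] at this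
        exact this
      have h4 := Finset.sum_congr (rfl : (Finset.univ : Finset (Fin n)) = _) (fun i _ => h3 i)
      rw [Finset.sum_add_distrib, Finset.sum_sub_distrib, ← Finset.mul_sum] at h4
      simp only [κ]
      have h5 : (((∑ i, s i * t i) - ((∑ i, α (p.1 i) * β (p.1 i)) - δ p.2) : K) : F)
          = (∑ i, ((s i * t i - α (p.1 i) * β (p.1 i) : K) : F)) + δ p.2 := by
        push_cast
        rw [Finset.sum_sub_distrib]
        ring
      rw [h5, mul_add, ← h4, ← hδ, map_add, map_sum]
      ring
    simp only [Equiv.ofBijective_apply]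
    rw [key, mul_eq_zero, or_iff_right hc0, ZeroMemClass.coe_eq_zero, sub_eq_zero]

lemma exists_roots (q : ℕ) (hq : IsPrimePow q) {F : Type*} [Field F] [Fintype F]
    (hF : Fintype.card F = q ^ 2) (σ : F →+* F) (hσq : ∀ x, σ x = x ^ q) (hσ : ∀ x, σ (σ x) = x)
    (a b : F) (ha : a ≠ 0) (hb : σ b ≠ b)
    (hab : (Odd q ∧
        ∃ s : F, s ≠ 0 ∧ s ^ q = s ∧ 4 * a ^ (q + 1) + (b ^ q - b) ^ 2 = s ^ 2) ∨
      (Even q ∧ ∃ h : ℕ, q = 2 ^ h ∧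
        ∑ i ∈ Finset.range h, (a ^ (q + 1) / (b ^ q + b) ^ 2) ^ 2 ^ i = 1)) :
    ∃ u1 u2 : F, u1 ≠ u2 ∧ u1 * σ u1 = 1 ∧ u2 * σ u2 = 1 ∧
      σ a * u1 ^ 2 - (σ b - b) * u1 - a = 0 ∧ σ a * u2 ^ 2 - (σ b - b) * u2 - a = 0 := by
  have hsa : σ a ≠ 0 := (map_ne_zero σ).mpr ha
  have hb' : σ b - b ≠ 0 := sub_ne_zero.mpr hb
  rcases hab with ⟨hodd, s, hs0, hs, hss⟩ | ⟨heven, h, hqh, htr⟩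
  · rw [← hσq] at hs
    rw [← hσq, pow_succ a, ← hσq] at hss
    have h2 : (2 : F) ≠ 0 := by
      intro h2
      have hd : ringChar F ∣ 2 := (ringChar.spec F 2).mp (by exact_mod_cast h2)
      have hc2 : ringChar F = 2 := by
        rcases (Nat.dvd_prime Nat.prime_two).mp hd with h | h
        · exact absurd h (CharP.ringChar_ne_one)
        · exact h
      have := (FiniteField.even_card_iff_char_two (F := F)).mp hc2
      rw [hF] at this
      have ho : Odd (q ^ 2) := hodd.pow
      rw [Nat.odd_iff] at ho
      omega
    have hmain : ∀ t : F, σ t = t → t ^ 2 = s ^ 2 →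
        ((σ b - b + t) / (2 * σ a)) * σ ((σ b - b + t) / (2 * σ a)) = 1 ∧
        σ a * ((σ b - b + t) / (2 * σ a)) ^ 2 - (σ b - b) * ((σ b - b + t) / (2 * σ a)) - a = 0 := by
      intro t ht hts
      rw [← hts] at hss
      constructor
      · rw [map_div₀, map_add, map_sub, map_mul, hσ, hσ, ht, map_ofNat]
        field_simp
        linear_combination -hss
      · field_simp
        linear_combination -hss
    obtain ⟨m1, m2⟩ := hmain s hs rfl
    obtain ⟨m3, m4⟩ := hmain (-s) (by simp [hs]) (by ring)
    refine ⟨_, _, ?_, m1, m3, m2, m4⟩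
    intro heq
    rw [div_left_inj' (mul_ne_zero h2 hsa)] at heq
    have : 2 * s = 0 := by linear_combination heq
    exact (mul_ne_zero h2 hs0) this
  · have hc2 : ringChar F = 2 := by
      rw [FiniteField.even_card_iff_char_two, hF]
      exact Nat.even_iff.mp (heven.pow_of_ne_zero two_ne_zero)
    have : CharP F 2 := by rw [← hc2]; exact ringChar.charP F
    have hd : σ b + b = σ b - b := (CharTwo.sub_eq_add _ _).symm
    obtain ⟨v, hv, hvq⟩ := as_root h (by rw [hF, hqh]) _ htr
    rw [← hqh, ← hσq] at hvq
    rw [← hσq, pow_succ a, ← hσq, hd, eq_div_iff (pow_ne_zero 2 hb')] at hv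
    have h2 : (2 : F) = 0 := CharTwo.two_eq_zero
    have hmain : ∀ w : F, (w ^ 2 + w) * (σ b - b) ^ 2 = σ a * a → σ w = w + 1 →
        ((σ b - b) * w / σ a) * σ ((σ b - b) * w / σ a) = 1 ∧
        σ a * ((σ b - b) * w / σ a) ^ 2 - (σ b - b) * ((σ b - b) * w / σ a) - a = 0 := by
      intro w hw hww
      constructor
      · rw [map_div₀, map_mul, map_sub, hσ, hσ, hww]
        field_simp
        linear_combination hw - (σ b - b) ^ 2 * (w ^ 2 + w) * h2
      · field_simp
        linear_combination hw - (σ b - b) ^ 2 * w * h2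
    obtain ⟨m1, m2⟩ := hmain v hv hvq
    obtain ⟨m3, m4⟩ := hmain (v + 1) (by linear_combination hv + (v + 1) * (σ b - b) ^ 2 * h2)
      (by simp [hvq])
    refine ⟨_, _, ?_, m1, m3, m2, m4⟩
    intro heq
    rw [div_left_inj' hsa] at heq
    have := mul_left_cancel₀ hb' heq
    simp at this

/-- for `r ≥ 2` even, with either `q` odd and `4a^{q+1} + (b^q − b)²` a
non-zero square of `GF(q) = {s : F | s^q = s}`, or `q = 2^h` even and
`Tr_q(a^{q+1}/(b^q + b)²) = 1`: among the `q^{2r}` affine hyperplanes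
`x_r = m₁x₁ + ⋯ + m_{r−1}x_{r−1} + d` (parametrised by `(m, d)`), exactly `q^{2r−1}`
meet `B(a,b)` in `q^{2r−3} − q^{r−2} + q^{r−1}` points and exactly `q^{2r} − q^{2r−1}`
meet `B(a,b)` in `q^{2r−3} − q^{r−2}` points. -/
theorem statement16 (q r : ℕ) (hq : IsPrimePow q) (hr : 2 ≤ r) (hreven : Even r)
    {F : Type*} [Field F] [Fintype F] (hF : Fintype.card F = q ^ 2)
    (a b : F) (ha : a ≠ 0) (hb : b ^ q ≠ b)
    (hab : (Odd q ∧
        ∃ s : F, s ≠ 0 ∧ s ^ q = s ∧ 4 * a ^ (q + 1) + (b ^ q - b) ^ 2 = s ^ 2) ∨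
      (Even q ∧ ∃ h : ℕ, q = 2 ^ h ∧
        ∑ i ∈ Finset.range h, (a ^ (q + 1) / (b ^ q + b) ^ 2) ^ 2 ^ i = 1)) :
    Set.ncard {p : (Fin (r - 1) → F) × F |
        ({x : (Fin (r - 1) → F) × F | x.2 = (∑ i, p.1 i * x.1 i) + p.2}
            ∩ BSet q r a b).ncard
          = q ^ (2 * r - 3) - q ^ (r - 2) + q ^ (r - 1)} = q ^ (2 * r - 1) ∧
    Set.ncard {p : (Fin (r - 1) → F) × F |
        ({x : (Fin (r - 1) → F) × F | x.2 = (∑ i, p.1 i * x.1 i) + p.2}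
            ∩ BSet q r a b).ncard
          = q ^ (2 * r - 3) - q ^ (r - 2)} = q ^ (2 * r) - q ^ (2 * r - 1) := by
  classical
  obtain ⟨σ, hσq, hσ⟩ : ∃ σ : F →+* F, (∀ x, σ x = x ^ q) ∧ ∀ x, σ (σ x) = x := by
    obtain ⟨p, k, hp, hk, rfl⟩ := hq
    have hp' : p.Prime := hp.nat_prime
    have : Fact p.Prime := ⟨hp'⟩
    have : CharP F p := charP_of_card_eq_prime_pow (f := k * 2) (by rw [hF, ← pow_mul])
    refine ⟨iterateFrobenius F p k, fun x => iterateFrobenius_def p k x, fun x => ?_⟩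
    rw [iterateFrobenius_def, iterateFrobenius_def, ← pow_mul, ← pow_two, ← hF,
      FiniteField.pow_card]
  have hqpos : 0 < q := hq.pos
  obtain ⟨u1, u2, hu, h1, h2, hq1, hq2⟩ := exists_roots q hq hF σ hσq hσ a b ha
    (by rwa [hσq]) hab
  obtain ⟨n, rfl⟩ : ∃ n, r = n + 1 := ⟨r - 1, by omega⟩
  obtain ⟨n, rfl⟩ : ∃ k, n = k + 1 := ⟨n - 1, by omega⟩
  obtain ⟨Z, hZ, hcount⟩ := core q (n + 1) hF σ hσ a b u1 u2 ha (by rwa [hσq]) hu h1 h2 hq1 hq2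
  have hred : ∀ p : (Fin (n + 1 + 1 - 1) → F) × F,
      ({x : (Fin (n + 1 + 1 - 1) → F) × F | x.2 = (∑ i, p.1 i * x.1 i) + p.2}
            ∩ BSet q (n + 1 + 1) a b).ncard
        = (q ^ (n + 1) - 1) * q ^ (n + 1 - 1) + if p ∈ Z then q ^ (n + 1) else 0 := by
    intro p
    refine Eq.trans ?_ ((hcount p).trans (by congr))
    rw [← Nat.card_coe_set_eq]
    have hiff : ∀ x : Fin (n + 1) → F,
        (((x, (∑ i, p.1 i * x i) + p.2) : (Fin (n + 1 + 1 - 1) → F) × F) ∈ BSet q (n + 1 + 1) a b ↔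
        σ ((∑ i : Fin (n + 1), p.1 i * x i) + p.2) - ((∑ i : Fin (n + 1), p.1 i * x i) + p.2)
        + ∑ i : Fin (n + 1),
          (σ a * σ (x i) ^ 2 - a * x i ^ 2 - (σ b - b) * (x i * σ (x i))) = 0) := by
      intro x
      change (((∑ i : Fin (n + 1), p.1 i * x i) + p.2) ^ q - ((∑ i : Fin (n + 1), p.1 i * x i) + p.2)
        + a ^ q * (∑ i : Fin (n + 1), x i ^ (2 * q)) - a * (∑ i : Fin (n + 1), x i ^ 2)
        = (b ^ q - b) * ∑ i : Fin (n + 1), x i ^ (q + 1)) ↔ _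
      rw [← sub_eq_zero]
      have : ∀ i, σ (x i) ^ 2 = x i ^ (2 * q) := fun i => by rw [hσq, ← pow_mul, mul_comm]
      have h' : ∀ i, x i * σ (x i) = x i ^ (q + 1) := fun i => by rw [hσq, pow_succ']
      simp only [Finset.sum_sub_distrib, ← Finset.mul_sum, this, h']
      rw [hσq a, hσq b, hσq]
      apply Eq.congr_left
      ring
    refine Nat.card_congr ⟨fun x => ⟨x.1.1, (hiff _).mp ?_⟩,
      fun x => ⟨(x.1, (∑ i, p.1 i * x.1 i) + p.2), ⟨rfl, (hiff _).mpr x.2⟩⟩, ?_, ?_⟩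
    · obtain ⟨⟨x, y⟩, hx, hB⟩ := x
      have hx' : y = (∑ i, p.1 i * x i) + p.2 := hx
      rw [hx'] at hB
      exact hB
    · rintro ⟨⟨x, y⟩, hx, hB⟩
      have hx' : y = (∑ i, p.1 i * x i) + p.2 := hx
      subst hx'
      rfl
    · intro x
      rfl
  have hnum : (q ^ (n + 1) - 1) * q ^ (n + 1 - 1)
      = q ^ (2 * (n + 1 + 1) - 3) - q ^ (n + 1 + 1 - 2) := by
    rw [Nat.sub_mul, one_mul, ← pow_add]
    congr 2
    omega
  have hpos : q ^ (n + 1) ≠ 0 := (pow_pos hqpos _).ne'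
  have hS1 : {p : (Fin (n + 1 + 1 - 1) → F) × F |
        ({x : (Fin (n + 1 + 1 - 1) → F) × F | x.2 = (∑ i, p.1 i * x.1 i) + p.2}
            ∩ BSet q (n + 1 + 1) a b).ncard
          = q ^ (2 * (n + 1 + 1) - 3) - q ^ (n + 1 + 1 - 2) + q ^ (n + 1 + 1 - 1)} = Z := by
    ext p
    change (_ = _) ↔ _
    rw [hred, hnum, Nat.add_right_inj]
    by_cases hp : p ∈ Z
    · simp [hp]
    · simp only [hp, if_false, iff_false]
      exact hpos.symm
  have hS2 : {p : (Fin (n + 1 + 1 - 1) → F) × F |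
        ({x : (Fin (n + 1 + 1 - 1) → F) × F | x.2 = (∑ i, p.1 i * x.1 i) + p.2}
            ∩ BSet q (n + 1 + 1) a b).ncard
          = q ^ (2 * (n + 1 + 1) - 3) - q ^ (n + 1 + 1 - 2)} = Zᶜ := by
    ext p
    change (_ = _) ↔ _
    rw [hred, hnum, Set.mem_compl_iff]
    by_cases hp : p ∈ Z
    · simp only [hp, if_true, not_true, iff_false]
      omega
    · simp [hp]
  have hZ' : Z.ncard = q ^ (2 * (n + 1 + 1) - 1) := by
    rw [hZ]; congr 1
  rw [hS1, hS2]
  refine ⟨hZ', ?_⟩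
  rw [Set.ncard_compl, hZ', Nat.card_prod, Nat.card_fun, Nat.card_eq_fintype_card, hF]
  congr 1
  simp
  ring
end

section
/- Let q be a prime power, r ≥ 2 an even integer, a ∈ F\{0} and b ∈ F with b^q ≠ b, where F = GF(q²). Suppose that either q is odd and 4a^{q+1} + (b^q − b)² is a non-zero square of GF(q), or q is even and Tr_q(a^{q+1}/(b^q + b)²) = 1. Set j = q^{r−1} − q^{r−2}. Then for every nonzero vector u = (u₀,u₁,…,u_r) ∈ F^{r+1}, the quantity #{x ∈ B(a,b) : u₀ + u₁x₁ + ⋯ + u_rx_r = 0} + j·[u_r = 0] (where [u_r = 0] is 1 if u_r = 0 and 0 otherwise) belongs to the three-element set { q^{r−1} − q^{r−2}, q^{2r−3} − q^{r−2}, q^{2r−3} − q^{r−2} + q^{r−1} }; that is, the multiset obtained from B(a,b) by adjoining the point at infinity P∞ = (0,…,0,1) with multiplicity j is a 3-character multiset of PG(r,q²) with respect to hyperplanes. -/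
open Finset

lemma hyp_count_s17 {K : Type*} [Field K] [Fintype K] [DecidableEq K] (n : ℕ) (u : Fin n → K)
    (hu : u ≠ 0) (c : K) :
    (univ.filter fun x : Fin n → K => ∑ i, u i * x i = c).card = Fintype.card K ^ (n - 1) := by
  obtain ⟨j, hj⟩ : ∃ j, u j ≠ 0 := by
    by_contra! h
    exact hu (funext h)
  have hn : 0 < n := j.pos
  have key : ∀ c : K, (univ.filter fun x : Fin n → K => ∑ i, u i * x i = c).card
      = (univ.filter fun x : Fin n → K => ∑ i, u i * x i = 0).card := by
    intro c
    refine Finset.card_bij' (fun x _ => x - Pi.single j (c / u j))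
      (fun x _ => x + Pi.single j (c / u j)) ?_ ?_ ?_ ?_
    · intro x hx
      simp only [mem_filter, mem_univ, true_and] at hx ⊢
      simp [mul_sub, Finset.sum_sub_distrib, hx, Pi.single_apply, mul_div_cancel₀ _ hj]
    · intro x hx
      simp only [mem_filter, mem_univ, true_and] at hx ⊢
      simp [mul_add, Finset.sum_add_distrib, hx, Pi.single_apply, mul_div_cancel₀ _ hj]
    · intro x _; simp
    · intro x _; simp
  have h2 := Finset.card_eq_sum_card_fiberwise (s := (univ : Finset (Fin n → K)))
    (t := (univ : Finset K)) (f := fun x => ∑ i, u i * x i) (by intro x _; simp)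
  simp only [key, Finset.sum_const, card_univ, Fintype.card_fun, Fintype.card_fin,
    smul_eq_mul] at h2
  rw [key]
  have hK : 0 < Fintype.card K := Fintype.card_pos
  obtain ⟨m, rfl⟩ : ∃ m, n = m + 1 := ⟨n - 1, by omega⟩
  rw [pow_succ'] at h2
  simpa using (Nat.eq_of_mul_eq_mul_left hK h2).symm

lemma dot_count {K : Type*} [Field K] [Fintype K] [DecidableEq K] (n : ℕ) (d : K) :
    (univ.filter fun x : (Fin n → K) × (Fin n → K) => ∑ i, x.1 i * x.2 i = d).card
      = (Fintype.card K ^ n - 1) * Fintype.card K ^ (n - 1)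
        + if d = 0 then Fintype.card K ^ n else 0 := by
  have h2 : (univ.filter fun x : (Fin n → K) × (Fin n → K) => ∑ i, x.1 i * x.2 i = d).card
      = ∑ y : Fin n → K, (univ.filter fun z : Fin n → K => ∑ i, y i * z i = d).card := by
    simp only [Finset.card_filter]
    rw [Fintype.sum_prod_type]
  rw [h2, ← Finset.sum_erase_add _ _ (mem_univ (0 : Fin n → K))]
  congr 1
  · rw [Finset.sum_congr rfl (fun y hy => hyp_count_s17 n y (Finset.ne_of_mem_erase hy) d)]
    simp [Finset.card_erase_of_mem]
  · split_ifs with h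
    · simp [h]
    · simp [Ne.symm h]

lemma quad_count {K : Type*} [Field K] [Fintype K] [DecidableEq K] (n : ℕ)
    (α γ : Fin n → K) (d : K) :
    (univ.filter fun x : Fin n → K × K =>
      ∑ i, ((x i).1 * (x i).2 + α i * (x i).1 + γ i * (x i).2) = d).card
      = (Fintype.card K ^ n - 1) * Fintype.card K ^ (n - 1)
        + if d + ∑ i, α i * γ i = 0 then Fintype.card K ^ n else 0 := by
  rw [← dot_count n]
  refine Finset.card_bij' (fun x _ => (fun i => (x i).1 + γ i, fun i => (x i).2 + α i))
      (fun x _ => fun i => (x.1 i - γ i, x.2 i - α i)) ?_ ?_ ?_ ?_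
  · intro x hx
    simp only [mem_filter, mem_univ, true_and] at hx ⊢
    rw [← hx, ← Finset.sum_add_distrib]
    exact Finset.sum_congr rfl fun i _ => by ring
  · intro x hx
    simp only [mem_filter, mem_univ, true_and] at hx ⊢
    rw [← sub_eq_iff_eq_add] at hx
    rw [← hx, ← Finset.sum_sub_distrib]
    exact Finset.sum_congr rfl fun i _ => by ring
  · intro x _; simp
  · intro x _; simp

/-- hilbert 90 -/
lemma h90 {F : Type*} [Field F] [Fintype F] (q : ℕ) (hq : 2 ≤ q) (hF : Fintype.card F = q ^ 2)
    (w : F) (hw : w ^ (q + 1) = 1) : ∃ v : F, v ≠ 0 ∧ v ^ q = w * v := by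
  classical
  have hw0 : w ≠ 0 := by
    rintro rfl
    simp at hw
  obtain ⟨g, hg⟩ := IsCyclic.exists_generator (α := Fˣ)
  obtain ⟨k, hk⟩ := Subgroup.mem_zpowers_iff.1 (hg (Units.mk0 w hw0))
  have ho : orderOf g = q ^ 2 - 1 := by
    rw [orderOf_eq_card_of_forall_mem_zpowers hg, Nat.card_eq_fintype_card, Fintype.card_units, hF]
  have h1 : g ^ (k * (q + 1 : ℕ)) = 1 := by
    rw [zpow_mul, hk, zpow_natCast]
    ext; simpa using hw
  rw [← orderOf_dvd_iff_zpow_eq_one, ho] at h1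
  have h3 : ((q ^ 2 - 1 : ℕ) : ℤ) = ((q:ℤ) - 1) * ((q + 1 : ℕ) : ℤ) := by
    have : 1 ≤ q ^ 2 := Nat.one_le_pow _ _ (by omega)
    push_cast [this]; ring
  rw [h3] at h1
  obtain ⟨m, hm⟩ := Int.dvd_of_mul_dvd_mul_right (by positivity) h1
  refine ⟨(g ^ m : Fˣ), Units.ne_zero _, ?_⟩
  have : (g ^ m) ^ q = Units.mk0 w hw0 * g ^ m := by
    rw [← hk, hm, ← zpow_natCast, ← zpow_mul, ← zpow_add]
    congr 1; ring
  have := congrArg Units.val this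
  simpa using this


lemma fix_card_s17 {F : Type*} [Field F] [Fintype F] (q : ℕ) (hq : 2 ≤ q)
    (hF : Fintype.card F = q ^ 2) : Set.ncard {x : F | x ^ q = x} = q := by
  classical
  have h1 := IsCyclic.card_powMonoidHom_ker (G := Fˣ) (q - 1)
  have hd : (q - 1) ∣ q ^ 2 - 1 := by simpa using Nat.sub_dvd_pow_sub_pow q 1 2
  rw [Nat.card_eq_fintype_card (α := Fˣ), Fintype.card_units, hF, Nat.gcd_eq_right hd] at h1
  have h2 : {x : F | x ^ q = x} = insert 0 ((fun x : Fˣ => (x : F)) ''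
      ((powMonoidHom (q - 1) : Fˣ →* Fˣ).ker : Set Fˣ)) := by
    ext x
    simp only [Set.mem_ofPred_eq, Set.mem_insert_iff, Set.mem_image, SetLike.mem_coe,
      MonoidHom.mem_ker, powMonoidHom_apply]
    constructor
    · intro h
      by_cases hx : x = 0
      · exact Or.inl hx
      · right
        refine ⟨Units.mk0 x hx, ?_, rfl⟩
        ext
        simp only [Units.val_pow_eq_pow_val, Units.val_mk0, Units.val_one]
        have : x ^ (q - 1) * x = 1 * x := by
          rw [← pow_succ, Nat.sub_add_cancel (by omega), h, one_mul]
        exact mul_right_cancel₀ hx this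
    · rintro (rfl | ⟨y, hy, rfl⟩)
      · exact zero_pow (by omega)
      · have := congrArg Units.val hy
        simp only [Units.val_pow_eq_pow_val, Units.val_one] at this
        conv_lhs => rw [← Nat.sub_add_cancel (show 1 ≤ q by omega)]
        rw [pow_succ, this, one_mul]
  rw [h2, Set.ncard_insert_of_notMem (by simp), Set.ncard_image_of_injective _ Units.val_injective,
    ← Nat.card_coe_set_eq]
  have : Nat.card ((powMonoidHom (q - 1) : Fˣ →* Fˣ).ker : Set Fˣ) = q - 1 := h1
  rw [this]; omega

lemma coord_bij {F : Type*} [Field F] [Fintype F] (q : ℕ) (hF : Fintype.card F = q ^ 2)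
    (φ : F →+* F) (K : Subfield F) (hK : ∀ x, x ∈ K ↔ φ x = x) (hcK : Nat.card K = q)
    (v1 v2 w1 w2 : F) (h1 : v1 ≠ 0) (h2 : v2 ≠ 0) (hw : w1 ≠ w2)
    (hv1 : φ v1 = w1 * v1) (hv2 : φ v2 = w2 * v2) :
    Function.Bijective (fun p : K × K => (p.1 : F) * v1 + p.2 * v2) := by
  classical
  rw [Fintype.bijective_iff_injective_and_card]
  constructor
  · rintro ⟨y, z⟩ ⟨y', z'⟩ h
    simp only at h
    have e := congrArg φ h
    simp only [map_add, map_mul, (hK _).1 y.2, (hK _).1 z.2, (hK _).1 y'.2, (hK _).1 z'.2,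
      hv1, hv2] at e
    have hz : ((z : F) - z') * (v2 * (w2 - w1)) = 0 := by linear_combination e - w1 * h
    have hy : ((y : F) - y') * (v1 * (w1 - w2)) = 0 := by linear_combination e - w2 * h
    have n1 : v2 * (w2 - w1) ≠ 0 := mul_ne_zero h2 (sub_ne_zero.2 hw.symm)
    have n2 : v1 * (w1 - w2) ≠ 0 := mul_ne_zero h1 (sub_ne_zero.2 hw)
    have a1 := sub_eq_zero.1 ((mul_eq_zero.1 hz).resolve_right n1)
    have a2 := sub_eq_zero.1 ((mul_eq_zero.1 hy).resolve_right n2)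
    exact Prod.ext (Subtype.ext a2) (Subtype.ext a1)
  · rw [Fintype.card_prod, hF, ← Nat.card_eq_fintype_card, hcK, sq]

lemma core_count {F : Type*} [Field F] [Fintype F] (q : ℕ) (hF : Fintype.card F = q ^ 2)
    (φ : F →+* F) (hφ : ∀ x, φ (φ x) = x)
    (K : Subfield F) (hK : ∀ x, x ∈ K ↔ φ x = x) (hcK : Nat.card K = q)
    (v1 v2 w1 w2 a β : F) (h1 : v1 ≠ 0) (h2 : v2 ≠ 0) (hw : w1 ≠ w2)
    (hv1 : φ v1 = w1 * v1) (hv2 : φ v2 = w2 * v2) (ha : a ≠ 0)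
    (hw1 : w1 * φ w1 = 1) (hw2 : w2 * φ w2 = 1)
    (hs : φ a * (w1 + w2) = β) (hp : φ a * w1 * w2 = - a)
    (n : ℕ) (c0 : F) (c : Fin n → F) :
    Set.ncard {x : Fin n → F | (φ c0 - c0) + ∑ i, (φ (c i * x i) - c i * x i
      + (φ a * φ (x i) ^ 2 - a * x i ^ 2 - β * x i * φ (x i))) = 0} = (q ^ n - 1) * q ^ (n - 1)
      ∨ Set.ncard {x : Fin n → F | (φ c0 - c0) + ∑ i, (φ (c i * x i) - c i * x i
      + (φ a * φ (x i) ^ 2 - a * x i ^ 2 - β * x i * φ (x i))) = 0} =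
      (q ^ n - 1) * q ^ (n - 1) + q ^ n := by
  classical
  set E : F := - φ a * (w1 - w2) ^ 2 * v1 * v2 with hE
  have hφa : φ a ≠ 0 := by simpa using ha
  have hE0 : E ≠ 0 := by
    rw [hE]
    have := sub_ne_zero.2 hw
    simp [hφa, this, h1, h2]
  have hw10 : w1 ≠ 0 := left_ne_zero_of_mul_eq_one hw1
  have hw20 : w2 ≠ 0 := left_ne_zero_of_mul_eq_one hw2
  have hφE : φ E = - E := by
    rw [hE]
    simp only [map_mul, map_neg, map_pow, map_sub, hφ, hv1, hv2]
    have e1 : φ w1 = 1 / w1 := by field_simp; linear_combination hw1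
    have e2 : φ w2 = 1 / w2 := by field_simp; linear_combination hw2
    rw [e1, e2]
    have : a = - (φ a * w1 * w2) := by rw [hp]; ring
    generalize φ a = A at *
    rw [this]
    field_simp
    ring
  have hT : ∀ t : F, (φ t - t) / E ∈ K := by
    intro t
    rw [hK, map_div₀, map_sub, hφ, hφE]
    field_simp
    ring
  let e : K × K ≃ F := Equiv.ofBijective _
    (coord_bij q hF φ K hK hcK v1 v2 w1 w2 h1 h2 hw hv1 hv2)
  have he : ∀ p : K × K, e p = (p.1 : F) * v1 + p.2 * v2 := fun p => rfl
  let e' : (Fin n → K × K) ≃ (Fin n → F) := Equiv.arrowCongr (Equiv.refl _) e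
  have he' : ∀ x i, e' x i = e (x i) := fun _ _ => rfl
  let α : Fin n → K := fun i => ⟨_, hT (c i * v1)⟩
  let γ : Fin n → K := fun i => ⟨_, hT (c i * v2)⟩
  let d : K := - ⟨_, hT c0⟩
  have hq : Fintype.card K = q := by rw [← hcK, Nat.card_eq_fintype_card]
  have main := quad_count n α γ d
  rw [hq] at main
  have hset : Set.ncard {x : Fin n → F | (φ c0 - c0) + ∑ i, (φ (c i * x i) - c i * x i
      + (φ a * φ (x i) ^ 2 - a * x i ^ 2 - β * x i * φ (x i))) = 0} =
      (univ.filter fun x : Fin n → K × K =>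
      ∑ i, ((x i).1 * (x i).2 + α i * (x i).1 + γ i * (x i).2) = d).card := by
    rw [← Set.ncard_coe_finset, ← Set.ncard_image_of_injective _ e'.injective,
      e'.image_eq_preimage_symm]
    congr 1
    ext x
    obtain ⟨x, rfl⟩ := e'.surjective x
    simp only [Set.mem_ofPred_eq, Set.mem_preimage, Equiv.symm_apply_apply, coe_filter, mem_univ,
      true_and]
    have key : (φ c0 - c0) + ∑ i, (φ (c i * e' x i) - c i * e' x i
      + (φ a * φ (e' x i) ^ 2 - a * e' x i ^ 2 - β * e' x i * φ (e' x i)))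
      = E * ((∑ i, ((x i).1 * (x i).2 + α i * (x i).1 + γ i * (x i).2) - d : K) : F) := by
      push_cast
      rw [mul_sub, Finset.mul_sum]
      have hd : E * (d : F) = - (φ c0 - c0) := by
        simp only [d, NegMemClass.coe_neg]
        field_simp
      rw [hd, sub_neg_eq_add, add_comm]
      congr 1
      refine Finset.sum_congr rfl fun i _ => ?_
      have hα : E * (α i : F) = φ (c i * v1) - c i * v1 := by
        simp only [α]; field_simp
      have hγ : E * (γ i : F) = φ (c i * v2) - c i * v2 := by
        simp only [γ]; field_simp
      rw [mul_add, mul_add, ← mul_assoc E (α i : F), ← mul_assoc E (γ i : F), hα, hγ, he', he, hE]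
      simp only [map_mul, map_add, (hK _).1 (x i).1.2, (hK _).1 (x i).2.2, hv1, hv2, ← hs]
      generalize φ a = A at *
      obtain rfl : a = - (A * w1 * w2) := by rw [hp]; ring
      ring
    rw [key, mul_eq_zero, or_iff_right hE0, ZeroMemClass.coe_eq_zero, sub_eq_zero]
  rw [hset, main]
  split_ifs
  · right; rfl
  · left; rfl

/-- the even case -/
lemma even_root {F : Type*} [Field F] [CharP F 2] (h : ℕ)
    (δ t : F) (hδ : δ ^ 2 ^ h = δ) (ht : t ^ 2 ^ h = t + 1)
    (hS : ∑ i ∈ range h, δ ^ 2 ^ i = 1) : ∃ y : F, y ^ 2 = y + δ ∧ y ^ 2 ^ h = y + 1 := by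
  have : Fact (Nat.Prime 2) := ⟨Nat.prime_two⟩
  have two : (2 : F) = 0 := CharTwo.two_eq_zero
  set θ := δ * t
  let S : ℕ → F := fun j => ∑ i ∈ range j, δ ^ 2 ^ i
  have hS1 : ∀ j, S (j + 1) = S j ^ 2 + δ := by
    intro j
    simp only [S]
    rw [Finset.sum_range_succ', sum_pow_char 2]
    simp only [← pow_mul, ← pow_succ, pow_zero, pow_one]
  have hSh : S h = 1 := hS
  have hS2 : S (2 * h) = 0 := by
    simp only [S]
    rw [two_mul, Finset.sum_range_add]
    simp only [pow_add, pow_mul, hδ, hS]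
    linear_combination two
  have hTh : ∑ i ∈ range (2 * h), θ ^ 2 ^ i = 1 := by
    rw [two_mul, Finset.sum_range_add, ← Finset.sum_add_distrib, ← hS]
    refine Finset.sum_congr rfl fun i _ => ?_
    simp only [pow_add, pow_mul, θ, mul_pow, hδ, ht]
    rw [add_pow_char_pow]
    linear_combination δ ^ 2 ^ i * t ^ 2 ^ i * two
  have hθ : ∑ i ∈ range (2 * h), θ ^ 2 ^ (i + 1) = 1 := by
    have : ∑ i ∈ range (2 * h), θ ^ 2 ^ (i + 1) = (∑ i ∈ range (2 * h), θ ^ 2 ^ i) ^ 2 := by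
      rw [sum_pow_char 2]
      simp only [← pow_mul, ← pow_succ]
    rw [this, hTh, one_pow]
  let y := ∑ j ∈ range (2 * h), θ ^ 2 ^ j * S j
  have hy : y ^ 2 = y + δ := by
    have e1 : y ^ 2 = ∑ j ∈ range (2 * h), (θ ^ 2 ^ (j + 1) * S (j + 1))
        + ∑ j ∈ range (2 * h), θ ^ 2 ^ (j + 1) * δ := by
      simp only [y]
      rw [sum_pow_char 2, ← Finset.sum_add_distrib]
      refine Finset.sum_congr rfl fun j _ => ?_
      rw [hS1, mul_pow, ← pow_mul, ← pow_succ]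
      linear_combination - θ ^ 2 ^ (j + 1) * δ * two
    have e2 : ∑ j ∈ range (2 * h), (θ ^ 2 ^ (j + 1) * S (j + 1)) = y := by
      have := Finset.sum_range_succ' (fun j => θ ^ 2 ^ j * S j) (2 * h)
      rw [Finset.sum_range_succ, hS2] at this
      have h0 : S 0 = 0 := by simp [S]
      rw [h0] at this
      simpa using this.symm
    rw [e1, e2, ← Finset.sum_mul, hθ, one_mul]
  refine ⟨y, hy, ?_⟩
  have : ∀ m, y ^ 2 ^ m = y + S m := by
    intro m
    induction m with
    | zero => simp [S]
    | succ m ih =>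
      rw [pow_succ, pow_mul, ih, add_pow_char, hy, hS1]; ring
  rw [this, hSh]

lemma roots_exist {F : Type*} [Field F] [Fintype F] (q p k : ℕ) [Fact p.Prime] [CharP F p]
    (hk : k ≠ 0) (hqp : q = p ^ k) (hF : Fintype.card F = q ^ 2)
    (φ : F →+* F) (hφq : ∀ x, φ x = x ^ q) (hφ : ∀ x, φ (φ x) = x)
    (a b : F) (ha : a ≠ 0) (hb : b ^ q ≠ b)
    (hab : (Odd q ∧
        ∃ s : F, s ≠ 0 ∧ s ^ q = s ∧ 4 * a ^ (q + 1) + (b ^ q - b) ^ 2 = s ^ 2) ∨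
      (Even q ∧ ∃ h : ℕ, q = 2 ^ h ∧
        ∑ i ∈ Finset.range h, (a ^ (q + 1) / (b ^ q + b) ^ 2) ^ 2 ^ i = 1)) :
    ∃ w1 w2 : F, w1 ≠ w2 ∧ w1 * φ w1 = 1 ∧ w2 * φ w2 = 1 ∧ φ a * (w1 + w2) = φ b - b ∧
      φ a * w1 * w2 = - a := by
  have hpp : p.Prime := Fact.out
  have hφa : φ a ≠ 0 := by simpa using ha
  simp only [pow_succ _ q, ← hφq] at hab hb
  rcases hab with ⟨ho, s, hs0, hs, hab⟩ | ⟨hev, h, hh, hab⟩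
  · have h2 : (2 : F) ≠ 0 := by
      intro h
      have h' : ((2 : ℕ) : F) = 0 := by exact_mod_cast h
      rw [CharP.cast_eq_zero_iff F p, Nat.prime_dvd_prime_iff_eq hpp Nat.prime_two] at h'
      subst h'
      rw [hqp, Nat.odd_pow_iff hk] at ho
      exact absurd ho (by decide)
    refine ⟨(φ b - b + s) / (2 * φ a), (φ b - b - s) / (2 * φ a), ?_, ?_, ?_, ?_, ?_⟩
    · intro h
      field_simp at h
      have : 2 * s = 0 := by linear_combination h
      simp [h2, hs0] at this
    · simp only [map_div₀, map_add, map_sub, map_mul, hφ, hs, map_ofNat]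
      field_simp
      linear_combination - hab
    · simp only [map_div₀, map_add, map_sub, map_mul, hφ, hs, map_ofNat]
      field_simp
      linear_combination - hab
    · field_simp
      ring
    · field_simp
      linear_combination hab
  · have hp2 : p = 2 := by
      have : 2 ∣ p ^ k := hqp ▸ hev.two_dvd
      exact ((Nat.prime_dvd_prime_iff_eq Nat.prime_two hpp).1
        (Nat.prime_two.dvd_of_dvd_pow this)).symm
    subst hp2
    have two : (2 : F) = 0 := CharTwo.two_eq_zero
    have hβ : φ b + b ≠ 0 := by
      intro h
      apply hb
      linear_combination h - b * two
    have hb' : φ (φ b + b) = φ b + b := by rw [map_add, hφ, add_comm]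
    obtain ⟨y, hy1, hy2⟩ := even_root h (φ a * a / (φ b + b) ^ 2) (b / (φ b + b))
      (by rw [← hh, ← hφq, map_div₀, map_mul, map_pow, hb', hφ, mul_comm])
      (by rw [← hh, ← hφq, map_div₀, hb']; field_simp; linear_combination - b * two) hab
    rw [← hh, ← hφq] at hy2
    generalize hβ' : φ b + b = β at *
    have hy3 : y ^ 2 * β ^ 2 = y * β ^ 2 + φ a * a := by
      rw [hy1]; field_simp
    refine ⟨β * y / φ a, β * (y + 1) / φ a, ?_, ?_, ?_, ?_, ?_⟩
    · intro h
      field_simp at h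
      have : (1 : F) = 0 := by linear_combination - h
      exact one_ne_zero this
    · simp only [map_div₀, map_mul, hφ, hb', hy2]
      field_simp
      linear_combination hy3 + y * β ^ 2 * two
    · simp only [map_div₀, map_mul, map_add, map_one, hφ, hb', hy2]
      field_simp
      linear_combination hy3 + (2 * y + 1) * β ^ 2 * two
    · field_simp
      linear_combination (β * y + b) * two - hβ'
    · field_simp
      linear_combination hy3 + (y * β ^ 2 + φ a * a) * two

/-- for `r ≥ 2` even, under the odd-square / even-trace hypothesis, the
multiset obtained from `B(a,b)` by adjoining `P∞ = (0,…,0,1)` with multiplicity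
`j = q^{r−1} − q^{r−2}` is a `3`-character multiset of `PG(r,q²)`: for every nonzero
`u = (u₀,(u₁,…,u_{r−1}),u_r) ∈ F^{r+1}`, the multiset intersection number
`#{x ∈ B(a,b) : u₀ + u₁x₁ + ⋯ + u_rx_r = 0} + j·[u_r = 0]` lies in
`{q^{r−1} − q^{r−2}, q^{2r−3} − q^{r−2}, q^{2r−3} − q^{r−2} + q^{r−1}}`. -/
theorem statement17 (q r : ℕ) (hq : IsPrimePow q) (hr : 2 ≤ r) (hreven : Even r)
    {F : Type*} [Field F] [Fintype F] [DecidableEq F] (hF : Fintype.card F = q ^ 2)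
    (a b : F) (ha : a ≠ 0) (hb : b ^ q ≠ b)
    (hab : (Odd q ∧
        ∃ s : F, s ≠ 0 ∧ s ^ q = s ∧ 4 * a ^ (q + 1) + (b ^ q - b) ^ 2 = s ^ 2) ∨
      (Even q ∧ ∃ h : ℕ, q = 2 ^ h ∧
        ∑ i ∈ Finset.range h, (a ^ (q + 1) / (b ^ q + b) ^ 2) ^ 2 ^ i = 1)) :
    ∀ u : F × (Fin (r - 1) → F) × F, u ≠ 0 →
      Set.ncard {x ∈ BSet q r a b |
          u.1 + (∑ i, u.2.1 i * x.1 i) + u.2.2 * x.2 = 0}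
        + (if u.2.2 = 0 then q ^ (r - 1) - q ^ (r - 2) else 0) ∈
      ({q ^ (r - 1) - q ^ (r - 2), q ^ (2 * r - 3) - q ^ (r - 2),
        q ^ (2 * r - 3) - q ^ (r - 2) + q ^ (r - 1)} : Set ℕ) := by
  have hq2 : 2 ≤ q := hq.two_le
  have hq' := hq
  rw [isPrimePow_nat_iff] at hq'
  obtain ⟨p, k, hp, hk, hqp⟩ := hq'
  have : Fact p.Prime := ⟨hp⟩
  have : CharP F p := by
    have hd : ringChar F ∣ p := by
      have h1 : ((Fintype.card F : ℕ) : F) = 0 := FiniteField.cast_card_eq_zero F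
      rw [hF, ← hqp, ← pow_mul] at h1
      push_cast at h1
      have h2 : ((p : ℕ) : F) = 0 := eq_zero_of_pow_eq_zero h1
      exact (CharP.cast_eq_zero_iff F (ringChar F) p).1 h2
    have h3 : ringChar F = p := by
      rcases (Nat.dvd_prime hp).1 hd with h | h
      · exact absurd h CharP.ringChar_ne_one
      · exact h
    rw [← h3]; infer_instance
  let φ : F →+* F := iterateFrobenius F p k
  have hφq : ∀ x, φ x = x ^ q := by
    intro x; rw [← hqp]; rfl
  have hφ : ∀ x, φ (φ x) = x := by
    intro x
    rw [hφq, hφq, ← pow_mul, ← sq, ← hF, FiniteField.pow_card]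
  let K : Subfield F := φ.eqLocusField (RingHom.id F)
  have hK : ∀ x, x ∈ K ↔ φ x = x := fun x => Iff.rfl
  have hKs : (K : Set F) = {x : F | x ^ q = x} := by
    ext x
    rw [SetLike.mem_coe, hK, hφq]; rfl
  have hKn : (K : Set F).ncard = q := by rw [hKs, fix_card_s17 q hq2 hF]
  have hcK : Nat.card K = q := hKn
  obtain ⟨w1, w2, hw, hw1, hw2, hs, hprod⟩ :=
    roots_exist q p k hk.ne' hqp.symm hF φ hφq hφ a b ha hb hab
  obtain ⟨v1, hv10, hv1⟩ := h90 q hq2 hF w1 (by rw [pow_succ', ← hφq, hw1])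
  obtain ⟨v2, hv20, hv2⟩ := h90 q hq2 hF w2 (by rw [pow_succ', ← hφq, hw2])
  rw [← hφq] at hv1 hv2
  obtain ⟨n, rfl⟩ : ∃ n, r = n + 2 := ⟨r - 2, by omega⟩
  rintro ⟨u0, u, ur⟩ hu
  have en1 : n + 2 - 1 = n + 1 := rfl
  have en2 : n + 2 - 2 = n := rfl
  have en3 : 2 * (n + 2) - 3 = 2 * n + 1 := by omega
  have hB : ∀ x : (Fin (n + 2 - 1) → F) × F, x ∈ BSet q (n + 2) a b ↔
      (φ x.2 - x.2) + ∑ i, (φ a * φ (x.1 i) ^ 2 - a * x.1 i ^ 2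
        - (φ b - b) * x.1 i * φ (x.1 i)) = 0 := by
    intro x
    have e1 : ∑ i, (φ a * φ (x.1 i) ^ 2 - a * x.1 i ^ 2
        - (φ b - b) * x.1 i * φ (x.1 i)) = a ^ q * (∑ i, x.1 i ^ (2 * q)) - a * (∑ i, x.1 i ^ 2)
        - (b ^ q - b) * ∑ i, x.1 i ^ (q + 1) := by
      simp only [Finset.mul_sum, ← Finset.sum_sub_distrib]
      refine Finset.sum_congr rfl fun i _ => ?_
      simp only [hφq]
      ring
    rw [e1, hφq]
    change _ = _ ↔ _
    rw [← sub_eq_zero]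
    constructor <;> intro h <;> linear_combination h
  simp only [en1, en2, en3, Set.mem_insert_iff, Set.mem_singleton_iff]
  by_cases hur : ur = 0
  · subst hur
    simp only [if_true, zero_mul, add_zero]
    let f : (Fin (n + 2 - 1) → F) → F := fun x => b * (∑ i, x i * φ (x i)) - a * ∑ i, x i ^ 2
    have hset : {x ∈ BSet q (n + 2) a b | u0 + ∑ i, u i * x.1 i = 0} =
        (fun z : (Fin (n + 2 - 1) → F) × F => (z.1, f z.1 + z.2)) ''
          ({x | ∑ i, u i * x i = - u0} ×ˢ (K : Set F)) := by
      have hf : ∀ x, ∑ i, (φ a * φ (x i) ^ 2 - a * x i ^ 2 - (φ b - b) * x i * φ (x i))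
          = f x - φ (f x) := by
        intro x
        simp only [f, map_sub, map_mul, map_sum, map_pow, hφ, Finset.mul_sum,
          ← Finset.sum_sub_distrib]
        exact Finset.sum_congr rfl fun i _ => by ring
      ext ⟨x, xr⟩
      simp only [Set.mem_ofPred_eq, Set.mem_image, Set.mem_prod, Prod.exists, Prod.mk.injEq,
        SetLike.mem_coe, hK, hB, hf]
      constructor
      · rintro ⟨h1, h2⟩
        refine ⟨x, xr - f x, ⟨by linear_combination h2, ?_⟩, rfl, by ring⟩
        rw [map_sub]
        linear_combination h1
      · rintro ⟨x', k, ⟨h1, h2⟩, rfl, rfl⟩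
        refine ⟨?_, by linear_combination h1⟩
        rw [map_add, h2]
        ring
    have hinj : Function.Injective
        (fun z : (Fin (n + 2 - 1) → F) × F => (z.1, f z.1 + z.2)) := by
      rintro ⟨x, k⟩ ⟨x', k'⟩ h
      simp only [Prod.mk.injEq] at h
      obtain ⟨rfl, h⟩ := h
      rw [add_left_cancel h]
    rw [hset, Set.ncard_image_of_injective _ hinj, Set.ncard_prod, hKn]
    by_cases hu' : u = 0
    · left
      subst hu'
      have hu0 : u0 ≠ 0 := by
        rintro rfl
        exact hu rfl
      have : {x : Fin (n + 2 - 1) → F | ∑ i, (0 : Fin (n + 2 - 1) → F) i * x i = - u0} = ∅ := by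
        ext x; simpa [eq_comm] using hu0
      rw [this]; simp
    · right; right
      have h1 := hyp_count_s17 (n + 2 - 1) u hu' (- u0)
      have h2 : {x : Fin (n + 2 - 1) → F | ∑ i, u i * x i = - u0}.ncard = (q ^ 2) ^ n := by
        rw [← hF, ← Set.ncard_coe_finset] at *
        simpa using h1
      rw [h2]
      have h3 : q ^ n ≤ q ^ (n + 1) := Nat.pow_le_pow_right (by omega) (by omega)
      have h4 : q ^ n ≤ q ^ (2 * n + 1) := Nat.pow_le_pow_right (by omega) (by omega)
      have h5 : (q ^ 2) ^ n * q = q ^ (2 * n + 1) := by rw [← pow_mul, pow_succ]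
      omega
  · simp only [if_neg hur, add_zero]
    have hc := core_count q hF φ hφ K hK hcK v1 v2 w1 w2 a (φ b - b) hv10 hv20 hw hv1 hv2 ha
      hw1 hw2 hs hprod (n + 2 - 1) (- u0 / ur) (fun i => - u i / ur)
    have hset : {x : Fin (n + 2 - 1) → F | (φ (- u0 / ur) - (- u0 / ur)) +
        ∑ i, (φ (- u i / ur * x i) - - u i / ur * x i
      + (φ a * φ (x i) ^ 2 - a * x i ^ 2 - (φ b - b) * x i * φ (x i))) = 0}.ncard
      = {x ∈ BSet q (n + 2) a b | u0 + ∑ i, u i * x.1 i + ur * x.2 = 0}.ncard := by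
      let g : (Fin (n + 2 - 1) → F) → F := fun x => - u0 / ur + ∑ i, - u i / ur * x i
      have hinj : Function.Injective (fun x : Fin (n + 2 - 1) → F => (x, g x)) := by
        intro x y h
        exact (Prod.ext_iff.1 h).1
      rw [← Set.ncard_image_of_injective _ hinj]
      congr 1
      ext ⟨x, xr⟩
      have hg : ur * g x = - u0 - ∑ i, u i * x i := by
        simp only [g, mul_add, Finset.mul_sum]
        rw [sub_eq_add_neg, ← Finset.sum_neg_distrib]
        congr 1
        · field_simp
        · exact Finset.sum_congr rfl fun i _ => by field_simp
      have hgx : (φ (- u0 / ur) - (- u0 / ur)) + ∑ i, (φ (- u i / ur * x i) - - u i / ur * x i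
          + (φ a * φ (x i) ^ 2 - a * x i ^ 2 - (φ b - b) * x i * φ (x i)))
          = (φ (g x) - g x) + ∑ i, (φ a * φ (x i) ^ 2 - a * x i ^ 2
            - (φ b - b) * x i * φ (x i)) := by
        rw [Finset.sum_add_distrib, Finset.sum_sub_distrib]
        simp only [g, map_add, map_sum]
        ring
      simp only [Set.mem_ofPred_eq, Set.mem_image, Prod.mk.injEq, hB]
      constructor
      · rintro ⟨x', h, rfl, rfl⟩
        rw [hgx] at h
        exact ⟨h, by rw [hg]; ring⟩
      · rintro ⟨h1, h2⟩
        have : xr = g x := by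
          apply mul_left_cancel₀ hur
          rw [hg]
          linear_combination h2
        subst this
        exact ⟨x, by rw [hgx]; exact h1, rfl, rfl⟩
    rw [hset] at hc
    have e : (q ^ (n + 2 - 1) - 1) * q ^ (n + 2 - 1 - 1) = q ^ (2 * n + 1) - q ^ n := by
      have : n + 2 - 1 - 1 = n := rfl
      rw [this, en1, Nat.sub_mul, one_mul, ← pow_add]
      congr 2; ring
    rw [e] at hc
    right
    exact hc
end
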